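/- arXiv:2306.05184 — 3 statements merged into one kernel-verified Lean document; each statement's English description precedes it below -/
import Mathlib

section
/- Let n ≥ 5 and let (u, p) be a smooth solution of the steady Navier-Stokes equations on ℝⁿ \ {0} with |u(x)| ≤ C/|x| for all x ≠ 0, where the pressure is normalized so that |p(x)| ≤ C′/|x|² for all x ≠ 0 (equivalently, p(x) → 0 as |x| → ∞). Then the total head pressure H = |u|²/2 + p satisfies H(x) ≤ 0 for all x ∈ ℝⁿ \ {0}. -/
open scoped ContDiff Topology

/-- The partial derivative of `f` in the `i`-th coordinate direction. -/
noncomputable def coordDeriv {n : ℕ} (i : Fin n) (f : EuclideanSpace ℝ (Fin n) → ℝ)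
    (x : EuclideanSpace ℝ (Fin n)) : ℝ :=
  fderiv ℝ f x (EuclideanSpace.single i 1)

/-- Smoothness at every point of `ℝⁿ \ {0}`. -/
def SmoothOffZero {n : ℕ} (f : EuclideanSpace ℝ (Fin n) → ℝ) : Prop :=
  ∀ x, x ≠ 0 → ContDiffAt ℝ ∞ f x

section Calculus

variable {n : ℕ} {f g : EuclideanSpace ℝ (Fin n) → ℝ} {x : EuclideanSpace ℝ (Fin n)}

lemma ContDiffAt.coordDeriv (hf : ContDiffAt ℝ ∞ f x) (i : Fin n) :
    ContDiffAt ℝ ∞ (coordDeriv i f) x :=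
  (hf.fderiv_right (m := ∞) (by simp)).clm_apply contDiffAt_const

lemma SmoothOffZero.coordDeriv (hf : SmoothOffZero f) (i : Fin n) :
    SmoothOffZero (coordDeriv i f) :=
  fun x hx => (hf x hx).coordDeriv i

lemma Filter.EventuallyEq.coordDeriv (h : f =ᶠ[𝓝 x] g) (i : Fin n) :
    coordDeriv i f =ᶠ[𝓝 x] coordDeriv i g := by
  filter_upwards [h.fderiv (𝕜 := ℝ)] with y hy
  simp only [_root_.coordDeriv, hy]

lemma coordDeriv_congr_off_zero (h : ∀ y, y ≠ 0 → f y = g y) (hx : x ≠ 0) (i : Fin n) :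
    coordDeriv i f x = coordDeriv i g x := by
  have : f =ᶠ[𝓝 x] g := by
    filter_upwards [isOpen_ne.mem_nhds hx] with y hy using h y hy
  exact (this.coordDeriv i).eq_of_nhds

lemma coordDeriv_const (c : ℝ) (i : Fin n) :
    coordDeriv i (fun _ => c) x = 0 := by
  simp [coordDeriv]

lemma coordDeriv_add (hf : ContDiffAt ℝ ∞ f x) (hg : ContDiffAt ℝ ∞ g x) (i : Fin n) :
    coordDeriv i (fun y => f y + g y) x = coordDeriv i f x + coordDeriv i g x := by
  simp [coordDeriv, fderiv_fun_add (hf.differentiableAt (by simp)) (hg.differentiableAt (by simp))]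

lemma coordDeriv_sub (hf : ContDiffAt ℝ ∞ f x) (hg : ContDiffAt ℝ ∞ g x) (i : Fin n) :
    coordDeriv i (fun y => f y - g y) x = coordDeriv i f x - coordDeriv i g x := by
  simp [coordDeriv, fderiv_fun_sub (hf.differentiableAt (by simp)) (hg.differentiableAt (by simp))]

lemma coordDeriv_mul (hf : ContDiffAt ℝ ∞ f x) (hg : ContDiffAt ℝ ∞ g x) (i : Fin n) :
    coordDeriv i (fun y => f y * g y) x = f x * coordDeriv i g x + coordDeriv i f x * g x := by
  simp [coordDeriv, fderiv_fun_mul (hf.differentiableAt (by simp)) (hg.differentiableAt (by simp))]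
  ring

lemma coordDeriv_sum {ι : Type*} (s : Finset ι) {F : ι → EuclideanSpace ℝ (Fin n) → ℝ}
    (hF : ∀ j, ContDiffAt ℝ ∞ (F j) x) (i : Fin n) :
    coordDeriv i (fun y => ∑ j ∈ s, F j y) x = ∑ j ∈ s, coordDeriv i (F j) x := by
  simp [coordDeriv, fderiv_fun_sum (fun j _ => (hF j).differentiableAt (by simp))]

lemma coordDeriv_comp {G : ℝ → ℝ} (hG : ContDiff ℝ ∞ G) (hf : ContDiffAt ℝ ∞ f x) (i : Fin n) :
    coordDeriv i (fun y => G (f y)) x = deriv G (f x) * coordDeriv i f x := by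
  have h1 := (hG.differentiable (by simp) (f x)).hasDerivAt
  have h2 := (hf.differentiableAt (by simp)).hasFDerivAt
  have := (h1.comp_hasFDerivAt x h2).fderiv
  simp only [Function.comp_def] at this
  simp [coordDeriv, this]

lemma coordDeriv_comm (hf : ContDiffAt ℝ ∞ f x) (i j : Fin n) :
    coordDeriv i (coordDeriv j f) x = coordDeriv j (coordDeriv i f) x := by
  have hs : IsSymmSndFDerivAt ℝ f x := hf.isSymmSndFDerivAt
    (by simpa using WithTop.coe_le_coe.2 (le_top : (2 : ℕ∞) ≤ ⊤))
  have hd : DifferentiableAt ℝ (fderiv ℝ f) x :=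
    (hf.fderiv_right (m := ∞) (by simp)).differentiableAt (by simp)
  have key : ∀ k l : Fin n, coordDeriv k (coordDeriv l f) x =
      fderiv ℝ (fderiv ℝ f) x (EuclideanSpace.single k 1) (EuclideanSpace.single l 1) := by
    intro k l
    change fderiv ℝ (fun y => fderiv ℝ f y (EuclideanSpace.single l 1)) x _ = _
    rw [fderiv_clm_apply hd (differentiableAt_const _)]
    simp
  rw [key, key, hs.eq]

lemma coordDeriv_comp_smul (c : ℝ) (i : Fin n) :
    coordDeriv i (fun y => f (c • y)) x = c * coordDeriv i f (c • x) := by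
  have := fderiv_comp_smul (𝕜 := ℝ) (f := f) (x := x) c
  simp [coordDeriv, this]

lemma integral_coordDeriv_eq_zero (hf : ContDiff ℝ ∞ f) (hc : HasCompactSupport f) (i : Fin n) :
    MeasureTheory.Integrable (coordDeriv i f) ∧ ∫ x, coordDeriv i f x = 0 := by
  have hcont : Continuous (coordDeriv i f) :=
    (contDiff_iff_contDiffAt.2 fun x => (hf.contDiffAt (x := x)).coordDeriv i).continuous
  have hLint : MeasureTheory.Integrable (coordDeriv i f) :=
    hcont.integrable_of_hasCompactSupport (hc.fderiv_apply (𝕜 := ℝ) _)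
  refine ⟨hLint, ?_⟩
  have := integral_mul_fderiv_eq_neg_fderiv_mul_of_integrable (𝕜 := ℝ)
    (μ := MeasureTheory.volume) (f := fun _ => (1 : ℝ)) (g := f)
    (v := EuclideanSpace.single i 1) (by simp)
    (by simp only [one_mul]; exact hLint)
    (by simpa using hf.continuous.integrable_of_hasCompactSupport hc)
    (fun _ _ => differentiableAt_const _) (fun x _ => hf.differentiable (by simp) x)
  simpa [coordDeriv] using this

end Calculus

section Bernoulli

variable {n : ℕ} {u : Fin n → EuclideanSpace ℝ (Fin n) → ℝ} {p : EuclideanSpace ℝ (Fin n) → ℝ}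

lemma laplacian_pressure_eq (hu : ∀ j, SmoothOffZero (u j))
    (hNS : ∀ x, x ≠ 0 → ∀ j, coordDeriv j p x =
      ∑ i, (coordDeriv i (coordDeriv i (u j)) x - u i x * coordDeriv i (u j) x))
    (hdiv : ∀ x, x ≠ 0 → ∑ i, coordDeriv i (u i) x = 0)
    {x : EuclideanSpace ℝ (Fin n)} (hx : x ≠ 0) :
    ∑ j, coordDeriv j (coordDeriv j p) x =
      -∑ j, ∑ i, coordDeriv j (u i) x * coordDeriv i (u j) x := by
  have h1 : ∀ j, coordDeriv j (coordDeriv j p) x = ∑ i,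
      (coordDeriv i (coordDeriv i (coordDeriv j (u j))) x
        - (u i x * coordDeriv i (coordDeriv j (u j)) x
          + coordDeriv j (u i) x * coordDeriv i (u j) x)) := by
    intro j
    have hD : ∀ i k, SmoothOffZero (coordDeriv i (u k)) := fun i k => (hu k).coordDeriv i
    have hDD : ∀ i k, SmoothOffZero (coordDeriv i (coordDeriv i (u k))) :=
      fun i k => (hD i k).coordDeriv i
    rw [coordDeriv_congr_off_zero (fun y hy => hNS y hy j) hx,
      coordDeriv_sum _ (fun i => (hDD i j x hx).sub ((hu i x hx).mul (hD i j x hx)))]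
    refine Finset.sum_congr rfl fun i _ => ?_
    rw [coordDeriv_sub (hDD i j x hx) ((hu i x hx).mul (hD i j x hx)),
      coordDeriv_mul (hu i x hx) (hD i j x hx), coordDeriv_comm (hD i j x hx) j i,
      coordDeriv_comm (hu j x hx) j i,
      coordDeriv_congr_off_zero (fun y hy => coordDeriv_comm (hu j y hy) j i) hx i]
  have h2 : ∀ y, y ≠ 0 → ∀ i, ∑ j, coordDeriv i (coordDeriv j (u j)) y = 0 := by
    intro y hy i
    rw [← coordDeriv_sum _ (fun j => (hu j y hy).coordDeriv j),
      coordDeriv_congr_off_zero hdiv hy, coordDeriv_const]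
  have h3 : ∀ i, ∑ j, coordDeriv i (coordDeriv i (coordDeriv j (u j))) x = 0 := by
    intro i
    rw [← coordDeriv_sum _ (fun j => ((hu j x hx).coordDeriv j).coordDeriv i),
      coordDeriv_congr_off_zero (fun y hy => h2 y hy i) hx, coordDeriv_const]
  simp only [h1, Finset.sum_sub_distrib, Finset.sum_add_distrib]
  rw [Finset.sum_comm, Finset.sum_congr rfl (fun i _ => h3 i), Finset.sum_comm]
  simp only [← Finset.mul_sum, h2 x hx]
  simp

/-- The total head pressure is a subsolution of the drift-diffusion equation. -/
lemma total_head_pressure_subsolution (hu : ∀ j, SmoothOffZero (u j)) (hp : SmoothOffZero p)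
    (hNS : ∀ x, x ≠ 0 → ∀ j, coordDeriv j p x =
      ∑ i, (coordDeriv i (coordDeriv i (u j)) x - u i x * coordDeriv i (u j) x))
    (hdiv : ∀ x, x ≠ 0 → ∑ i, coordDeriv i (u i) x = 0)
    {H : EuclideanSpace ℝ (Fin n) → ℝ} (hH : H = fun x => ∑ j, u j x * u j x * (1 / 2) + p x)
    {x : EuclideanSpace ℝ (Fin n)} (hx : x ≠ 0) :
    0 ≤ ∑ i, (coordDeriv i (coordDeriv i H) x - u i x * coordDeriv i H x) := by
  have h1 : ∀ y, y ≠ 0 → ∀ i, coordDeriv i H y =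
      ∑ j, u j y * coordDeriv i (u j) y + coordDeriv i p y := by
    intro y hy i
    have hq : ∀ j, ContDiffAt ℝ ∞ (fun x => u j x * u j x * (1 / 2)) y :=
      fun j => ((hu j y hy).mul (hu j y hy)).mul contDiffAt_const
    rw [hH, coordDeriv_add (ContDiffAt.sum fun j _ => hq j) (hp y hy), coordDeriv_sum _ hq]
    congr 1
    refine Finset.sum_congr rfl fun j _ => ?_
    rw [coordDeriv_mul ((hu j y hy).mul (hu j y hy)) contDiffAt_const,
      coordDeriv_mul (hu j y hy) (hu j y hy), coordDeriv_const]
    ring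
  have h2 : ∀ i, coordDeriv i (coordDeriv i H) x =
      ∑ j, (u j x * coordDeriv i (coordDeriv i (u j)) x
        + coordDeriv i (u j) x * coordDeriv i (u j) x) + coordDeriv i (coordDeriv i p) x := by
    intro i
    have hq : ∀ j, ContDiffAt ℝ ∞ (fun y => u j y * coordDeriv i (u j) y) x :=
      fun j => (hu j x hx).mul ((hu j x hx).coordDeriv i)
    rw [coordDeriv_congr_off_zero (fun y hy => h1 y hy i) hx,
      coordDeriv_add (ContDiffAt.sum fun j _ => hq j) ((hp x hx).coordDeriv i),
      coordDeriv_sum _ hq]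
    congr 1
    exact Finset.sum_congr rfl fun j _ => coordDeriv_mul (hu j x hx) ((hu j x hx).coordDeriv i) i
  have h3 : ∑ i, (coordDeriv i (coordDeriv i H) x - u i x * coordDeriv i H x) =
      ∑ i, ∑ j, (coordDeriv i (u j) x - coordDeriv j (u i) x) ^ 2 / 2 := by
    have e1 : ∑ i, u i x * coordDeriv i p x =
        ∑ i, ∑ j, (u j x * coordDeriv i (coordDeriv i (u j)) x
          - u j x * u i x * coordDeriv i (u j) x) := by
      rw [Finset.sum_comm]
      refine Finset.sum_congr rfl fun j _ => ?_
      rw [hNS x hx, Finset.mul_sum]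
      exact Finset.sum_congr rfl fun i _ => by ring
    have e2 := laplacian_pressure_eq hu hNS hdiv hx
    have e3 : ∑ i, ∑ j, coordDeriv j (u i) x * coordDeriv j (u i) x =
        ∑ i, ∑ j, coordDeriv i (u j) x * coordDeriv i (u j) x := Finset.sum_comm
    have e4 : ∑ i, ∑ j, (coordDeriv i (u j) x - coordDeriv j (u i) x) ^ 2 / 2 =
        1 / 2 * ∑ i, ∑ j, coordDeriv i (u j) x * coordDeriv i (u j) x
        + 1 / 2 * ∑ i, ∑ j, coordDeriv j (u i) x * coordDeriv j (u i) x
        - ∑ j, ∑ i, coordDeriv j (u i) x * coordDeriv i (u j) x := by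
      simp only [Finset.mul_sum, ← Finset.sum_add_distrib, ← Finset.sum_sub_distrib]
      exact Finset.sum_congr rfl fun i _ => Finset.sum_congr rfl fun j _ => by ring
    rw [e4, e3]
    simp only [h1 x hx, h2, mul_add, Finset.sum_sub_distrib, Finset.sum_add_distrib, e1, e2,
      Finset.mul_sum]
    simp only [← mul_assoc, mul_comm (u _ x) (u _ x)]
    have e5 : ∀ a : Fin n → Fin n → ℝ, ∑ i, ∑ j, 1 / 2 * a i j = 1 / 2 * ∑ i, ∑ j, a i j := by
      intro a; simp only [Finset.mul_sum]
    simp only [mul_assoc, e5]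
    ring_nf
  rw [h3]
  positivity

end Bernoulli

section Liouville

variable {n : ℕ}

lemma exists_scaled_cutoffs (n : ℕ) : ∃ A : ℝ, 0 ≤ A ∧ ∀ ε : ℝ, 0 < ε →
    ∃ η : EuclideanSpace ℝ (Fin n) → ℝ, ContDiff ℝ ∞ η ∧ (∀ x, 0 ≤ η x) ∧ (∀ x, η x ≤ 1) ∧
      (∀ x, ‖x‖ ≤ ε → η x = 0) ∧ (∀ x, 2 * ε ≤ ‖x‖ → η x = 1) ∧
      (∀ i x, |coordDeriv i η x| ≤ A / ε) ∧
      (∀ i x, |coordDeriv i (coordDeriv i η) x| ≤ A / ε ^ 2) := by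
  let b : ContDiffBump (0 : EuclideanSpace ℝ (Fin n)) := ⟨1, 2, one_pos, one_lt_two⟩
  let ζ : EuclideanSpace ℝ (Fin n) → ℝ := fun x => 1 - b x
  have hb : ContDiff ℝ ∞ b := b.contDiff
  have hζ : ContDiff ℝ ∞ ζ := contDiff_const.sub hb
  have hζb : ∀ i, coordDeriv i ζ = fun x => -coordDeriv i b x := by
    intro i
    ext x
    simp [ζ, coordDeriv, fderiv_const_sub]
  have hsmooth : ∀ i {f : EuclideanSpace ℝ (Fin n) → ℝ}, ContDiff ℝ ∞ f →
      ContDiff ℝ ∞ (coordDeriv i f) := fun i f hf =>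
    contDiff_iff_contDiffAt.2 fun x => hf.contDiffAt.coordDeriv i
  have hsupp : ∀ i {f : EuclideanSpace ℝ (Fin n) → ℝ}, HasCompactSupport f →
      HasCompactSupport (coordDeriv i f) := fun i f hf => hf.fderiv_apply (𝕜 := ℝ) _
  have hcs : ∀ i, HasCompactSupport (coordDeriv i ζ) := by
    intro i
    rw [hζb]
    exact (hsupp i b.hasCompactSupport).neg
  choose A1 hA1 using fun i =>
    (hcs i).exists_bound_of_continuous (hsmooth i hζ).continuous
  choose A2 hA2 using fun i =>
    (hsupp i (hcs i)).exists_bound_of_continuous (hsmooth i (hsmooth i hζ)).continuous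
  refine ⟨∑ i, (|A1 i| + |A2 i|), by positivity, fun ε hε => ?_⟩
  have hA : ∀ i, |A1 i| + |A2 i| ≤ ∑ i, (|A1 i| + |A2 i|) := fun i =>
    Finset.single_le_sum (f := fun i => |A1 i| + |A2 i|) (fun _ _ => by positivity)
      (Finset.mem_univ i)
  have hnorm : ∀ x : EuclideanSpace ℝ (Fin n), ‖ε⁻¹ • x‖ = ‖x‖ / ε := by
    intro x
    rw [norm_smul, Real.norm_of_nonneg (by positivity)]
    field_simp
  have hd : ∀ i, coordDeriv i (fun x => ζ (ε⁻¹ • x)) =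
      fun x => ε⁻¹ * coordDeriv i ζ (ε⁻¹ • x) := fun i => funext fun x =>
    coordDeriv_comp_smul ε⁻¹ i
  refine ⟨fun x => ζ (ε⁻¹ • x), hζ.comp (contDiff_const_smul _), fun x => sub_nonneg.2 b.le_one,
    fun x => sub_le_self _ b.nonneg, fun x hx => ?_, fun x hx => ?_, fun i x => ?_, fun i x => ?_⟩
  · have : b (ε⁻¹ • x) = 1 := b.one_of_mem_closedBall (by
      rw [mem_closedBall_zero_iff, hnorm]; exact (div_le_one hε).2 hx)
    simp [ζ, this]
  · have : b (ε⁻¹ • x) = 0 := b.zero_of_le_dist (by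
      rw [dist_zero_right, hnorm]; exact (le_div_iff₀ hε).2 hx)
    simp [ζ, this]
  · rw [hd, abs_mul, abs_of_pos (by positivity : 0 < ε⁻¹), div_eq_inv_mul]
    gcongr
    have := hA1 i (ε⁻¹ • x)
    rw [Real.norm_eq_abs] at this
    linarith [hA i, le_abs_self (A1 i), abs_nonneg (A2 i)]
  · rw [hd]
    have : coordDeriv i (fun x => ε⁻¹ * coordDeriv i ζ (ε⁻¹ • x)) x =
        ε⁻¹ * (ε⁻¹ * coordDeriv i (coordDeriv i ζ) (ε⁻¹ • x)) := by
      have hg : ContDiffAt ℝ ∞ (fun x => coordDeriv i ζ (ε⁻¹ • x)) x :=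
        ((hsmooth i hζ).comp (contDiff_const_smul _)).contDiffAt
      rw [coordDeriv_mul contDiffAt_const hg, coordDeriv_const,
        coordDeriv_comp_smul]
      ring
    rw [this, ← mul_assoc, abs_mul, abs_of_pos (by positivity : 0 < ε⁻¹ * ε⁻¹),
      show ∀ a : ℝ, a / ε ^ 2 = ε⁻¹ * ε⁻¹ * a by intro a; field_simp]
    gcongr
    have := hA2 i (ε⁻¹ • x)
    rw [Real.norm_eq_abs] at this
    linarith [hA i, le_abs_self (A2 i), abs_nonneg (A1 i)]

variable {u : Fin n → EuclideanSpace ℝ (Fin n) → ℝ} {W η : EuclideanSpace ℝ (Fin n) → ℝ}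

/-- Integration by parts against a test function vanishing near the origin. -/
lemma integral_test_drift_diffusion (hu : ∀ j, SmoothOffZero (u j))
    (hdiv : ∀ x, x ≠ 0 → ∑ i, coordDeriv i (u i) x = 0) (hW : SmoothOffZero W) {R : ℝ}
    (hWR : ∀ x, R < ‖x‖ → W x = 0) (hη : ContDiff ℝ ∞ η) (hη0 : η =ᶠ[𝓝 0] fun _ => 0) :
    MeasureTheory.Integrable
      (fun x => η x * ∑ i, (coordDeriv i (coordDeriv i W) x - u i x * coordDeriv i W x)) ∧
    Continuous
      (fun x => η x * ∑ i, (coordDeriv i (coordDeriv i W) x - u i x * coordDeriv i W x)) ∧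
    ∫ x, η x * ∑ i, (coordDeriv i (coordDeriv i W) x - u i x * coordDeriv i W x) =
      ∫ x, W x * ∑ i, (coordDeriv i (coordDeriv i η) x + u i x * coordDeriv i η x) := by
  have hWout : ∀ x, R < ‖x‖ → W =ᶠ[𝓝 x] fun _ => 0 := fun x hx => by
    filter_upwards [(isOpen_lt continuous_const continuous_norm).mem_nhds hx] with y hy
    exact hWR y hy
  have hdz : ∀ {f : EuclideanSpace ℝ (Fin n) → ℝ} {x}, f =ᶠ[𝓝 x] (fun _ => 0) →
      ∀ i, coordDeriv i f =ᶠ[𝓝 x] fun _ => 0 := by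
    intro f x h i
    refine (h.coordDeriv i).trans (Filter.Eventually.of_forall fun y => ?_)
    exact coordDeriv_const 0 i
  have hηs : ∀ x, ContDiffAt ℝ ∞ η x := fun x => hη.contDiffAt
  let L : EuclideanSpace ℝ (Fin n) → ℝ := fun x =>
    η x * ∑ i, (coordDeriv i (coordDeriv i W) x - u i x * coordDeriv i W x)
  let V : Fin n → EuclideanSpace ℝ (Fin n) → ℝ := fun i x =>
    η x * coordDeriv i W x - W x * coordDeriv i η x - u i x * (W x * η x)
  have hL0 : L =ᶠ[𝓝 0] fun _ => 0 := by
    filter_upwards [hη0] with x hx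
    simp [L, hx]
  have hV0 : ∀ i, V i =ᶠ[𝓝 0] fun _ => 0 := by
    intro i
    filter_upwards [hη0, hdz hη0 i] with x hx hx'
    simp [V, hx, hx']
  have hLs : ContDiff ℝ ∞ L := by
    refine contDiff_iff_contDiffAt.2 fun x => ?_
    by_cases hx : x = 0
    · subst hx
      exact contDiffAt_const.congr_of_eventuallyEq hL0
    · exact (hηs x).mul (ContDiffAt.sum fun i _ =>
        (((hW x hx).coordDeriv i).coordDeriv i).sub ((hu i x hx).mul ((hW x hx).coordDeriv i)))
  have hVs : ∀ i, ContDiff ℝ ∞ (V i) := by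
    refine fun i => contDiff_iff_contDiffAt.2 fun x => ?_
    by_cases hx : x = 0
    · subst hx
      exact contDiffAt_const.congr_of_eventuallyEq (hV0 i)
    · exact (((hηs x).mul ((hW x hx).coordDeriv i)).sub
        ((hW x hx).mul ((hηs x).coordDeriv i))).sub ((hu i x hx).mul ((hW x hx).mul (hηs x)))
  have hout : ∀ x, x ∉ Metric.closedBall (0 : EuclideanSpace ℝ (Fin n)) R → R < ‖x‖ := by
    intro x hx
    simpa using hx
  have hLc : HasCompactSupport L := by
    refine HasCompactSupport.intro (isCompact_closedBall 0 R) fun x hx => ?_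
    have h := hWout x (hout x hx)
    simp [L, fun i => (hdz h i).eq_of_nhds, fun i => (hdz (hdz h i) i).eq_of_nhds]
  have hVc : ∀ i, HasCompactSupport (V i) := by
    refine fun i => HasCompactSupport.intro (isCompact_closedBall 0 R) fun x hx => ?_
    have h := hWout x (hout x hx)
    simp [V, (hdz h i).eq_of_nhds, h.eq_of_nhds]
  have hLi := hLs.continuous.integrable_of_hasCompactSupport hLc (μ := MeasureTheory.volume)
  refine ⟨hLi, hLs.continuous, ?_⟩
  have hpt : ∀ x, W x * ∑ i, (coordDeriv i (coordDeriv i η) x + u i x * coordDeriv i η x) =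
      L x - ∑ i, coordDeriv i (V i) x := by
    intro x
    by_cases hx : x = 0
    · subst hx
      simp [hL0.eq_of_nhds, fun i => (hdz (hV0 i) i).eq_of_nhds,
        fun i => (hdz hη0 i).eq_of_nhds, fun i => (hdz (hdz hη0 i) i).eq_of_nhds]
    · have hWx := hW x hx
      have hV : ∀ i, coordDeriv i (V i) x =
          η x * (coordDeriv i (coordDeriv i W) x - u i x * coordDeriv i W x)
          - W x * (coordDeriv i (coordDeriv i η) x + u i x * coordDeriv i η x)
          - W x * η x * coordDeriv i (u i) x := by
        intro i
        rw [coordDeriv_sub (((hηs x).mul (hWx.coordDeriv i)).sub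
            (hWx.mul ((hηs x).coordDeriv i))) ((hu i x hx).mul (hWx.mul (hηs x))),
          coordDeriv_sub ((hηs x).mul (hWx.coordDeriv i)) (hWx.mul ((hηs x).coordDeriv i)),
          coordDeriv_mul (hηs x) (hWx.coordDeriv i), coordDeriv_mul hWx ((hηs x).coordDeriv i),
          coordDeriv_mul (hu i x hx) (hWx.mul (hηs x)), coordDeriv_mul hWx (hηs x)]
        ring
      have hsum : ∑ i, coordDeriv i (V i) x = L x
          - W x * ∑ i, (coordDeriv i (coordDeriv i η) x + u i x * coordDeriv i η x)
          - W x * η x * ∑ i, coordDeriv i (u i) x := by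
        simp only [L, hV, Finset.mul_sum]
        rw [Finset.sum_sub_distrib, Finset.sum_sub_distrib]
      rw [hsum, hdiv x hx]
      ring
  have hVi := fun i => integral_coordDeriv_eq_zero (hVs i) (hVc i) i
  simp only [hpt]
  rw [MeasureTheory.integral_sub hLi (MeasureTheory.integrable_finsetSum _ fun i _ => (hVi i).1),
    MeasureTheory.integral_finsetSum _ fun i _ => (hVi i).1]
  simp [fun i => (hVi i).2, L]

/-- A nonnegative subsolution on `ℝⁿ \ {0}`, `n ≥ 5`, with at most inverse-square growth at the
origin and vanishing near infinity, is a solution. -/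
lemma subsolution_eq_zero (hn : 5 ≤ n) (hu : ∀ j, SmoothOffZero (u j))
    (hdiv : ∀ x, x ≠ 0 → ∑ i, coordDeriv i (u i) x = 0) {C : ℝ}
    (huC : ∀ x, x ≠ 0 → ∀ i, |u i x| ≤ C / ‖x‖)
    (hW : SmoothOffZero W) {R K : ℝ} (hK : 0 ≤ K) (hC : 0 ≤ C)
    (hWR : ∀ x, R < ‖x‖ → W x = 0) (hWK : ∀ x, x ≠ 0 → |W x| ≤ K / ‖x‖ ^ 2)
    (hsub : ∀ x, x ≠ 0 →
      0 ≤ ∑ i, (coordDeriv i (coordDeriv i W) x - u i x * coordDeriv i W x))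
    {x : EuclideanSpace ℝ (Fin n)} (hx : x ≠ 0) :
    ∑ i, (coordDeriv i (coordDeriv i W) x - u i x * coordDeriv i W x) = 0 := by
  obtain ⟨A, hA, hcut⟩ := exists_scaled_cutoffs n
  have hnear : ∀ {ε : ℝ} {η : EuclideanSpace ℝ (Fin n) → ℝ}, 0 < ε →
      (∀ x, ‖x‖ ≤ ε → η x = 0) → η =ᶠ[𝓝 0] fun _ => 0 := by
    intro ε η hε h
    filter_upwards [Metric.closedBall_mem_nhds 0 hε] with y hy
    exact h y (by simpa using hy)
  set v := MeasureTheory.volume.real (Metric.closedBall (0 : EuclideanSpace ℝ (Fin n)) 1) with hv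
  set M := K * (n * (A + C * A)) * (2 ^ n * v) with hM
  have hbound : ∀ ε : ℝ, 0 < ε → ε ≤ 1 → ∀ η : EuclideanSpace ℝ (Fin n) → ℝ,
      ContDiff ℝ ∞ η → (∀ x, ‖x‖ ≤ ε → η x = 0) → (∀ x, 2 * ε ≤ ‖x‖ → η x = 1) →
      (∀ i x, |coordDeriv i η x| ≤ A / ε) →
      (∀ i x, |coordDeriv i (coordDeriv i η) x| ≤ A / ε ^ 2) →
      ∫ x, η x * ∑ i, (coordDeriv i (coordDeriv i W) x - u i x * coordDeriv i W x)
        ≤ M * ε := by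
    intro ε hε hε1 η hη hη0 hη1 hd1 hd2
    rw [(integral_test_drift_diffusion hu hdiv hW hWR hη (hnear hε hη0)).2.2]
    have hlc : ∀ {c : ℝ} {x : EuclideanSpace ℝ (Fin n)}, η =ᶠ[𝓝 x] (fun _ => c) →
        ∑ i, (coordDeriv i (coordDeriv i η) x + u i x * coordDeriv i η x) = 0 := by
      intro c x h
      have h1 : ∀ i, coordDeriv i η =ᶠ[𝓝 x] fun _ => 0 := fun i =>
        (h.coordDeriv i).trans (Filter.Eventually.of_forall fun y => coordDeriv_const c i)
      have h2 : ∀ i, coordDeriv i (coordDeriv i η) x = 0 := fun i =>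
        ((h1 i).coordDeriv i).eq_of_nhds.trans (coordDeriv_const 0 i)
      simp [h2, fun i => (h1 i).eq_of_nhds]
    have hzero : ∀ x, x ∉ Metric.closedBall (0 : EuclideanSpace ℝ (Fin n)) (2 * ε) →
        W x * ∑ i, (coordDeriv i (coordDeriv i η) x + u i x * coordDeriv i η x) = 0 := by
      intro x hx
      have hx' : 2 * ε < ‖x‖ := by simpa using hx
      rw [hlc (c := 1), mul_zero]
      filter_upwards [(isOpen_lt continuous_const continuous_norm).mem_nhds hx'] with y hy
      exact hη1 y (le_of_lt hy)
    have hpt : ∀ x, ‖W x * ∑ i, (coordDeriv i (coordDeriv i η) x + u i x * coordDeriv i η x)‖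
        ≤ K / ε ^ 2 * (n * ((A + C * A) / ε ^ 2)) := by
      intro x
      by_cases hxε : ‖x‖ < ε
      · rw [hlc (c := 0), mul_zero, norm_zero]
        · positivity
        · filter_upwards [(isOpen_lt continuous_norm continuous_const).mem_nhds hxε] with y hy
          exact hη0 y (le_of_lt hy)
      · have hxε := not_lt.1 hxε
        have hx0 : x ≠ 0 := norm_pos_iff.1 (hε.trans_le hxε)
        rw [norm_mul]
        gcongr
        · exact (hWK x hx0).trans (by gcongr)
        · refine (norm_sum_le_of_le (f := fun i => coordDeriv i (coordDeriv i η) x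
            + u i x * coordDeriv i η x) Finset.univ
            (n := fun _ => (A + C * A) / ε ^ 2) fun i _ => ?_).trans (by simp)
          rw [Real.norm_eq_abs]
          have h1 : |u i x * coordDeriv i η x| ≤ C / ε * (A / ε) := by
            rw [abs_mul]
            gcongr
            · exact (huC x hx0 i).trans (by gcongr)
            · exact hd1 i x
          have h2 : C / ε * (A / ε) = C * A / ε ^ 2 := by field_simp
          rw [add_div]
          exact (abs_add_le _ _).trans (add_le_add (hd2 i x) (h1.trans_eq h2))
    have hvol : MeasureTheory.volume.real
        (Metric.closedBall (0 : EuclideanSpace ℝ (Fin n)) (2 * ε)) = (2 * ε) ^ n * v := by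
      rw [MeasureTheory.Measure.addHaar_real_closedBall' _ _ (by positivity)]
      simp [hv]
    rw [← MeasureTheory.setIntegral_eq_integral_of_forall_compl_eq_zero hzero]
    refine (Real.le_norm_self _).trans
      ((MeasureTheory.norm_setIntegral_le_of_norm_le_const
        MeasureTheory.measure_closedBall_lt_top fun x _ => hpt x).trans ?_)
    rw [hvol]
    have h5 : ε ^ n ≤ ε ^ 5 := pow_le_pow_of_le_one hε.le hε1 hn
    have hv0 : 0 ≤ v := MeasureTheory.measureReal_nonneg
    calc K / ε ^ 2 * (n * ((A + C * A) / ε ^ 2)) * ((2 * ε) ^ n * v)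
        = M / ε ^ 4 * ε ^ n := by rw [hM, mul_pow]; field_simp
      _ ≤ M / ε ^ 4 * ε ^ 5 := by gcongr
      _ = M * ε := by field_simp
  have hr : 0 < ‖x‖ / 2 := by have := norm_pos_iff.2 hx; positivity
  obtain ⟨η₁, hη₁, hη₁n, hη₁l, hη₁0, hη₁1, -, -⟩ := hcut (‖x‖ / 2) hr
  obtain ⟨hLint, hcont, -⟩ := integral_test_drift_diffusion hu hdiv hW hWR hη₁ (hnear hr hη₁0)
  have hnonneg : ∀ {η : EuclideanSpace ℝ (Fin n) → ℝ}, (∀ y, 0 ≤ η y) → η 0 = 0 → ∀ y,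
      0 ≤ η y * ∑ i, (coordDeriv i (coordDeriv i W) y - u i y * coordDeriv i W y) := by
    intro η h h0 y
    by_cases hy : y = 0
    · subst hy
      simp [h0]
    · exact mul_nonneg (h y) (hsub y hy)
  have hsmall : ∀ ε : ℝ, 0 < ε → ε ≤ min 1 (‖x‖ / 4) →
      ∫ y, η₁ y * ∑ i, (coordDeriv i (coordDeriv i W) y - u i y * coordDeriv i W y)
        ≤ M * ε := by
    intro ε hε hεm
    obtain ⟨η, hη, hηn, hηl, hη0, hη1, hd1, hd2⟩ := hcut ε hε
    refine le_trans ?_ (hbound ε hε (hεm.trans (min_le_left _ _)) η hη hη0 hη1 hd1 hd2)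
    refine MeasureTheory.integral_mono hLint
      (integral_test_drift_diffusion hu hdiv hW hWR hη (hnear hε hη0)).1 fun y => ?_
    by_cases hy : ‖y‖ ≤ ‖x‖ / 2
    · simpa [hη₁0 y hy] using hnonneg hηn (hη0 0 (by simpa using hε.le)) y
    · have hy := not_le.1 hy
      have h1 : η y = 1 := hη1 y (by linarith [hεm.trans (min_le_right _ _)])
      exact mul_le_mul_of_nonneg_right ((hη₁l y).trans_eq h1.symm)
        (hsub y (norm_pos_iff.1 (hr.trans hy)))
  have hle : ∫ y, η₁ y * ∑ i, (coordDeriv i (coordDeriv i W) y - u i y * coordDeriv i W y)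
      ≤ 0 := by
    have ht : Filter.Tendsto (fun ε : ℝ => M * ε) (𝓝[>] 0) (𝓝 0) := by
      have : Continuous fun ε : ℝ => M * ε := by fun_prop
      simpa using (this.tendsto 0).mono_left nhdsWithin_le_nhds
    refine ge_of_tendsto ht ?_
    have hm : (0 : ℝ) < min 1 (‖x‖ / 4) := lt_min one_pos (by linarith)
    filter_upwards [Ioc_mem_nhdsGT hm] with ε hε using hsmall ε hε.1 hε.2
  have hnn := hnonneg hη₁n (hη₁0 0 (by simpa using hr.le))
  have h0 : (fun y => η₁ y * ∑ i, (coordDeriv i (coordDeriv i W) y - u i y * coordDeriv i W y))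
      = 0 := by
    refine (Continuous.ae_eq_iff_eq MeasureTheory.volume hcont continuous_const).1 ?_
    exact (MeasureTheory.integral_eq_zero_iff_of_nonneg hnn hLint).1
      (le_antisymm hle (MeasureTheory.integral_nonneg hnn))
  have hx1 := congrFun h0 x
  simpa [hη₁1 x (by linarith)] using hx1

end Liouville

section Truncation

/-- A smooth convex truncation: it vanishes on `(-∞, 0]` and is strictly convex on `(0, ∞)`. -/
noncomputable def smoothPosPart (s : ℝ) : ℝ := s * expNegInvGlue s

lemma contDiff_smoothPosPart : ContDiff ℝ ∞ smoothPosPart :=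
  contDiff_id.mul expNegInvGlue.contDiff

lemma smoothPosPart_of_nonpos {s : ℝ} (hs : s ≤ 0) : smoothPosPart s = 0 := by
  simp [smoothPosPart, expNegInvGlue.zero_of_nonpos hs]

lemma smoothPosPart_pos {s : ℝ} (hs : 0 < s) : 0 < smoothPosPart s :=
  mul_pos hs (expNegInvGlue.pos_of_pos hs)

lemma smoothPosPart_nonneg (s : ℝ) : 0 ≤ smoothPosPart s := by
  rcases le_or_gt s 0 with hs | hs
  · exact (smoothPosPart_of_nonpos hs).ge
  · exact (smoothPosPart_pos hs).le

lemma smoothPosPart_le {s : ℝ} (hs : 0 ≤ s) : smoothPosPart s ≤ s := by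
  refine mul_le_of_le_one_right hs ?_
  rw [expNegInvGlue]
  split_ifs
  · exact zero_le_one
  · exact Real.exp_le_one_iff.2 (neg_nonpos.2 (inv_nonneg.2 hs))

lemma deriv_smoothPosPart_of_pos {s : ℝ} (hs : 0 < s) :
    deriv smoothPosPart s = (1 + s⁻¹) * Real.exp (-s⁻¹) := by
  have h : smoothPosPart =ᶠ[𝓝 s] fun t => t * Real.exp (-t⁻¹) := by
    filter_upwards [Ioi_mem_nhds hs] with t ht
    simp [smoothPosPart, expNegInvGlue, not_le.2 (Set.mem_Ioi.1 ht)]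
  rw [h.deriv_eq]
  have := (hasDerivAt_id s).mul ((hasDerivAt_inv hs.ne').neg.exp)
  refine (this.congr_deriv ?_).deriv
  simp
  field_simp

lemma deriv_smoothPosPart_of_nonpos {s : ℝ} (hs : s ≤ 0) : deriv smoothPosPart s = 0 := by
  refine IsLocalMin.deriv_eq_zero (Filter.Eventually.of_forall fun t => ?_)
  rw [smoothPosPart_of_nonpos hs]
  exact smoothPosPart_nonneg t

lemma deriv_smoothPosPart_nonneg (s : ℝ) : 0 ≤ deriv smoothPosPart s := by
  rcases le_or_gt s 0 with hs | hs
  · exact (deriv_smoothPosPart_of_nonpos hs).ge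
  · rw [deriv_smoothPosPart_of_pos hs]
    positivity

lemma deriv_deriv_smoothPosPart_pos {s : ℝ} (hs : 0 < s) :
    0 < deriv (deriv smoothPosPart) s := by
  have h : deriv smoothPosPart =ᶠ[𝓝 s] fun t => (1 + t⁻¹) * Real.exp (-t⁻¹) := by
    filter_upwards [Ioi_mem_nhds hs] with t ht using deriv_smoothPosPart_of_pos ht
  rw [h.deriv_eq]
  have := ((hasDerivAt_inv hs.ne').const_add 1).mul ((hasDerivAt_inv hs.ne').neg.exp)
  have h2 := (this.congr_deriv (g' := Real.exp (-s⁻¹) / s ^ 3) (by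
    simp only [Pi.neg_apply]; field_simp; ring)).deriv
  have h3 : deriv (fun t => (1 + t⁻¹) * Real.exp (-t⁻¹)) s = Real.exp (-s⁻¹) / s ^ 3 := h2
  rw [h3]
  positivity

lemma deriv_deriv_smoothPosPart_nonneg (s : ℝ) : 0 ≤ deriv (deriv smoothPosPart) s := by
  rcases le_or_gt s 0 with hs | hs
  · refine (IsLocalMin.deriv_eq_zero (Filter.Eventually.of_forall fun t => ?_)).ge
    rw [deriv_smoothPosPart_of_nonpos hs]
    exact deriv_smoothPosPart_nonneg t
  · exact (deriv_deriv_smoothPosPart_pos hs).le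

end Truncation

section MaximumPrinciple

variable {n : ℕ}

lemma fderiv_eq_sum_coordDeriv (f : EuclideanSpace ℝ (Fin n) → ℝ)
    (x v : EuclideanSpace ℝ (Fin n)) : fderiv ℝ f x v = ∑ i, v i * coordDeriv i f x := by
  have hv : v = ∑ i, v i • EuclideanSpace.single i (1 : ℝ) := by
    ext j
    simp [Finset.sum_apply, Pi.single_apply]
  conv_lhs => rw [hv]
  simp [coordDeriv]

lemma eq_smul_of_coordDeriv_eq_zero {W : EuclideanSpace ℝ (Fin n) → ℝ} (hW : SmoothOffZero W)
    (h : ∀ x, x ≠ 0 → ∀ i, coordDeriv i W x = 0) {x : EuclideanSpace ℝ (Fin n)} (hx : x ≠ 0)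
    {t : ℝ} (ht : 0 < t) : W (t • x) = W x := by
  have hd : ∀ s : ℝ, 0 < s → HasDerivAt (fun r : ℝ => W (r • x)) 0 s := by
    intro s hs
    have hsx : s • x ≠ 0 := smul_ne_zero hs.ne' hx
    have h1 := ((hW _ hsx).differentiableAt (by simp)).hasFDerivAt
    have h2 : HasDerivAt (fun r : ℝ => r • x) x s := by
      simpa using (hasDerivAt_id s).smul_const x
    have h3 := h1.comp_hasDerivAt s h2
    rw [fderiv_eq_sum_coordDeriv] at h3
    simpa [h _ hsx, Function.comp_def] using h3
  have := isOpen_Ioi.is_const_of_deriv_eq_zero (s := Set.Ioi (0 : ℝ)) (convex_Ioi 0).isPreconnected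
    (fun s hs => (hd s hs).differentiableAt.differentiableWithinAt)
    (fun s hs => (hd s hs).deriv) ht (show (1 : ℝ) ∈ Set.Ioi 0 from Set.mem_Ioi.2 one_pos)
  simpa using this

/-- Maximum principle for subsolutions with inverse-square growth, `n ≥ 5`. -/
lemma subsolution_nonpos (hn : 5 ≤ n) {u : Fin n → EuclideanSpace ℝ (Fin n) → ℝ}
    {H : EuclideanSpace ℝ (Fin n) → ℝ} (hu : ∀ j, SmoothOffZero (u j))
    (hdiv : ∀ x, x ≠ 0 → ∑ i, coordDeriv i (u i) x = 0) {C : ℝ} (hC : 0 ≤ C)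
    (huC : ∀ x, x ≠ 0 → ∀ i, |u i x| ≤ C / ‖x‖)
    (hH : SmoothOffZero H) {K : ℝ} (hK : 0 ≤ K) (hHK : ∀ x, x ≠ 0 → H x ≤ K / ‖x‖ ^ 2)
    (hsub : ∀ x, x ≠ 0 →
      0 ≤ ∑ i, (coordDeriv i (coordDeriv i H) x - u i x * coordDeriv i H x))
    {x : EuclideanSpace ℝ (Fin n)} (hx : x ≠ 0) : H x ≤ 0 := by
  by_contra! hpos
  set k := H x / 2 with hk
  have hk0 : 0 < k := by positivity
  have hHk : SmoothOffZero fun y => H y - k := fun y hy => (hH y hy).sub contDiffAt_const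
  let W : EuclideanSpace ℝ (Fin n) → ℝ := fun y => smoothPosPart (H y - k)
  have hW : SmoothOffZero W := fun y hy => contDiff_smoothPosPart.contDiffAt.comp y (hHk y hy)
  have hG' : ContDiff ℝ ∞ (deriv smoothPosPart) :=
    (contDiff_infty_iff_deriv.1 contDiff_smoothPosPart).2
  have hDk : ∀ y, y ≠ 0 → ∀ i, coordDeriv i (fun y => H y - k) y = coordDeriv i H y := by
    intro y hy i
    rw [coordDeriv_sub (hH y hy) contDiffAt_const, coordDeriv_const, sub_zero]
  have hDW : ∀ y, y ≠ 0 → ∀ i, coordDeriv i W y =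
      deriv smoothPosPart (H y - k) * coordDeriv i H y := by
    intro y hy i
    rw [← hDk y hy i]
    exact coordDeriv_comp contDiff_smoothPosPart (hHk y hy) i
  have hDDW : ∀ y, y ≠ 0 → ∀ i, coordDeriv i (coordDeriv i W) y =
      deriv smoothPosPart (H y - k) * coordDeriv i (coordDeriv i H) y
        + deriv (deriv smoothPosPart) (H y - k) * coordDeriv i H y ^ 2 := by
    intro y hy i
    have hc : ContDiffAt ℝ ∞ (fun y => deriv smoothPosPart (H y - k)) y :=
      hG'.contDiffAt.comp y (hHk y hy)
    rw [coordDeriv_congr_off_zero (fun z hz => hDW z hz i) hy,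
      coordDeriv_mul hc ((hH y hy).coordDeriv i), coordDeriv_comp hG' (hHk y hy), hDk y hy]
    ring
  have hLW : ∀ y, y ≠ 0 →
      ∑ i, (coordDeriv i (coordDeriv i W) y - u i y * coordDeriv i W y) =
      deriv smoothPosPart (H y - k)
          * ∑ i, (coordDeriv i (coordDeriv i H) y - u i y * coordDeriv i H y)
        + deriv (deriv smoothPosPart) (H y - k) * ∑ i, coordDeriv i H y ^ 2 := by
    intro y hy
    rw [Finset.mul_sum, Finset.mul_sum, ← Finset.sum_add_distrib]
    refine Finset.sum_congr rfl fun i _ => ?_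
    rw [hDW y hy, hDDW y hy]
    ring
  have hfst : ∀ y, y ≠ 0 → 0 ≤ deriv smoothPosPart (H y - k)
      * ∑ i, (coordDeriv i (coordDeriv i H) y - u i y * coordDeriv i H y) := fun y hy =>
    mul_nonneg (deriv_smoothPosPart_nonneg _) (hsub y hy)
  have hsnd : ∀ y, 0 ≤ deriv (deriv smoothPosPart) (H y - k) * ∑ i, coordDeriv i H y ^ 2 :=
    fun y => mul_nonneg (deriv_deriv_smoothPosPart_nonneg _) (by positivity)
  have hWR : ∀ y, √(K / k) < ‖y‖ → W y = 0 := by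
    intro y hy
    have hy0 : 0 < ‖y‖ := (Real.sqrt_nonneg _).trans_lt hy
    have h1 : K / k < ‖y‖ ^ 2 := (Real.sqrt_lt' hy0).1 hy
    refine smoothPosPart_of_nonpos (sub_nonpos.2 ((hHK y (norm_pos_iff.1 hy0)).trans ?_))
    rw [div_lt_iff₀ hk0] at h1
    rw [div_le_iff₀ (by positivity)]
    linarith
  have hWK : ∀ y, y ≠ 0 → |W y| ≤ K / ‖y‖ ^ 2 := by
    intro y hy
    rw [abs_of_nonneg (smoothPosPart_nonneg _)]
    rcases le_total (H y - k) 0 with h | h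
    · rw [smoothPosPart_of_nonpos h]
      positivity
    · exact (smoothPosPart_le h).trans (by linarith [hHK y hy])
  have hzero : ∀ y, y ≠ 0 → ∀ i, coordDeriv i W y = 0 := by
    intro y hy i
    rw [hDW y hy]
    rcases le_or_gt (H y - k) 0 with h | h
    · rw [deriv_smoothPosPart_of_nonpos h, zero_mul]
    · have h0 := subsolution_eq_zero hn hu hdiv huC hW hK hC hWR hWK (fun z hz => by
        rw [hLW z hz]; exact add_nonneg (hfst z hz) (hsnd z)) hy
      rw [hLW y hy] at h0
      have h1 : deriv (deriv smoothPosPart) (H y - k) * ∑ i, coordDeriv i H y ^ 2 = 0 :=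
        le_antisymm (by linarith [hfst y hy]) (hsnd y)
      have h2 := (mul_eq_zero.1 h1).resolve_left (deriv_deriv_smoothPosPart_pos h).ne'
      have h3 := (Finset.sum_eq_zero_iff_of_nonneg fun j _ => sq_nonneg _).1 h2 i
        (Finset.mem_univ i)
      rw [pow_eq_zero_iff two_ne_zero |>.1 h3, mul_zero]
  have hnx : 0 < ‖x‖ := norm_pos_iff.2 hx
  have ht : 0 < (√(K / k) + 1) / ‖x‖ := by positivity
  have hfar := hWR (((√(K / k) + 1) / ‖x‖) • x) (by
    rw [norm_smul, Real.norm_of_nonneg ht.le, div_mul_cancel₀ _ hnx.ne']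
    linarith)
  rw [eq_smul_of_coordDeriv_eq_zero hW hzero hx ht] at hfar
  exact (smoothPosPart_pos (by linarith : 0 < H x - k)).ne' hfar

end MaximumPrinciple

/-- **Non-positivity of the total head pressure, n ≥ 5.**  If `(u, p)` is a smooth
solution of the steady Navier-Stokes equations on `ℝⁿ \ {0}`, `n ≥ 5`, with
`|u(x)| ≤ C/|x|` and the pressure normalized so that `|p(x)| ≤ C'/|x|²`, then the
total head pressure `H = |u|²/2 + p` satisfies `H ≤ 0` on `ℝⁿ \ {0}`. -/
theorem total_head_pressure_nonpositive {n : ℕ} (hn : 5 ≤ n)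
    (u : EuclideanSpace ℝ (Fin n) → EuclideanSpace ℝ (Fin n))
    (p : EuclideanSpace ℝ (Fin n) → ℝ)
    (hu : ContDiffOn ℝ (⊤ : ℕ∞) u {x : EuclideanSpace ℝ (Fin n) | x ≠ 0})
    (hp : ContDiffOn ℝ (⊤ : ℕ∞) p {x : EuclideanSpace ℝ (Fin n) | x ≠ 0})
    (hNS : ∀ x : EuclideanSpace ℝ (Fin n), x ≠ 0 → ∀ j : Fin n,
      -(∑ i : Fin n, fderiv ℝ (fun y => fderiv ℝ (fun z => u z j) y
            (EuclideanSpace.single i 1)) x (EuclideanSpace.single i 1)) +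
        (∑ i : Fin n, u x i * fderiv ℝ (fun z => u z j) x (EuclideanSpace.single i 1)) +
        fderiv ℝ p x (EuclideanSpace.single j 1) = 0)
    (hdiv : ∀ x : EuclideanSpace ℝ (Fin n), x ≠ 0 →
      ∑ i : Fin n, fderiv ℝ (fun z => u z i) x (EuclideanSpace.single i 1) = 0)
    (C : ℝ) (hC : 0 < C)
    (hbound : ∀ x : EuclideanSpace ℝ (Fin n), x ≠ 0 → ‖u x‖ ≤ C / ‖x‖)
    (C' : ℝ) (hC' : 0 < C')
    (hpbound : ∀ x : EuclideanSpace ℝ (Fin n), x ≠ 0 → |p x| ≤ C' / ‖x‖ ^ 2) :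
    ∀ x : EuclideanSpace ℝ (Fin n), x ≠ 0 → ‖u x‖ ^ 2 / 2 + p x ≤ 0 := by
  have huj : ∀ j, SmoothOffZero fun z => u z j := fun j x hx =>
    (contDiff_euclidean.1 contDiff_id j).contDiffAt.comp x
      (hu.contDiffAt (isOpen_ne.mem_nhds hx))
  have hps : SmoothOffZero p := fun x hx => hp.contDiffAt (isOpen_ne.mem_nhds hx)
  have hNS' : ∀ x, x ≠ 0 → ∀ j, coordDeriv j p x = ∑ i,
      (coordDeriv i (coordDeriv i fun z => u z j) x - u x i * coordDeriv i (fun z => u z j) x) := by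
    intro x hx j
    rw [Finset.sum_sub_distrib]
    have := hNS x hx j
    change -(∑ i, coordDeriv i (coordDeriv i fun z => u z j) x)
      + (∑ i, u x i * coordDeriv i (fun z => u z j) x) + coordDeriv j p x = 0 at this
    linarith
  have hHs : SmoothOffZero fun x => ∑ j, u x j * u x j * (1 / 2) + p x := fun x hx =>
    (ContDiffAt.sum fun j _ =>
      ((huj j x hx).mul (huj j x hx)).mul contDiffAt_const).add (hps x hx)
  have hHeq : ∀ x, ∑ j, u x j * u x j * (1 / 2) + p x = ‖u x‖ ^ 2 / 2 + p x := by
    intro x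
    rw [EuclideanSpace.real_norm_sq_eq, Finset.sum_div]
    congr 1
    exact Finset.sum_congr rfl fun j _ => by ring
  intro x hx
  rw [← hHeq]
  refine subsolution_nonpos hn huj hdiv hC.le (fun y hy i => ?_) hHs
    (K := C ^ 2 / 2 + C') (by positivity) (fun y hy => ?_)
    (fun y hy => total_head_pressure_subsolution huj hps hNS' hdiv rfl hy) hx
  · exact (PiLp.norm_apply_le (u y) i).trans (hbound y hy)
  · rw [hHeq, add_div]
    refine add_le_add ?_ ((le_abs_self _).trans (hpbound y hy))
    have := pow_le_pow_left₀ (norm_nonneg _) (hbound y hy) 2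
    rw [div_pow] at this
    rw [div_right_comm]
    linarith
end

section
/- Let n ≥ 5 and let (u, p) be a smooth solution of the steady Navier-Stokes equations on ℝⁿ \ {0} with |u(x)| ≤ C/|x| for all x ≠ 0, where the pressure is normalized so that |p(x)| ≤ C′/|x|² for all x ≠ 0. Then the total head pressure H = |u|²/2 + p satisfies ∫_{ℝⁿ} |H(x)| |x|^{2−n} dx < ∞. -/
open MeasureTheory Set Filter Topology

noncomputable section

namespace SteadyNavierStokes

variable {n : ℕ}

/-- The `i`-th partial derivative of a scalar function on `ℝⁿ`. -/
def pd (i : Fin n) (f : EuclideanSpace ℝ (Fin n) → ℝ) (x : EuclideanSpace ℝ (Fin n)) : ℝ :=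
  fderiv ℝ f x (EuclideanSpace.single i 1)

/-- Smoothness away from the origin. -/
def SmoothOff (f : EuclideanSpace ℝ (Fin n) → ℝ) : Prop :=
  ∀ x, x ≠ 0 → ContDiffAt ℝ ((⊤ : ℕ∞) : WithTop ℕ∞) f x

/-- The function vanishes outside a compact annulus centred at the origin. -/
def AnnularSupport (f : EuclideanSpace ℝ (Fin n) → ℝ) : Prop :=
  ∃ a b : ℝ, 0 < a ∧ ∀ x, f x ≠ 0 → a ≤ ‖x‖ ∧ ‖x‖ ≤ b

variable {f g : EuclideanSpace ℝ (Fin n) → ℝ} {x : EuclideanSpace ℝ (Fin n)}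

namespace SmoothOff

lemma differentiableAt (hf : SmoothOff f) (hx : x ≠ 0) : DifferentiableAt ℝ f x :=
  (hf x hx).differentiableAt (by simp)

lemma const (c : ℝ) : SmoothOff (fun _ : EuclideanSpace ℝ (Fin n) => c) :=
  fun _ _ => contDiffAt_const

lemma coord (i : Fin n) : SmoothOff (fun y : EuclideanSpace ℝ (Fin n) => y i) :=
  fun _ _ => (EuclideanSpace.proj (𝕜 := ℝ) i).contDiff.contDiffAt

lemma add (hf : SmoothOff f) (hg : SmoothOff g) : SmoothOff (fun y => f y + g y) :=
  fun x hx => (hf x hx).add (hg x hx)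

lemma sub (hf : SmoothOff f) (hg : SmoothOff g) : SmoothOff (fun y => f y - g y) :=
  fun x hx => (hf x hx).sub (hg x hx)

lemma mul (hf : SmoothOff f) (hg : SmoothOff g) : SmoothOff (fun y => f y * g y) :=
  fun x hx => (hf x hx).mul (hg x hx)

lemma sum {ι : Type*} {s : Finset ι} {F : ι → EuclideanSpace ℝ (Fin n) → ℝ}
    (hF : ∀ k, SmoothOff (F k)) : SmoothOff (fun y => ∑ k ∈ s, F k y) :=
  fun x hx => ContDiffAt.sum fun k _ => hF k x hx

lemma comp {φ : ℝ → ℝ} (hφ : ContDiff ℝ ((⊤ : ℕ∞) : WithTop ℕ∞) φ) (hf : SmoothOff f) :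
    SmoothOff (fun y => φ (f y)) :=
  fun x hx => hφ.contDiffAt.comp x (hf x hx)

lemma pd (hf : SmoothOff f) (i : Fin n) : SmoothOff (pd i f) := fun x hx =>
  ((hf x hx).fderiv_right (m := ((⊤ : ℕ∞) : WithTop ℕ∞)) (by simp)).clm_apply contDiffAt_const

end SmoothOff

lemma pd_congr (i : Fin n) (h : ∀ y, y ≠ 0 → f y = g y) (hx : x ≠ 0) : pd i f x = pd i g x := by
  have : f =ᶠ[𝓝 x] g := by
    filter_upwards [isOpen_ne.mem_nhds hx] with y hy using h y hy
  rw [pd, pd, this.fderiv_eq]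

lemma pd_const (i : Fin n) (c : ℝ) : pd i (fun _ => c) x = 0 := by
  simp [pd]

lemma pd_coord (i j : Fin n) : pd i (fun y => y j) x = if i = j then 1 else 0 := by
  have : HasFDerivAt (fun y : EuclideanSpace ℝ (Fin n) => y j)
      (EuclideanSpace.proj (𝕜 := ℝ) j) x := (EuclideanSpace.proj (𝕜 := ℝ) j).hasFDerivAt
  rw [pd, this.fderiv]
  simp [eq_comm]

lemma pd_add (i : Fin n) (hf : SmoothOff f) (hg : SmoothOff g) (hx : x ≠ 0) :
    pd i (fun y => f y + g y) x = pd i f x + pd i g x := by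
  simp [pd, fderiv_fun_add (hf.differentiableAt hx) (hg.differentiableAt hx)]

lemma pd_sub (i : Fin n) (hf : SmoothOff f) (hg : SmoothOff g) (hx : x ≠ 0) :
    pd i (fun y => f y - g y) x = pd i f x - pd i g x := by
  simp [pd, fderiv_fun_sub (hf.differentiableAt hx) (hg.differentiableAt hx)]

lemma pd_mul (i : Fin n) (hf : SmoothOff f) (hg : SmoothOff g) (hx : x ≠ 0) :
    pd i (fun y => f y * g y) x = pd i f x * g x + f x * pd i g x := by
  simp [pd, fderiv_fun_mul (hf.differentiableAt hx) (hg.differentiableAt hx)]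
  ring

lemma pd_sum {ι : Type*} (s : Finset ι) (i : Fin n) {F : ι → EuclideanSpace ℝ (Fin n) → ℝ}
    (hF : ∀ k, SmoothOff (F k)) (hx : x ≠ 0) :
    pd i (fun y => ∑ k ∈ s, F k y) x = ∑ k ∈ s, pd i (F k) x := by
  simp [pd, fderiv_fun_sum fun k _ => (hF k).differentiableAt hx]

lemma pd_comp (i : Fin n) {φ : ℝ → ℝ} {φ' : ℝ} (hφ : HasDerivAt φ φ' (f x)) (hf : SmoothOff f)
    (hx : x ≠ 0) : pd i (fun y => φ (f y)) x = φ' * pd i f x := by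
  have := hφ.comp_hasFDerivAt x (hf.differentiableAt hx).hasFDerivAt
  rw [pd, show (fun y => φ (f y)) = φ ∘ f from rfl, this.fderiv]
  simp [pd]

lemma pd_comm (i j : Fin n) (hf : SmoothOff f) (hx : x ≠ 0) :
    pd i (pd j f) x = pd j (pd i f) x := by
  have hd : DifferentiableAt ℝ (fderiv ℝ f) x :=
    ((hf x hx).fderiv_right (m := 1) (by norm_cast)).differentiableAt (by simp)
  have key : ∀ k l : Fin n, pd k (pd l f) x =
      fderiv ℝ (fderiv ℝ f) x (EuclideanSpace.single k 1) (EuclideanSpace.single l 1) := by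
    intro k l
    have : HasFDerivAt (pd l f) _ x :=
      hd.hasFDerivAt.clm_apply (hasFDerivAt_const (EuclideanSpace.single l (1 : ℝ)) x)
    rw [pd, this.fderiv]
    simp
  have hle : minSmoothness ℝ 2 ≤ ((⊤ : ℕ∞) : WithTop ℕ∞) := by
    rw [minSmoothness_of_isRCLikeNormedField]
    norm_cast
  rw [key, key, ((hf x hx).isSymmSndFDerivAt hle).eq]

lemma AnnularSupport.mono (hf : AnnularSupport f) (h : ∀ x, f x = 0 → g x = 0) :
    AnnularSupport g := by
  obtain ⟨a, b, ha, hab⟩ := hf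
  exact ⟨a, b, ha, fun x hx => hab x fun h0 => hx (h x h0)⟩

lemma AnnularSupport.hasCompactSupport (hf : AnnularSupport f) : HasCompactSupport f := by
  obtain ⟨a, b, -, hab⟩ := hf
  refine HasCompactSupport.intro (isCompact_closedBall (0 : EuclideanSpace ℝ (Fin n)) b) ?_
  intro x hx
  by_contra h0
  exact hx (by simpa using (hab x h0).2)

lemma AnnularSupport.eventuallyEq_zero (hf : AnnularSupport f) : f =ᶠ[𝓝 0] fun _ => 0 := by
  obtain ⟨a, b, ha, hab⟩ := hf
  filter_upwards [Metric.ball_mem_nhds 0 ha] with y hy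
  by_contra h0
  have := (hab y h0).1
  simp at hy
  linarith

lemma SmoothOff.contDiff (hf : SmoothOff f) (hs : AnnularSupport f) :
    ContDiff ℝ ((⊤ : ℕ∞) : WithTop ℕ∞) f := by
  rw [contDiff_iff_contDiffAt]
  intro x
  by_cases hx : x = 0
  · subst hx
    exact contDiffAt_const.congr_of_eventuallyEq hs.eventuallyEq_zero
  · exact hf x hx

lemma SmoothOff.integrable (hf : SmoothOff f) (hs : AnnularSupport f) : Integrable f :=
  (hf.contDiff hs).continuous.integrable_of_hasCompactSupport hs.hasCompactSupport

lemma AnnularSupport.pd (hf : AnnularSupport f) (i : Fin n) : AnnularSupport (pd i f) := by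
  obtain ⟨a, b, ha, hab⟩ := hf
  refine ⟨a, b, ha, fun x hx => ?_⟩
  have hcl : IsClosed {y : EuclideanSpace ℝ (Fin n) | a ≤ ‖y‖ ∧ ‖y‖ ≤ b} :=
    (isClosed_le continuous_const continuous_norm).inter
      (isClosed_le continuous_norm continuous_const)
  by_contra hn
  have : f =ᶠ[𝓝 x] fun _ => 0 := by
    filter_upwards [hcl.isOpen_compl.mem_nhds hn] with y hy
    by_contra h0
    exact hy (hab y h0)
  exact hx (by simp [SteadyNavierStokes.pd, this.fderiv_eq])

lemma integral_pd_eq_zero (i : Fin n) (hf : SmoothOff f) (hs : AnnularSupport f) :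
    ∫ x, pd i f x = 0 := by
  have h := integral_mul_fderiv_eq_neg_fderiv_mul_of_integrable
    (μ := (volume : Measure (EuclideanSpace ℝ (Fin n))))
    (f := fun _ => (1 : ℝ)) (g := f) (v := EuclideanSpace.single i (1 : ℝ))
    (by simp)
    (((hf.pd i).integrable (hs.pd i)).congr (ae_of_all _ fun x => by simp [pd]))
    (by simpa using hf.integrable hs) (by simp)
    (fun x _ => (hf.contDiff hs).differentiable (by simp) x)
  simpa [pd] using h

lemma ae_ne_zero (hn : 0 < n) : ∀ᵐ x : EuclideanSpace ℝ (Fin n), x ≠ 0 := by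
  have : Nonempty (Fin n) := ⟨⟨0, hn⟩⟩
  have : Nontrivial (EuclideanSpace ℝ (Fin n)) := inferInstance
  filter_upwards [measure_eq_zero_iff_ae_notMem.1
    (measure_singleton (μ := (volume : Measure (EuclideanSpace ℝ (Fin n)))) 0)] with x hx
  simpa using hx

/-- The divergence theorem for fields supported in an annulus. -/
lemma integral_div_eq_zero {V : Fin n → EuclideanSpace ℝ (Fin n) → ℝ}
    (hV : ∀ i, SmoothOff (V i)) (hs : ∀ i, AnnularSupport (V i)) :
    ∫ x, ∑ i, pd i (V i) x = 0 := by
  rw [integral_finsetSum _ fun i _ => ((hV i).pd i).integrable ((hs i).pd i)]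
  exact Finset.sum_eq_zero fun i _ => integral_pd_eq_zero i (hV i) (hs i)

/-- The radial function `x ↦ h (log ‖x‖)`, set to zero at the origin. -/
def logRadial (h : ℝ → ℝ) (x : EuclideanSpace ℝ (Fin n)) : ℝ :=
  if x = 0 then 0 else h (Real.log ‖x‖)

lemma logRadial_of_ne (h : ℝ → ℝ) (hx : x ≠ 0) : logRadial h x = h (Real.log ‖x‖) := if_neg hx

lemma smoothOff_log_norm :
    SmoothOff (fun y : EuclideanSpace ℝ (Fin n) => Real.log ‖y‖) := fun _ hx =>
  (contDiffAt_norm ℝ hx).log (norm_ne_zero_iff.2 hx)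

lemma smoothOff_logRadial {h : ℝ → ℝ} (hh : ContDiff ℝ ((⊤ : ℕ∞) : WithTop ℕ∞) h) :
    SmoothOff (logRadial h : EuclideanSpace ℝ (Fin n) → ℝ) := by
  intro x hx
  refine (smoothOff_log_norm.comp hh x hx).congr_of_eventuallyEq ?_
  filter_upwards [isOpen_ne.mem_nhds hx] with y hy using logRadial_of_ne h hy

lemma pd_log_norm (i : Fin n) (hx : x ≠ 0) :
    pd i (fun y => Real.log ‖y‖) x = x i / ‖x‖ ^ 2 := by
  have h2 : HasFDerivAt (fun y : EuclideanSpace ℝ (Fin n) => ‖y‖ ^ 2) (2 • innerSL ℝ x) x :=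
    (hasStrictFDerivAt_norm_sq x).hasFDerivAt
  have hpos : (0 : ℝ) < ‖x‖ ^ 2 := by positivity
  have h3 := (h2.log hpos.ne').const_mul (1 / 2)
  have : (fun y : EuclideanSpace ℝ (Fin n) => Real.log ‖y‖) =
      fun y => 1 / 2 * Real.log (‖y‖ ^ 2) := by
    funext y
    rw [Real.log_pow]
    push_cast
    ring
  rw [pd, this, h3.fderiv]
  simp [EuclideanSpace.inner_single_right]
  field_simp

lemma pd_logRadial (i : Fin n) {h : ℝ → ℝ} (hh : Differentiable ℝ h) (hx : x ≠ 0) :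
    pd i (logRadial h) x = x i * (deriv h (Real.log ‖x‖) / ‖x‖ ^ 2) := by
  rw [pd_congr i (fun y hy => logRadial_of_ne h hy) hx,
    pd_comp i (hh _).hasDerivAt smoothOff_log_norm hx, pd_log_norm i hx]
  ring

lemma annularSupport_logRadial {h : ℝ → ℝ} {T : ℝ} (hT : ∀ t, T < |t| → h t = 0) :
    AnnularSupport (logRadial h : EuclideanSpace ℝ (Fin n) → ℝ) := by
  refine ⟨Real.exp (-T), Real.exp T, Real.exp_pos _, fun x hx => ?_⟩
  have hx0 : x ≠ 0 := fun h0 => hx (by simp [logRadial, h0])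
  have hpos : 0 < ‖x‖ := norm_pos_iff.2 hx0
  rw [logRadial_of_ne h hx0] at hx
  have hlog : |Real.log ‖x‖| ≤ T := by
    by_contra hc
    exact hx (hT _ (not_le.1 hc))
  rw [abs_le] at hlog
  exact ⟨(Real.le_log_iff_exp_le hpos).1 hlog.1, (Real.log_le_iff_le_exp hpos).1 hlog.2⟩

lemma SmoothOff.const_mul (c : ℝ) (hf : SmoothOff f) : SmoothOff (fun y => c * f y) :=
  (SmoothOff.const c).mul hf

lemma pd_const_mul (i : Fin n) (c : ℝ) (hf : SmoothOff f) (hx : x ≠ 0) :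
    pd i (fun y => c * f y) x = c * pd i f x := by
  rw [pd_mul i (SmoothOff.const c) hf hx, pd_const]
  ring

section Equations

variable {U : Fin n → EuclideanSpace ℝ (Fin n) → ℝ} {P : EuclideanSpace ℝ (Fin n) → ℝ}

/-- The total head pressure `|U|² / 2 + P`. -/
def head (U : Fin n → EuclideanSpace ℝ (Fin n) → ℝ) (P : EuclideanSpace ℝ (Fin n) → ℝ)
    (x : EuclideanSpace ℝ (Fin n)) : ℝ :=
  1 / 2 * (∑ j, U j x * U j x) + P x

lemma smoothOff_head (hU : ∀ j, SmoothOff (U j)) (hP : SmoothOff P) : SmoothOff (head U P) :=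
  ((SmoothOff.sum fun j => (hU j).mul (hU j)).const_mul _).add hP

lemma pd_head (hU : ∀ j, SmoothOff (U j)) (hP : SmoothOff P) (i : Fin n) (hx : x ≠ 0) :
    pd i (head U P) x = ∑ j, U j x * pd i (U j) x + pd i P x := by
  unfold head
  rw [pd_add i ((SmoothOff.sum fun j => (hU j).mul (hU j)).const_mul _) hP hx,
    pd_const_mul i _ (SmoothOff.sum fun j => (hU j).mul (hU j)) hx,
    pd_sum _ i (fun j => (hU j).mul (hU j)) hx, Finset.mul_sum]
  congr 1
  refine Finset.sum_congr rfl fun j _ => ?_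
  rw [pd_mul i (hU j) (hU j) hx]
  ring

lemma pd_pd_head (hU : ∀ j, SmoothOff (U j)) (hP : SmoothOff P) (i : Fin n) (hx : x ≠ 0) :
    pd i (pd i (head U P)) x =
      ∑ j, (pd i (U j) x * pd i (U j) x + U j x * pd i (pd i (U j)) x) + pd i (pd i P) x := by
  rw [pd_congr i (fun y hy => pd_head hU hP i hy) hx,
    pd_add i (SmoothOff.sum fun j => (hU j).mul ((hU j).pd i)) (hP.pd i) hx,
    pd_sum _ i (fun j => (hU j).mul ((hU j).pd i)) hx]
  congr 1
  exact Finset.sum_congr rfl fun j _ => pd_mul i (hU j) ((hU j).pd i) hx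

lemma pd_pressure
    (hNS : ∀ x, x ≠ 0 → ∀ j, -(∑ i, pd i (pd i (U j)) x) + (∑ i, U i x * pd i (U j) x)
      + pd j P x = 0) (j : Fin n) (hx : x ≠ 0) :
    pd j P x = (∑ i, pd i (pd i (U j)) x) - ∑ i, U i x * pd i (U j) x := by
  linarith [hNS x hx j]

lemma sum_pd_pd_pressure (hU : ∀ j, SmoothOff (U j))
    (hNS : ∀ x, x ≠ 0 → ∀ j, -(∑ i, pd i (pd i (U j)) x) + (∑ i, U i x * pd i (U j) x)
      + pd j P x = 0)
    (hdiv : ∀ x, x ≠ 0 → ∑ i, pd i (U i) x = 0) (hx : x ≠ 0) :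
    ∑ j, pd j (pd j P) x = -∑ j, ∑ i, pd j (U i) x * pd i (U j) x := by
  have h1 : ∀ j, pd j (pd j P) x = ∑ i, pd i (pd i (pd j (U j))) x -
      ∑ i, (pd j (U i) x * pd i (U j) x + U i x * pd i (pd j (U j)) x) := by
    intro j
    rw [pd_congr j (fun y hy => pd_pressure hNS j hy) hx,
      pd_sub j (SmoothOff.sum fun i => ((hU j).pd i).pd i)
        (SmoothOff.sum fun i => (hU i).mul ((hU j).pd i)) hx,
      pd_sum _ j (fun i => ((hU j).pd i).pd i) hx,
      pd_sum _ j (fun i => (hU i).mul ((hU j).pd i)) hx]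
    congr 1
    · refine Finset.sum_congr rfl fun i _ => ?_
      rw [pd_comm j i ((hU j).pd i) hx]
      exact pd_congr i (fun y hy => pd_comm j i (hU j) hy) hx
    · refine Finset.sum_congr rfl fun i _ => ?_
      rw [pd_mul j (hU i) ((hU j).pd i) hx, pd_comm j i (hU j) hx]
  have hdiv1 : ∀ i, ∀ y, y ≠ 0 → ∑ j, pd i (pd j (U j)) y = 0 := by
    intro i y hy
    rw [← pd_sum _ i (fun j => (hU j).pd j) hy, pd_congr i hdiv hy, pd_const]
  have hdiv2 : ∀ i, ∑ j, pd i (pd i (pd j (U j))) x = 0 := by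
    intro i
    rw [← pd_sum _ i (fun j => ((hU j).pd j).pd i) hx, pd_congr i (hdiv1 i) hx, pd_const]
  simp_rw [h1, Finset.sum_sub_distrib, Finset.sum_add_distrib]
  rw [Finset.sum_comm, Finset.sum_eq_zero (fun i _ => hdiv2 i),
    Finset.sum_comm (f := fun j i => U i x * pd i (pd j (U j)) x)]
  simp_rw [← Finset.mul_sum, hdiv1 _ x hx]
  simp

/-- The total head pressure is a subsolution of the drift-diffusion equation. -/
lemma laplacian_head_sub_drift_nonneg (hU : ∀ j, SmoothOff (U j)) (hP : SmoothOff P)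
    (hNS : ∀ x, x ≠ 0 → ∀ j, -(∑ i, pd i (pd i (U j)) x) + (∑ i, U i x * pd i (U j) x)
      + pd j P x = 0)
    (hdiv : ∀ x, x ≠ 0 → ∑ i, pd i (U i) x = 0) (hx : x ≠ 0) :
    0 ≤ ∑ i, pd i (pd i (head U P)) x - ∑ i, U i x * pd i (head U P) x := by
  have hdrift : ∑ i, U i x * pd i (head U P) x = ∑ j, U j x * ∑ i, pd i (pd i (U j)) x := by
    simp_rw [pd_head hU hP _ hx, pd_pressure hNS _ hx, mul_add, mul_sub,
      Finset.sum_add_distrib, Finset.sum_sub_distrib]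
    rw [sub_eq_add_neg, add_left_comm, add_eq_left, ← sub_eq_add_neg, sub_eq_zero]
    simp_rw [Finset.mul_sum]
    rw [Finset.sum_comm]
    exact Finset.sum_congr rfl fun i _ => Finset.sum_congr rfl fun j _ => by ring
  have hvisc : ∑ i, ∑ j, U j x * pd i (pd i (U j)) x = ∑ j, U j x * ∑ i, pd i (pd i (U j)) x := by
    rw [Finset.sum_comm]
    simp_rw [Finset.mul_sum]
  have hsq : ∑ i, ∑ j, (pd i (U j) x - pd j (U i) x) ^ 2 =
      2 * (∑ i, ∑ j, pd i (U j) x * pd i (U j) x - ∑ i, ∑ j, pd i (U j) x * pd j (U i) x) := by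
    have hswap : ∑ i, ∑ j, pd j (U i) x * pd j (U i) x =
        ∑ i, ∑ j, pd i (U j) x * pd i (U j) x := Finset.sum_comm
    have : ∀ i j, (pd i (U j) x - pd j (U i) x) ^ 2 = pd i (U j) x * pd i (U j) x +
        pd j (U i) x * pd j (U i) x - 2 * (pd i (U j) x * pd j (U i) x) := fun i j => by ring
    simp_rw [this, Finset.sum_sub_distrib, Finset.sum_add_distrib, ← Finset.mul_sum]
    rw [hswap]
    ring
  have hnn : 0 ≤ ∑ i, ∑ j, (pd i (U j) x - pd j (U i) x) ^ 2 := by positivity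
  simp_rw [pd_pd_head hU hP _ hx, Finset.sum_add_distrib]
  rw [hdrift, hvisc, sum_pd_pd_pressure hU hNS hdiv hx]
  linarith

/-- Testing the subsolution `F` of the drift-diffusion equation against a cutoff `χ`. -/
lemma integral_cutoff_mul_laplacian_sub_drift (hn : 0 < n)
    {F χ : EuclideanSpace ℝ (Fin n) → ℝ}
    (hU : ∀ j, SmoothOff (U j)) (hdiv : ∀ x, x ≠ 0 → ∑ i, pd i (U i) x = 0)
    (hF : SmoothOff F) (hχ : SmoothOff χ) (hs : AnnularSupport χ) :
    ∫ x, χ x * (∑ i, pd i (pd i F) x - ∑ i, U i x * pd i F x) =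
      ∫ x, F x * (∑ i, pd i (pd i χ) x + ∑ i, U i x * pd i χ x) := by
  have hsub : ∀ i, AnnularSupport (fun x => F x * pd i χ x) := fun i =>
    (hs.pd i).mono fun x hx => by simp [hx]
  have hint1 : Integrable (fun x => χ x * (∑ i, pd i (pd i F) x - ∑ i, U i x * pd i F x)) :=
    (hχ.mul ((SmoothOff.sum fun i => (hF.pd i).pd i).sub
      (SmoothOff.sum fun i => (hU i).mul (hF.pd i)))).integrable
      (hs.mono fun x hx => by simp [hx])
  have hV : ∀ i, SmoothOff (fun x => χ x * pd i F x - F x * pd i χ x - χ x * (U i x * F x)) :=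
    fun i => ((hχ.mul (hF.pd i)).sub (hF.mul (hχ.pd i))).sub (hχ.mul ((hU i).mul hF))
  have hVs : ∀ i, AnnularSupport
      (fun x => χ x * pd i F x - F x * pd i χ x - χ x * (U i x * F x)) := by
    intro i
    obtain ⟨a, b, ha, hab⟩ := hs
    obtain ⟨a', b', ha', hab'⟩ := hsub i
    refine ⟨min a a', max b b', lt_min ha ha', fun x hx => ?_⟩
    by_cases h : χ x = 0
    · have := hab' x (fun h' => hx (by simp [h, h']))
      exact ⟨(min_le_right _ _).trans this.1, this.2.trans (le_max_right _ _)⟩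
    · have := hab x h
      exact ⟨(min_le_left _ _).trans this.1, this.2.trans (le_max_left _ _)⟩
  have hint2 : Integrable (fun x => F x * (∑ i, pd i (pd i χ) x + ∑ i, U i x * pd i χ x)) := by
    have h1 : ∀ i, Integrable (fun x => F x * pd i (pd i χ) x + F x * (U i x * pd i χ x)) :=
      fun i => ((hF.mul ((hχ.pd i).pd i)).integrable
        (((hs.pd i).pd i).mono fun x hx => by simp [hx])).add
        ((hF.mul ((hU i).mul (hχ.pd i))).integrable ((hs.pd i).mono fun x hx => by simp [hx]))
    refine (integrable_finsetSum Finset.univ fun i _ => h1 i).congr (ae_of_all _ fun x => ?_)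
    simp only [Finset.sum_add_distrib, ← Finset.mul_sum, mul_add]
  have hpt : ∀ x : EuclideanSpace ℝ (Fin n), x ≠ 0 →
      ∑ i, pd i (fun x => χ x * pd i F x - F x * pd i χ x - χ x * (U i x * F x)) x =
      χ x * (∑ i, pd i (pd i F) x - ∑ i, U i x * pd i F x) -
        F x * (∑ i, pd i (pd i χ) x + ∑ i, U i x * pd i χ x) := by
    intro x hx
    have h1 : ∀ i, pd i (fun x => χ x * pd i F x - F x * pd i χ x - χ x * (U i x * F x)) x =
        χ x * pd i (pd i F) x - χ x * (U i x * pd i F x) - F x * pd i (pd i χ) x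
          - F x * (U i x * pd i χ x) - χ x * F x * pd i (U i) x := by
      intro i
      rw [pd_sub i ((hχ.mul (hF.pd i)).sub (hF.mul (hχ.pd i))) (hχ.mul ((hU i).mul hF)) hx,
        pd_sub i (hχ.mul (hF.pd i)) (hF.mul (hχ.pd i)) hx, pd_mul i hχ (hF.pd i) hx,
        pd_mul i hF (hχ.pd i) hx, pd_mul i hχ ((hU i).mul hF) hx, pd_mul i (hU i) hF hx]
      ring
    simp_rw [h1, Finset.sum_sub_distrib, ← Finset.mul_sum]
    rw [hdiv x hx]
    ring
  rw [← sub_eq_zero, ← integral_sub hint1 hint2, ← integral_div_eq_zero hV hVs]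
  refine integral_congr_ae ?_
  filter_upwards [ae_ne_zero hn] with x hx using (hpt x hx).symm

/-- Testing the equations against the vector field `h (log ‖x‖) x`. -/
lemma integral_radial_virial (hn : 0 < n) (hU : ∀ j, SmoothOff (U j)) (hP : SmoothOff P)
    (hNS : ∀ x, x ≠ 0 → ∀ j, -(∑ i, pd i (pd i (U j)) x) + (∑ i, U i x * pd i (U j) x)
      + pd j P x = 0)
    (hdiv : ∀ x, x ≠ 0 → ∑ i, pd i (U i) x = 0)
    {h : ℝ → ℝ} (hh : ContDiff ℝ ((⊤ : ℕ∞) : WithTop ℕ∞) h) {T : ℝ} (hT : ∀ t, T < |t| → h t = 0) :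
    Integrable (fun x => h (Real.log ‖x‖) * (∑ j, U j x * U j x + n * P x) +
      deriv h (Real.log ‖x‖) / ‖x‖ ^ 2 * ((∑ j, U j x * x j) ^ 2 + P x * ‖x‖ ^ 2)) ∧
    ∫ x, (h (Real.log ‖x‖) * (∑ j, U j x * U j x + n * P x) +
      deriv h (Real.log ‖x‖) / ‖x‖ ^ 2 * ((∑ j, U j x * x j) ^ 2 + P x * ‖x‖ ^ 2)) = 0 := by
  have hw : SmoothOff (logRadial h : EuclideanSpace ℝ (Fin n) → ℝ) := smoothOff_logRadial hh
  have hA : ∀ i j, SmoothOff (fun y => pd i (U j) y - pd j (U i) y) := fun i j =>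
    ((hU j).pd i).sub ((hU i).pd j)
  have hux : SmoothOff (fun y => ∑ j, U j y * y j) :=
    SmoothOff.sum fun j => (hU j).mul (SmoothOff.coord j)
  have hcurl : ∀ i, SmoothOff (fun y => ∑ j, y j * (pd i (U j) y - pd j (U i) y)) := fun i =>
    SmoothOff.sum fun j => (SmoothOff.coord j).mul (hA i j)
  have hB1 : ∀ i, SmoothOff (fun y => U i y * (∑ j, U j y * y j) + P y * y i) := fun i =>
    ((hU i).mul hux).add (hP.mul (SmoothOff.coord i))
  have hB : ∀ i, SmoothOff (fun y => U i y * (∑ j, U j y * y j) + P y * y i -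
      ∑ j, y j * (pd i (U j) y - pd j (U i) y)) := fun i => (hB1 i).sub (hcurl i)
  have hV := fun i => hw.mul (hB i)
  have hVs : ∀ i, AnnularSupport (fun y => logRadial h y * (U i y * (∑ j, U j y * y j) +
      P y * y i - ∑ j, y j * (pd i (U j) y - pd j (U i) y))) := fun i =>
    (annularSupport_logRadial hT).mono fun x hx => by simp [hx]
  suffices hae : (fun x => ∑ i, pd i (fun y => logRadial h y * (U i y * (∑ j, U j y * y j) +
      P y * y i - ∑ j, y j * (pd i (U j) y - pd j (U i) y))) x) =ᵐ[volume]
      (fun x => h (Real.log ‖x‖) * (∑ j, U j x * U j x + n * P x) +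
        deriv h (Real.log ‖x‖) / ‖x‖ ^ 2 * ((∑ j, U j x * x j) ^ 2 + P x * ‖x‖ ^ 2)) from
    ⟨(integrable_finsetSum Finset.univ fun i _ =>
      ((hV i).pd i).integrable ((hVs i).pd i)).congr hae,
      (integral_congr_ae hae).symm.trans (integral_div_eq_zero hV hVs)⟩
  filter_upwards [ae_ne_zero hn] with x hx
  have hpd : ∀ i, pd i (fun y => U i y * (∑ j, U j y * y j) + P y * y i -
      ∑ j, y j * (pd i (U j) y - pd j (U i) y)) x =
      pd i (U i) x * (∑ j, U j x * x j) + U i x * U i x + P x +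
      ∑ j, x j * (U i x * pd i (U j) x) + x i * pd i P x
        - ∑ j, x j * pd i (pd i (U j)) x + ∑ j, x j * pd j (pd i (U i)) x := by
    intro i
    rw [pd_sub i (hB1 i) (hcurl i) hx,
      pd_add i ((hU i).mul hux) (hP.mul (SmoothOff.coord i)) hx, pd_mul i (hU i) hux hx,
      pd_mul i hP (SmoothOff.coord i) hx, pd_coord,
      pd_sum _ i (fun j => (hU j).mul (SmoothOff.coord j)) hx,
      pd_sum _ i (fun j => (SmoothOff.coord j).mul (hA i j)) hx]
    have e1 : ∑ j, pd i (fun y => U j y * y j) x = ∑ j, x j * pd i (U j) x + U i x := by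
      simp_rw [pd_mul i (hU _) (SmoothOff.coord _) hx, pd_coord, Finset.sum_add_distrib]
      simp [mul_comm]
    have e2 : ∑ j, pd i (fun y => y j * (pd i (U j) y - pd j (U i) y)) x =
        ∑ j, x j * pd i (pd i (U j)) x - ∑ j, x j * pd j (pd i (U i)) x := by
      simp_rw [pd_mul i (SmoothOff.coord _) (hA i _) hx, pd_coord,
        pd_sub i ((hU _).pd i) ((hU i).pd _) hx, pd_comm i _ (hU i) hx, mul_sub,
        Finset.sum_add_distrib, Finset.sum_sub_distrib]
      simp
    have e3 : ∑ j, x j * (U i x * pd i (U j) x) = U i x * ∑ j, x j * pd i (U j) x := by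
      rw [Finset.mul_sum]
      exact Finset.sum_congr rfl fun j _ => by ring
    rw [e1, e2, e3, if_pos rfl]
    ring
  have hskew : ∑ i, x i * ∑ j, x j * (pd i (U j) x - pd j (U i) x) = 0 := by
    simp_rw [mul_sub, Finset.sum_sub_distrib, mul_sub, Finset.sum_sub_distrib, Finset.mul_sum]
    rw [sub_eq_zero, Finset.sum_comm]
    exact Finset.sum_congr rfl fun i _ => Finset.sum_congr rfl fun j _ => by ring
  have hnorm : ∑ i, x i * x i = ‖x‖ ^ 2 := by
    rw [EuclideanSpace.real_norm_sq_eq]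
    exact Finset.sum_congr rfl fun i _ => by ring
  have hgrad : ∑ i, x i * (U i x * (∑ j, U j x * x j) + P x * x i -
      ∑ j, x j * (pd i (U j) x - pd j (U i) x)) =
      (∑ j, U j x * x j) ^ 2 + P x * ‖x‖ ^ 2 := by
    have : ∀ i, x i * (U i x * (∑ j, U j x * x j) + P x * x i -
        ∑ j, x j * (pd i (U j) x - pd j (U i) x)) = U i x * x i * (∑ j, U j x * x j) +
        P x * (x i * x i) - x i * ∑ j, x j * (pd i (U j) x - pd j (U i) x) := fun i => by ring
    simp_rw [this, Finset.sum_sub_distrib, Finset.sum_add_distrib, ← Finset.sum_mul,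
      ← Finset.mul_sum]
    rw [hskew, hnorm]
    ring
  have hdivB : ∑ i, (pd i (U i) x * (∑ j, U j x * x j) + U i x * U i x + P x +
      ∑ j, x j * (U i x * pd i (U j) x) + x i * pd i P x
        - ∑ j, x j * pd i (pd i (U j)) x + ∑ j, x j * pd j (pd i (U i)) x) =
      ∑ j, U j x * U j x + n * P x := by
    have e1 : ∑ i, ∑ j, x j * (U i x * pd i (U j) x) + ∑ i, x i * pd i P x -
        ∑ i, ∑ j, x j * pd i (pd i (U j)) x = 0 := by
      rw [Finset.sum_comm, Finset.sum_comm (f := fun i j => x j * pd i (pd i (U j)) x),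
        ← Finset.sum_add_distrib, ← Finset.sum_sub_distrib]
      refine Finset.sum_eq_zero fun j _ => ?_
      rw [← Finset.mul_sum, ← Finset.mul_sum]
      linear_combination x j * hNS x hx j
    have e2 : ∑ i, ∑ j, x j * pd j (pd i (U i)) x = 0 := by
      rw [Finset.sum_comm]
      refine Finset.sum_eq_zero fun j _ => ?_
      rw [← Finset.mul_sum, ← pd_sum _ j (fun i => (hU i).pd i) hx, pd_congr j hdiv hx, pd_const,
        mul_zero]
    simp_rw [Finset.sum_add_distrib, Finset.sum_sub_distrib, Finset.sum_add_distrib,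
      ← Finset.sum_mul]
    rw [hdiv x hx, e2]
    simp only [Finset.sum_const, Finset.card_univ, Fintype.card_fin, nsmul_eq_mul]
    linear_combination e1
  simp_rw [pd_mul _ hw (hB _) hx, pd_logRadial _ (hh.differentiable (by simp)) hx, hpd,
    Finset.sum_add_distrib, ← Finset.mul_sum, mul_comm (x _) (_ / _), mul_assoc, ← Finset.mul_sum]
  rw [hgrad, hdivB, logRadial_of_ne h hx]
  ring

end Equations

/-- The Laplacian of a radial function in logarithmic coordinates. -/
lemma laplacian_logRadial {h : ℝ → ℝ} (hh : ContDiff ℝ ((⊤ : ℕ∞) : WithTop ℕ∞) h) (hx : x ≠ 0) :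
    ∑ i, pd i (pd i (logRadial h)) x =
      (deriv (deriv h) (Real.log ‖x‖) + (n - 2) * deriv h (Real.log ‖x‖)) / ‖x‖ ^ 2 := by
  have hh' : ContDiff ℝ ((⊤ : ℕ∞) : WithTop ℕ∞) (deriv h) := (contDiff_infty_iff_deriv.1 hh).2
  have hexp : ContDiff ℝ ((⊤ : ℕ∞) : WithTop ℕ∞) (fun t : ℝ => Real.exp (-2 * t)) := by fun_prop
  set k : ℝ → ℝ := fun t => Real.exp (-2 * t) * deriv h t with hk
  have hkc : ContDiff ℝ ((⊤ : ℕ∞) : WithTop ℕ∞) k := hexp.mul hh'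
  have hexplog : ∀ y : EuclideanSpace ℝ (Fin n), y ≠ 0 →
      Real.exp (-2 * Real.log ‖y‖) = 1 / ‖y‖ ^ 2 := by
    intro y hy
    rw [neg_mul, Real.exp_neg, show (2 : ℝ) * Real.log ‖y‖ = ((2 : ℕ) : ℝ) * Real.log ‖y‖ by simp,
      Real.exp_nat_mul, Real.exp_log (norm_pos_iff.2 hy), one_div]
  have hk' : deriv k (Real.log ‖x‖) = (deriv (deriv h) (Real.log ‖x‖) -
      2 * deriv h (Real.log ‖x‖)) / ‖x‖ ^ 2 := by
    have h1 : HasDerivAt (fun t : ℝ => Real.exp (-2 * t))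
        (Real.exp (-2 * Real.log ‖x‖) * (-2 * 1)) (Real.log ‖x‖) :=
      ((hasDerivAt_id _).const_mul (-2)).exp
    have h2 := h1.mul (hh'.differentiable (by simp) (Real.log ‖x‖)).hasDerivAt
    have h3 : deriv k (Real.log ‖x‖) = _ := h2.deriv
    rw [h3, hexplog x hx]
    ring
  have hpd : ∀ i, pd i (pd i (logRadial h)) x =
      deriv h (Real.log ‖x‖) / ‖x‖ ^ 2 + x i * x i * (deriv k (Real.log ‖x‖) / ‖x‖ ^ 2) := by
    intro i
    have : ∀ y : EuclideanSpace ℝ (Fin n), y ≠ 0 →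
        pd i (logRadial h) y = y i * logRadial k y := by
      intro y hy
      rw [pd_logRadial i (hh.differentiable (by simp)) hy, logRadial_of_ne k hy, hk]
      simp only [hexplog y hy]
      ring
    rw [pd_congr i this hx, pd_mul i (SmoothOff.coord i) (smoothOff_logRadial hkc) hx, pd_coord,
      pd_logRadial i (hkc.differentiable (by simp)) hx, logRadial_of_ne k hx, hk]
    simp only [hexplog x hx, if_true]
    ring
  have hnorm : ∑ i, x i * x i = ‖x‖ ^ 2 := by
    rw [EuclideanSpace.real_norm_sq_eq]
    exact Finset.sum_congr rfl fun i _ => by ring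
  have hpos : 0 < ‖x‖ := norm_pos_iff.2 hx
  simp_rw [hpd, Finset.sum_add_distrib, ← Finset.sum_mul]
  rw [hnorm, hk']
  simp only [Finset.sum_const, Finset.card_univ, Fintype.card_fin, nsmul_eq_mul]
  field_simp
  ring

/-- A smooth cutoff on the line with bounded first and second derivatives. -/
lemma exists_cutoff : ∃ (θ : ℝ → ℝ) (M : ℝ), ContDiff ℝ ((⊤ : ℕ∞) : WithTop ℕ∞) θ ∧ 0 ≤ M ∧
    (∀ t, 0 ≤ θ t) ∧ (∀ t, θ t ≤ 1) ∧ (∀ t, |t| ≤ 1 → θ t = 1) ∧ (∀ t, 2 < |t| → θ t = 0) ∧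
    (∀ t, 2 < |t| → deriv θ t = 0) ∧ (∀ t, |deriv θ t| ≤ M) ∧ ∀ t, |deriv (deriv θ) t| ≤ M := by
  let b : ContDiffBump (0 : ℝ) := ⟨1, 2, one_pos, one_lt_two⟩
  have hb : ContDiff ℝ ((⊤ : ℕ∞) : WithTop ℕ∞) b := b.contDiff
  have hb1 : ContDiff ℝ ((⊤ : ℕ∞) : WithTop ℕ∞) (deriv b) := (contDiff_infty_iff_deriv.1 hb).2
  have hb2 : ContDiff ℝ ((⊤ : ℕ∞) : WithTop ℕ∞) (deriv (deriv b)) := (contDiff_infty_iff_deriv.1 hb1).2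
  obtain ⟨M₁, h₁⟩ := hb1.continuous.bounded_above_of_compact_support b.hasCompactSupport.deriv
  obtain ⟨M₂, h₂⟩ :=
    hb2.continuous.bounded_above_of_compact_support b.hasCompactSupport.deriv.deriv
  have hzero : ∀ t, 2 < |t| → b t = 0 := fun t ht =>
    b.zero_of_le_dist (by simpa [Real.dist_eq] using ht.le)
  refine ⟨b, max M₁ M₂, hb, ((norm_nonneg _).trans (h₁ 0)).trans (le_max_left _ _),
    fun t => b.nonneg, fun t => b.le_one,
    fun t ht => b.one_of_mem_closedBall (by simpa [Real.dist_eq] using ht), hzero, ?_,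
    fun t => (h₁ t).trans (le_max_left _ _), fun t => (h₂ t).trans (le_max_right _ _)⟩
  intro t ht
  have : (b : ℝ → ℝ) =ᶠ[𝓝 t] fun _ => 0 := by
    filter_upwards [(isOpen_lt continuous_const continuous_abs).mem_nhds ht] with s hs
      using hzero s hs
  rw [this.deriv_eq]
  simp

/-- A smooth convex function of at most linear growth vanishing exactly on `(-∞, δ]`. -/
lemma exists_convex_truncation {δ : ℝ} (hδ : 0 < δ) : ∃ f g : ℝ → ℝ,
    ContDiff ℝ ((⊤ : ℕ∞) : WithTop ℕ∞) f ∧ ContDiff ℝ ((⊤ : ℕ∞) : WithTop ℕ∞) g ∧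
    (∀ s, HasDerivAt f (g s) s) ∧ (∀ s, 0 ≤ deriv g s) ∧ (∀ s, 0 ≤ g s) ∧ (∀ s, 0 ≤ f s) ∧
    (∀ s, f s ≤ |s|) ∧ (∀ s, s ≤ δ → f s = 0) ∧ ∀ s, g s = 0 ↔ s ≤ δ := by
  set g : ℝ → ℝ := fun s => Real.smoothTransition (s - δ) with hg
  have hgc : ContDiff ℝ ((⊤ : ℕ∞) : WithTop ℕ∞) g :=
    Real.smoothTransition.contDiff.comp (contDiff_id.sub contDiff_const)
  have hgcont := hgc.continuous
  have hgmono : Monotone g := fun a b hab =>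
    Real.smoothTransition.monotone (sub_le_sub_right hab δ)
  have hg0 : ∀ s, 0 ≤ g s := fun s => Real.smoothTransition.nonneg _
  have hgz : ∀ s, g s = 0 ↔ s ≤ δ := fun s => by
    simp [hg, Real.smoothTransition.zero_iff_nonpos]
  have hder : ∀ s, HasDerivAt (fun s => ∫ t in (0 : ℝ)..s, g t) (g s) s := fun s =>
    intervalIntegral.integral_hasDerivAt_right (hgcont.intervalIntegrable _ _)
      hgcont.aestronglyMeasurable.stronglyMeasurableAtFilter hgcont.continuousAt
  have hfz : ∀ s, s ≤ δ → ∫ t in (0 : ℝ)..s, g t = 0 := by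
    intro s hs
    refine intervalIntegral.integral_zero_ae (ae_of_all _ fun t ht => (hgz t).2 ?_)
    rcases le_total 0 s with h | h
    · rw [uIoc_of_le h] at ht
      exact ht.2.trans hs
    · rw [uIoc_of_ge h] at ht
      exact ht.2.trans hδ.le
  have hfmono : Monotone (fun s => ∫ t in (0 : ℝ)..s, g t) :=
    monotone_of_deriv_nonneg (fun s => (hder s).differentiableAt)
      fun s => by rw [(hder s).deriv]; exact hg0 s
  refine ⟨fun s => ∫ t in (0 : ℝ)..s, g t, g, ?_, hgc, hder, fun s => hgmono.deriv_nonneg, hg0, ?_,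
    ?_, hfz, hgz⟩
  · rw [contDiff_infty_iff_deriv]
    refine ⟨fun s => (hder s).differentiableAt, ?_⟩
    rwa [funext fun s => (hder s).deriv]
  · intro s
    rcases le_total s δ with h | h
    · exact (hfz s h).ge
    · exact (hfz δ le_rfl).ge.trans (hfmono h)
  · intro s
    rcases le_total s δ with h | h
    · exact (hfz s h).trans_le (abs_nonneg s)
    · have h0 : 0 ≤ s := hδ.le.trans h
      have := intervalIntegral.integral_mono_on (μ := volume) h0
        (hgcont.intervalIntegrable _ _) (continuous_const.intervalIntegrable _ _)
        (fun t _ => Real.smoothTransition.le_one (t - δ))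
      simp only [intervalIntegral.integral_const, smul_eq_mul, mul_one, sub_zero] at this
      exact this.trans (le_abs_self s)

lemma integrableOn_ball_inv_norm_pow_four (hn : 5 ≤ n) (R : ℝ) :
    IntegrableOn (fun x : EuclideanSpace ℝ (Fin n) => (‖x‖ ^ 4)⁻¹) (Metric.ball 0 R) := by
  have : Nonempty (Fin n) := ⟨⟨0, by omega⟩⟩
  rw [integrableOn_fun_norm_addHaar volume (f := fun y : ℝ => (y ^ 4)⁻¹),
    finrank_euclideanSpace_fin]
  have hint : IntegrableOn (fun y : ℝ => y ^ (n - 5)) (Ioo 0 R) :=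
    ((continuous_pow (n - 5)).integrableOn_Icc (a := 0) (b := R)).mono_set Ioo_subset_Icc_self
  refine hint.congr_fun (fun y hy => ?_) measurableSet_Ioo
  have hy0 : y ≠ 0 := hy.1.ne'
  simp only [smul_eq_mul]
  rw [show n - 1 = n - 5 + 4 by omega, pow_add]
  field_simp

/-- The weight `‖x‖⁻ⁿ` has linear growth over logarithmic annuli. -/
lemma integral_annulus_inv_norm_pow (hn : 0 < n) {T : ℝ} (hT : 0 ≤ T) :
    Integrable (fun x : EuclideanSpace ℝ (Fin n) =>
      indicator {y : ℝ | |Real.log y| ≤ T} (fun y => (y ^ n)⁻¹) ‖x‖) ∧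
    ∫ x : EuclideanSpace ℝ (Fin n),
      indicator {y : ℝ | |Real.log y| ≤ T} (fun y => (y ^ n)⁻¹) ‖x‖ =
      n * volume.real (Metric.ball (0 : EuclideanSpace ℝ (Fin n)) 1) * (2 * T) := by
  have : Nonempty (Fin n) := ⟨⟨0, hn⟩⟩
  have hle : Real.exp (-T) ≤ Real.exp T := Real.exp_le_exp.2 (by linarith)
  have hsub : Icc (Real.exp (-T)) (Real.exp T) ⊆ Ioi 0 := fun y hy =>
    (Real.exp_pos _).trans_le hy.1
  have hfun : EqOn (fun y : ℝ => y ^ (n - 1) •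
      indicator {y : ℝ | |Real.log y| ≤ T} (fun y => (y ^ n)⁻¹) y)
      (indicator (Icc (Real.exp (-T)) (Real.exp T)) fun y => y⁻¹) (Ioi 0) := by
    intro y hy
    have hy0 : 0 < y := hy
    have hmem : y ∈ {y : ℝ | |Real.log y| ≤ T} ↔ y ∈ Icc (Real.exp (-T)) (Real.exp T) := by
      rw [mem_ofPred_eq, abs_le, Real.le_log_iff_exp_le hy0, Real.log_le_iff_le_exp hy0, mem_Icc]
    by_cases h : y ∈ Icc (Real.exp (-T)) (Real.exp T)
    · simp only [indicator_of_mem h, indicator_of_mem (hmem.2 h), smul_eq_mul]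
      rw [show (y ^ n)⁻¹ = (y ^ (n - 1 + 1))⁻¹ by rw [Nat.sub_add_cancel hn], pow_succ]
      field_simp
    · simp only [indicator_of_notMem h, indicator_of_notMem (fun h' => h (hmem.1 h')), smul_zero]
  have hint : IntegrableOn (fun y : ℝ => y⁻¹) (Icc (Real.exp (-T)) (Real.exp T)) :=
    (continuousOn_inv₀.mono fun y hy => (hsub hy).ne').integrableOn_Icc
  constructor
  · rw [integrable_fun_norm_addHaar volume, finrank_euclideanSpace_fin,
      integrableOn_congr_fun hfun measurableSet_Ioi]
    exact ((integrable_indicator_iff measurableSet_Icc).2 hint).integrableOn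
  · rw [integral_fun_norm_addHaar volume, finrank_euclideanSpace_fin,
      setIntegral_congr_fun measurableSet_Ioi hfun, setIntegral_indicator measurableSet_Icc,
      inter_eq_right.2 hsub, integral_Icc_eq_integral_Ioc,
      ← intervalIntegral.integral_of_le hle,
      integral_inv_of_pos (Real.exp_pos _) (Real.exp_pos _), ← Real.exp_sub, Real.log_exp]
    simp only [nsmul_eq_mul, smul_eq_mul]
    ring

section Estimates

variable {U : Fin n → EuclideanSpace ℝ (Fin n) → ℝ} {P : EuclideanSpace ℝ (Fin n) → ℝ}

lemma deriv_comp_div {θ : ℝ → ℝ} (hθ : Differentiable ℝ θ) (N : ℝ) :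
    deriv (fun t => θ (t / N)) = fun t => deriv θ (t / N) / N := by
  funext t
  have h := (hθ (t / N)).hasDerivAt.comp t ((hasDerivAt_id t).div_const N)
  have h' : deriv (fun t => θ (t / N)) t = deriv θ (t / N) * (1 / N) := h.deriv
  rw [h']
  ring

/-- Logarithmic cutoffs are almost harmonic, uniformly with respect to a drift of size `1/‖x‖`. -/
lemma abs_laplacian_add_drift_log_cutoff_le (hn : 2 ≤ n) {θ : ℝ → ℝ} {M C N : ℝ} (hN : 1 ≤ N)
    (hθ : ContDiff ℝ ((⊤ : ℕ∞) : WithTop ℕ∞) θ) (hM : ∀ t, |deriv θ t| ≤ M)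
    (hM' : ∀ t, |deriv (deriv θ) t| ≤ M) (hx : x ≠ 0) (hC : |∑ j, U j x * x j| ≤ C) :
    |∑ i, pd i (pd i (logRadial fun t => θ (t / N))) x +
      ∑ i, U i x * pd i (logRadial fun t => θ (t / N)) x| ≤
      M * (n - 1 + C) / N / ‖x‖ ^ 2 := by
  have hθ' : ContDiff ℝ ((⊤ : ℕ∞) : WithTop ℕ∞) (deriv θ) := (contDiff_infty_iff_deriv.1 hθ).2
  have hh : ContDiff ℝ ((⊤ : ℕ∞) : WithTop ℕ∞) (fun t => θ (t / N)) :=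
    hθ.comp (contDiff_id.div_const N)
  have hN0 : 0 < N := by linarith
  have hn2 : (2 : ℝ) ≤ n := by exact_mod_cast hn
  have hd1 := deriv_comp_div (hθ.differentiable (by simp)) N
  have hd2 : deriv (deriv fun t => θ (t / N)) = fun t => deriv (deriv θ) (t / N) / N / N := by
    rw [hd1]
    funext t
    rw [deriv_div_const, deriv_comp_div (hθ'.differentiable (by simp)) N]
  have hdrift : ∑ i, U i x * pd i (logRadial fun t => θ (t / N)) x =
      (∑ j, U j x * x j) * (deriv θ (Real.log ‖x‖ / N) / N) / ‖x‖ ^ 2 := by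
    simp_rw [pd_logRadial _ (hh.differentiable (by simp)) hx, hd1, ← mul_assoc, ← Finset.sum_mul]
    ring
  rw [laplacian_logRadial hh hx, hd2, hd1, hdrift, ← add_div, abs_div,
    abs_of_nonneg (sq_nonneg ‖x‖)]
  gcongr
  set a := deriv θ (Real.log ‖x‖ / N)
  set b := deriv (deriv θ) (Real.log ‖x‖ / N)
  set S := ∑ j, U j x * x j
  have ha : |a| ≤ M := hM _
  have hb : |b| ≤ M := hM' _
  have hM0 : 0 ≤ M := (abs_nonneg _).trans ha
  have e : b / N / N + (n - 2) * (a / N) + S * (a / N) = (b / N + (n - 2) * a + S * a) / N := by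
    ring
  rw [e, abs_div, abs_of_pos hN0]
  gcongr
  have h1 : |b / N| ≤ M := by
    rw [abs_div, abs_of_pos hN0]
    exact (div_le_self (abs_nonneg b) hN).trans hb
  have h2 : |((n : ℝ) - 2) * a| ≤ (n - 2) * M := by
    rw [abs_mul, abs_of_nonneg (by linarith)]
    gcongr
  have h3 : |S * a| ≤ C * M := by
    rw [abs_mul]
    gcongr
    exact (abs_nonneg _).trans hC
  calc |b / N + (n - 2) * a + S * a| ≤ |b / N| + |(n - 2) * a| + |S * a| := abs_add_three _ _ _
    _ ≤ M * (n - 1 + C) := by linarith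

/-- A function with zero gradient off the origin that vanishes near infinity is zero. -/
lemma eq_zero_of_gradient_eq_zero (hf : SmoothOff f)
    (hgrad : ∀ y, y ≠ 0 → ∀ i, pd i f y = 0) {R : ℝ} (hR : ∀ y, R ≤ ‖y‖ → f y = 0)
    (hx : x ≠ 0) : f x = 0 := by
  have hfd : ∀ y, y ≠ 0 → fderiv ℝ f y = 0 := by
    intro y hy
    refine ContinuousLinearMap.coe_injective
      ((EuclideanSpace.basisFun (Fin n) ℝ).toBasis.ext fun i => ?_)
    simpa [pd] using hgrad y hy i
  have hpos : 0 < ‖x‖ := norm_pos_iff.2 hx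
  have hne : ∀ t ∈ Ici (1 : ℝ), t • x ≠ 0 := fun t ht =>
    smul_ne_zero (zero_lt_one.trans_le ht).ne' hx
  have hder : ∀ t ∈ Ici (1 : ℝ), HasDerivAt (fun t : ℝ => f (t • x)) 0 t := by
    intro t ht
    have h1 := (hf.differentiableAt (hne t ht)).hasFDerivAt
    rw [hfd _ (hne t ht)] at h1
    simpa [Function.comp_def] using! h1.comp_hasDerivAt t ((hasDerivAt_id t).smul_const x)
  set t₁ : ℝ := max 1 (R / ‖x‖)
  have hconst := constant_of_has_deriv_right_zero (f := fun t : ℝ => f (t • x)) (a := 1) (b := t₁)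
    (fun t ht => (hder t ht.1).continuousAt.continuousWithinAt)
    (fun t ht => (hder t ht.1).hasDerivWithinAt) t₁ (right_mem_Icc.2 (le_max_left _ _))
  simp only [one_smul] at hconst
  rw [← hconst]
  refine hR _ ?_
  rw [norm_smul, Real.norm_of_nonneg (zero_le_one.trans (le_max_left _ _))]
  exact (div_le_iff₀ hpos).1 (le_max_right _ _)

/-- The head pressure is nonpositive. -/
lemma head_nonpos (hn : 5 ≤ n) (hU : ∀ j, SmoothOff (U j)) (hP : SmoothOff P)
    (hNS : ∀ x, x ≠ 0 → ∀ j, -(∑ i, pd i (pd i (U j)) x) + (∑ i, U i x * pd i (U j) x)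
      + pd j P x = 0)
    (hdiv : ∀ x, x ≠ 0 → ∑ i, pd i (U i) x = 0) {C K : ℝ}
    (hC : ∀ x, x ≠ 0 → |∑ j, U j x * x j| ≤ C)
    (hK : ∀ x, x ≠ 0 → |head U P x| ≤ K / ‖x‖ ^ 2) (hx : x ≠ 0) : head U P x ≤ 0 := by
  have hH := smoothOff_head hU hP
  have hn2 : (5 : ℝ) ≤ n := by exact_mod_cast hn
  have hC0 : 0 ≤ C := (abs_nonneg _).trans (hC x hx)
  have hK0 : 0 ≤ K := by
    have h1 := (abs_nonneg _).trans (hK x hx)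
    have h2 : 0 < ‖x‖ ^ 2 := pow_pos (norm_pos_iff.2 hx) 2
    by_contra hneg
    linarith [div_neg_of_neg_of_pos (not_le.1 hneg) h2]
  refine le_of_forall_pos_le_add fun δ hδ => ?_
  rw [zero_add]
  obtain ⟨f, g, hf, hg, hfg, hg', hg0, hf0, hfabs, hfδ, hgδ⟩ := exists_convex_truncation hδ
  obtain ⟨θ, M, hθ, hM0, hθ0, hθ1, hθone, hθzero, -, hM, hM'⟩ := exists_cutoff
  have hF : SmoothOff (fun y => f (head U P y)) := hH.comp hf
  have hQ : SmoothOff (fun y => deriv g (head U P y) * ∑ i, pd i (head U P) y * pd i (head U P) y) :=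
    (hH.comp (contDiff_infty_iff_deriv.1 hg).2).mul
      (SmoothOff.sum fun i => (hH.pd i).mul (hH.pd i))
  set Q : EuclideanSpace ℝ (Fin n) → ℝ :=
    fun y => deriv g (head U P y) * ∑ i, pd i (head U P) y * pd i (head U P) y with hQdef
  have hQ0 : ∀ y, 0 ≤ Q y := fun y =>
    mul_nonneg (hg' _) (Finset.sum_nonneg fun i _ => mul_self_nonneg _)
  set χ : ℝ → EuclideanSpace ℝ (Fin n) → ℝ := fun N => logRadial fun t => θ (t / N)
  have hχ : ∀ N, SmoothOff (χ N) := fun N =>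
    smoothOff_logRadial (hθ.comp (contDiff_id.div_const N))
  have hχs : ∀ N, 0 < N → AnnularSupport (χ N) := fun N hN =>
    annularSupport_logRadial (T := 2 * N) fun t ht => hθzero _ (by
      rw [abs_div, abs_of_pos hN]
      exact (lt_div_iff₀ hN).2 ht)
  have hχ0 : ∀ N y, 0 ≤ χ N y := fun N y => by
    by_cases hy : y = 0
    · simp [χ, logRadial, hy]
    · simp only [χ, logRadial_of_ne _ hy]
      exact hθ0 _
  have hLF : ∀ y, y ≠ 0 → Q y ≤ ∑ i, pd i (pd i fun z => f (head U P z)) y -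
      ∑ i, U i y * pd i (fun z => f (head U P z)) y := by
    intro y hy
    have h1 : ∀ i, ∀ z, z ≠ 0 → pd i (fun z => f (head U P z)) z =
        g (head U P z) * pd i (head U P) z := fun i z hz => pd_comp i (hfg _) hH hz
    have h2 : ∀ i, pd i (pd i fun z => f (head U P z)) y =
        deriv g (head U P y) * (pd i (head U P) y * pd i (head U P) y) +
          g (head U P y) * pd i (pd i (head U P)) y := by
      intro i
      rw [pd_congr i (h1 i) hy, pd_mul i (hH.comp hg) (hH.pd i) hy,
        pd_comp i (hg.differentiable (by simp) _).hasDerivAt hH hy]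
      ring
    have h3 : ∑ i, U i y * pd i (fun z => f (head U P z)) y =
        g (head U P y) * ∑ i, U i y * pd i (head U P) y := by
      rw [Finset.mul_sum]
      refine Finset.sum_congr rfl fun i _ => ?_
      rw [h1 i y hy]
      ring
    simp_rw [h2, h3, Finset.sum_add_distrib, ← Finset.mul_sum]
    have h4 := mul_nonneg (hg0 (head U P y)) (laplacian_head_sub_drift_nonneg hU hP hNS hdiv hy)
    simp only [hQdef]
    linarith
  set R : ℝ := Real.sqrt (K / δ) + 1 with hR
  have hsmall : ∀ y : EuclideanSpace ℝ (Fin n), R ≤ ‖y‖ → head U P y ≤ δ := by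
    intro y hy
    have hsq : K / δ ≤ ‖y‖ ^ 2 := by
      rw [← Real.sq_sqrt (div_nonneg hK0 hδ.le)]
      gcongr
      linarith
    have hpos : 0 < ‖y‖ := lt_of_lt_of_le (by positivity) hy
    refine (le_abs_self _).trans ((hK y (norm_pos_iff.1 hpos)).trans ?_)
    rw [div_le_iff₀ (by positivity), mul_comm]
    exact (div_le_iff₀ hδ).1 hsq
  set J : ℝ := ∫ y in Metric.ball (0 : EuclideanSpace ℝ (Fin n)) R, (‖y‖ ^ 4)⁻¹
  have hbound : ∀ N, 1 ≤ N → ∫ y, χ N y * Q y ≤ K * (M * (n - 1 + C)) * J / N := by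
    intro N hN
    have hN0 : 0 < N := by linarith
    have hint : ∀ {G : EuclideanSpace ℝ (Fin n) → ℝ}, SmoothOff G →
        Integrable (fun y => χ N y * G y) := fun hG =>
      ((hχ N).mul hG).integrable ((hχs N hN0).mono fun y hy => by simp [hy])
    calc ∫ y, χ N y * Q y
        ≤ ∫ y, χ N y * (∑ i, pd i (pd i fun z => f (head U P z)) y -
          ∑ i, U i y * pd i (fun z => f (head U P z)) y) := by
          refine integral_mono_ae (hint hQ) (hint ((SmoothOff.sum fun i => (hF.pd i).pd i).sub
            (SmoothOff.sum fun i => (hU i).mul (hF.pd i)))) ?_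
          filter_upwards [ae_ne_zero (by omega : 0 < n)] with y hy
          exact mul_le_mul_of_nonneg_left (hLF y hy) (hχ0 N y)
      _ = ∫ y, f (head U P y) * (∑ i, pd i (pd i (χ N)) y + ∑ i, U i y * pd i (χ N) y) :=
          integral_cutoff_mul_laplacian_sub_drift (by omega) hU hdiv hF (hχ N) (hχs N hN0)
      _ ≤ ∫ y, indicator (Metric.ball (0 : EuclideanSpace ℝ (Fin n)) R)
          (fun y => K * (M * (n - 1 + C)) / N * (‖y‖ ^ 4)⁻¹) y := by
          refine (Real.le_norm_self _).trans (norm_integral_le_of_norm_le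
            ((integrable_indicator_iff Metric.isOpen_ball.measurableSet).2
              ((integrableOn_ball_inv_norm_pow_four hn R).const_mul _)) ?_)
          filter_upwards [ae_ne_zero (by omega : 0 < n)] with y hy
          by_cases hyR : y ∈ Metric.ball (0 : EuclideanSpace ℝ (Fin n)) R
          · have hpos : 0 < ‖y‖ := norm_pos_iff.2 hy
            rw [indicator_of_mem hyR, Real.norm_eq_abs, abs_mul, abs_of_nonneg (hf0 _)]
            calc f (head U P y) * |∑ i, pd i (pd i (χ N)) y + ∑ i, U i y * pd i (χ N) y|
                ≤ K / ‖y‖ ^ 2 * (M * (n - 1 + C) / N / ‖y‖ ^ 2) :=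
                  mul_le_mul ((hfabs _).trans (hK y hy))
                    (abs_laplacian_add_drift_log_cutoff_le (by omega) hN hθ hM hM' hy (hC y hy))
                    (abs_nonneg _) (by positivity)
              _ = K * (M * (n - 1 + C)) / N * (‖y‖ ^ 4)⁻¹ := by
                  field_simp
          · have hRy : R ≤ ‖y‖ := by simpa using hyR
            simp [hfδ _ (hsmall y hRy), indicator_of_notMem hyR]
      _ = K * (M * (n - 1 + C)) * J / N := by
          rw [integral_indicator Metric.isOpen_ball.measurableSet, integral_const_mul]
          ring
  have hQz : ∀ y, y ≠ 0 → Q y = 0 := by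
    intro y hy
    set m : ℝ := |Real.log ‖y‖| + 1 with hm
    have hm0 : 0 < m := by positivity
    have hχy : χ m y = 1 := by
      simp only [χ, logRadial_of_ne _ hy]
      refine hθone _ ?_
      rw [abs_div, abs_of_pos hm0, div_le_one hm0]
      linarith
    have hle : ∀ N, 2 * m ≤ N → ∀ z, χ m z ≤ χ N z := by
      intro N hN z
      by_cases hz : z = 0
      · simp [χ, logRadial, hz]
      simp only [χ, logRadial_of_ne _ hz]
      by_cases h2 : 2 < |Real.log ‖z‖ / m|
      · rw [hθzero _ h2]
        exact hθ0 _
      · refine (hθ1 _).trans (hθone _ ?_).ge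
        rw [abs_div, abs_of_pos hm0, not_lt, div_le_iff₀ hm0] at h2
        have hN0 : 0 < N := by linarith
        rw [abs_div, abs_of_pos hN0, div_le_one hN0]
        linarith
    have hsm := (hχ m).mul hQ
    have hss : AnnularSupport (fun z => χ m z * Q z) := (hχs m hm0).mono fun z hz => by simp [hz]
    have hlim : ∫ z, χ m z * Q z ≤ 0 := by
      refine ge_of_tendsto (x := (atTop : Filter ℝ))
        (tendsto_const_nhds.div_atTop tendsto_id : Tendsto (fun N : ℝ =>
          K * (M * (n - 1 + C)) * J / N) atTop (𝓝 0)) ?_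
      filter_upwards [eventually_ge_atTop (max 1 (2 * m))] with N hN
      have hN1 : 1 ≤ N := (le_max_left _ _).trans hN
      refine le_trans (integral_mono (hsm.integrable hss) (((hχ N).mul hQ).integrable
        ((hχs N (by linarith)).mono fun z hz => by simp [hz])) fun z => ?_) (hbound N hN1)
      exact mul_le_mul_of_nonneg_right (hle N ((le_max_right _ _).trans hN) z) (hQ0 z)
    by_contra hne
    refine absurd ((hsm.contDiff hss).continuous.integral_pos_of_hasCompactSupport_nonneg_nonzero
      (μ := volume) hss.hasCompactSupport (fun z => mul_nonneg (hχ0 m z) (hQ0 z)) (x := y) ?_)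
      hlim.not_gt
    rw [hχy, one_mul]
    exact hne
  refine (hgδ _).1 (eq_zero_of_gradient_eq_zero (hH.comp hg) (fun y hy i => ?_)
    (fun y hy => (hgδ _).2 (hsmall y hy)) hx)
  rw [pd_comp i (hg.differentiable (by simp) _).hasDerivAt hH hy]
  rcases mul_eq_zero.1 (hQz y hy) with h | h
  · rw [h, zero_mul]
  · have := (Finset.sum_eq_zero_iff_of_nonneg fun i _ => mul_self_nonneg _).1 h i
      (Finset.mem_univ i)
    rw [mul_self_eq_zero.1 this, mul_zero]

/-- Weighted integrals of the head pressure over logarithmic annuli are uniformly bounded. -/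
lemma exists_bound_integral_cutoff_head (hn : 5 ≤ n) (hU : ∀ j, SmoothOff (U j))
    (hP : SmoothOff P)
    (hNS : ∀ x, x ≠ 0 → ∀ j, -(∑ i, pd i (pd i (U j)) x) + (∑ i, U i x * pd i (U j) x)
      + pd j P x = 0)
    (hdiv : ∀ x, x ≠ 0 → ∑ i, pd i (U i) x = 0) {C C' : ℝ}
    (hC : ∀ x, x ≠ 0 → |∑ j, U j x * x j| ≤ C)
    (hC' : ∀ x, x ≠ 0 → |P x| ≤ C' / ‖x‖ ^ 2)
    (hneg : ∀ x, x ≠ 0 → head U P x ≤ 0) :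
    ∃ I : ℝ, ∀ N : ℝ, 1 ≤ N → IntegrableOn (fun x => |head U P x| / ‖x‖ ^ (n - 2))
        {x | |Real.log ‖x‖| ≤ N} ∧
      ∫ x in {x | |Real.log ‖x‖| ≤ N}, |head U P x| / ‖x‖ ^ (n - 2) ≤ I := by
  have hn0 : 0 < n := by omega
  obtain ⟨θ, M, hθ, hM0, hθ0, hθ1, hθone, hθzero, hθ'zero, hM, -⟩ := exists_cutoff
  set B : ℝ := volume.real (Metric.ball (0 : EuclideanSpace ℝ (Fin n)) 1)
  refine ⟨2 * M * (C ^ 2 + C') * (n * B), fun N hN => ?_⟩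
  have hN0 : 0 < N := by linarith
  set h : ℝ → ℝ := fun t => Real.exp (-(n - 2 : ℕ) * t) * θ (t / N) with hh_def
  have hexp : ContDiff ℝ ((⊤ : ℕ∞) : WithTop ℕ∞) (fun t : ℝ => Real.exp (-(n - 2 : ℕ) * t)) := by
    fun_prop
  have hh : ContDiff ℝ ((⊤ : ℕ∞) : WithTop ℕ∞) h := hexp.mul (hθ.comp (contDiff_id.div_const N))
  have habs : ∀ t : ℝ, 2 * N < |t| → 2 < |t / N| := fun t ht => by
    rw [abs_div, abs_of_pos hN0]
    exact (lt_div_iff₀ hN0).2 ht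
  have hT : ∀ t, 2 * N < |t| → h t = 0 := fun t ht => by
    simp only [hh_def, hθzero _ (habs t ht), mul_zero]
  have hh' : ∀ t, deriv h t = -(n - 2 : ℕ) * h t +
      Real.exp (-(n - 2 : ℕ) * t) * (deriv θ (t / N) / N) := by
    intro t
    have h1 : HasDerivAt (fun t : ℝ => Real.exp (-(n - 2 : ℕ) * t))
        (Real.exp (-(n - 2 : ℕ) * t) * (-(n - 2 : ℕ) * 1)) t :=
      ((hasDerivAt_id _).const_mul _).exp
    have h2 := ((hθ.differentiable (by simp)) (t / N)).hasDerivAt.comp t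
      ((hasDerivAt_id t).div_const N)
    have h3 : deriv h t = _ := (h1.mul h2).deriv
    rw [h3, hh_def]
    simp only [Function.comp_apply, id_eq]
    ring
  have hexplog : ∀ y : EuclideanSpace ℝ (Fin n), y ≠ 0 →
      Real.exp (-(n - 2 : ℕ) * Real.log ‖y‖) = (‖y‖ ^ (n - 2))⁻¹ := by
    intro y hy
    rw [neg_mul, Real.exp_neg, Real.exp_nat_mul, Real.exp_log (norm_pos_iff.2 hy)]
  have hH := smoothOff_head hU hP
  have hw : SmoothOff (fun y => -(logRadial h y * head U P y)) := fun y hy =>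
    (((smoothOff_logRadial hh).mul hH) y hy).neg
  have hws : AnnularSupport (fun y => -(logRadial h y * head U P y)) :=
    (annularSupport_logRadial hT).mono fun y hy => by simp [hy]
  have hwint := hw.integrable hws
  have hw0 : ∀ y, 0 ≤ -(logRadial h y * head U P y) := by
    intro y
    by_cases hy : y = 0
    · simp [logRadial, hy]
    · rw [logRadial_of_ne h hy, ← mul_neg]
      exact mul_nonneg (mul_nonneg (Real.exp_pos _).le (hθ0 _)) (neg_nonneg.2 (hneg y hy))
  have hmeas : MeasurableSet {x : EuclideanSpace ℝ (Fin n) | |Real.log ‖x‖| ≤ N} :=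
    measurableSet_le (by fun_prop) measurable_const
  have hae : (fun y => -(logRadial h y * head U P y)) =ᵐ[volume.restrict
      {x | |Real.log ‖x‖| ≤ N}] fun x => |head U P x| / ‖x‖ ^ (n - 2) := by
    filter_upwards [ae_restrict_of_ae (ae_ne_zero hn0), ae_restrict_mem hmeas] with y hy hyN
    have hθy : θ (Real.log ‖y‖ / N) = 1 := hθone _ (by
      rw [abs_div, abs_of_pos hN0, div_le_one hN0]
      exact hyN)
    rw [logRadial_of_ne h hy, abs_of_nonpos (hneg y hy), hh_def]
    simp only [hθy, hexplog y hy]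
    ring
  obtain ⟨hVint, hV0⟩ := integral_radial_virial hn0 hU hP hNS hdiv hh hT
  obtain ⟨hAint, hA⟩ := integral_annulus_inv_norm_pow hn0 (by positivity : 0 ≤ 2 * N)
  have hkey : ∫ y, 2 * -(logRadial h y * head U P y) ≤
      ∫ y : EuclideanSpace ℝ (Fin n), M * (C ^ 2 + C') / N *
        indicator {s : ℝ | |Real.log s| ≤ 2 * N} (fun s => (s ^ n)⁻¹) ‖y‖ := by
    rw [← sub_zero (∫ y : EuclideanSpace ℝ (Fin n), M * (C ^ 2 + C') / N * _), ← hV0,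
      ← integral_sub (hAint.const_mul _) hVint]
    refine integral_mono_ae (hwint.const_mul 2) ((hAint.const_mul _).sub hVint) ?_
    filter_upwards [ae_ne_zero hn0] with y hy
    have hpos : 0 < ‖y‖ := norm_pos_iff.2 hy
    set S := ∑ j, U j y * y j with hS
    set r := ‖y‖ with hr
    have hSsq : S ^ 2 ≤ C ^ 2 := sq_le_sq' (abs_le.1 (hC y hy)).1 (abs_le.1 (hC y hy)).2
    have hPr : |P y| * r ^ 2 ≤ C' := (le_div_iff₀ (by positivity)).1 (hC' y hy)
    set e : ℝ := (r ^ (n - 2))⁻¹ * (deriv θ (Real.log r / N) / N) / r ^ 2 *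
      (S ^ 2 + P y * r ^ 2) with he_def
    have he : e ≤ M * (C ^ 2 + C') / N *
        indicator {s : ℝ | |Real.log s| ≤ 2 * N} (fun s => (s ^ n)⁻¹) r := by
      by_cases hmem : |Real.log r| ≤ 2 * N
      · rw [indicator_of_mem (show r ∈ {s : ℝ | |Real.log s| ≤ 2 * N} from hmem)]
        have hle : |deriv θ (Real.log r / N) * (S ^ 2 + P y * r ^ 2)| ≤ M * (C ^ 2 + C') := by
          rw [abs_mul]
          refine mul_le_mul (hM _) ((abs_add_le _ _).trans (add_le_add ?_ ?_)) (abs_nonneg _) hM0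
          · rwa [abs_of_nonneg (sq_nonneg S)]
          · rwa [abs_mul, abs_of_nonneg (sq_nonneg r)]
        have hpow : r ^ n = r ^ (n - 2) * r ^ 2 := by
          rw [← pow_add, Nat.sub_add_cancel (by omega)]
        calc e = deriv θ (Real.log r / N) * (S ^ 2 + P y * r ^ 2) * (N⁻¹ * (r ^ n)⁻¹) := by
              rw [he_def, hpow]
              field_simp
          _ ≤ M * (C ^ 2 + C') * (N⁻¹ * (r ^ n)⁻¹) := by
              exact mul_le_mul_of_nonneg_right ((le_abs_self _).trans hle) (by positivity)
          _ = M * (C ^ 2 + C') / N * (r ^ n)⁻¹ := by ring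
      · rw [indicator_of_notMem (show r ∉ {s : ℝ | |Real.log s| ≤ 2 * N} from hmem), he_def,
          hθ'zero _ (habs _ (not_le.1 hmem))]
        simp
    have hn2 : ((n - 2 : ℕ) : ℝ) = n - 2 := by
      rw [Nat.cast_sub (by omega)]
      simp
    have hhr : 0 ≤ h (Real.log r) := mul_nonneg (Real.exp_pos _).le (hθ0 _)
    have hrad : 0 ≤ (n - 2) * (h (Real.log r) * (S ^ 2 / r ^ 2)) := by
      have : (0 : ℝ) ≤ n - 2 := by rw [← hn2]; positivity
      positivity
    have hident : h (Real.log r) * (∑ j, U j y * U j y + n * P y) +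
        deriv h (Real.log r) / r ^ 2 * (S ^ 2 + P y * r ^ 2) =
        2 * (h (Real.log r) * head U P y) - (n - 2) * (h (Real.log r) * (S ^ 2 / r ^ 2)) + e := by
      rw [hh', hexplog y hy, he_def, head, hn2]
      field_simp
      ring
    rw [hident, logRadial_of_ne h hy]
    linarith
  rw [integral_const_mul, integral_const_mul, hA] at hkey
  refine ⟨(hwint.integrableOn (s := {x | |Real.log ‖x‖| ≤ N})).congr hae, ?_⟩
  rw [← integral_congr_ae hae]
  refine (setIntegral_le_integral hwint (ae_of_all _ hw0)).trans ?_
  have : M * (C ^ 2 + C') / N * (n * B * (2 * (2 * N))) =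
      2 * (2 * M * (C ^ 2 + C') * (n * B)) := by
    field_simp
  rw [this] at hkey
  linarith

end Estimates

end SteadyNavierStokes

end

open SteadyNavierStokes

/-- **Weighted integrability of the total head pressure, n ≥ 5.**  If `(u, p)` is a
smooth solution of the steady Navier-Stokes equations on `ℝⁿ \ {0}`, `n ≥ 5`, with
`|u(x)| ≤ C/|x|` and the pressure normalized so that `|p(x)| ≤ C'/|x|²`, then the total
head pressure `H = |u|²/2 + p` satisfies `∫_{ℝⁿ} |H(x)| |x|^{2-n} dx < ∞`. -/
theorem total_head_pressure_weighted_integrable {n : ℕ} (hn : 5 ≤ n)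
    (u : EuclideanSpace ℝ (Fin n) → EuclideanSpace ℝ (Fin n))
    (p : EuclideanSpace ℝ (Fin n) → ℝ)
    (hu : ContDiffOn ℝ (⊤ : ℕ∞) u {x : EuclideanSpace ℝ (Fin n) | x ≠ 0})
    (hp : ContDiffOn ℝ (⊤ : ℕ∞) p {x : EuclideanSpace ℝ (Fin n) | x ≠ 0})
    (hNS : ∀ x : EuclideanSpace ℝ (Fin n), x ≠ 0 → ∀ j : Fin n,
      -(∑ i : Fin n, fderiv ℝ (fun y => fderiv ℝ (fun z => u z j) y
            (EuclideanSpace.single i 1)) x (EuclideanSpace.single i 1)) +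
        (∑ i : Fin n, u x i * fderiv ℝ (fun z => u z j) x (EuclideanSpace.single i 1)) +
        fderiv ℝ p x (EuclideanSpace.single j 1) = 0)
    (hdiv : ∀ x : EuclideanSpace ℝ (Fin n), x ≠ 0 →
      ∑ i : Fin n, fderiv ℝ (fun z => u z i) x (EuclideanSpace.single i 1) = 0)
    (C : ℝ) (hC : 0 < C)
    (hbound : ∀ x : EuclideanSpace ℝ (Fin n), x ≠ 0 → ‖u x‖ ≤ C / ‖x‖)
    (C' : ℝ) (hC' : 0 < C')
    (hpbound : ∀ x : EuclideanSpace ℝ (Fin n), x ≠ 0 → |p x| ≤ C' / ‖x‖ ^ 2) :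
    MeasureTheory.Integrable
      (fun x : EuclideanSpace ℝ (Fin n) => |‖u x‖ ^ 2 / 2 + p x| / ‖x‖ ^ (n - 2))
      MeasureTheory.volume := by
  have hn0 : 0 < n := by omega
  have hU : ∀ j, SmoothOff fun y => u y j := fun j x hx =>
    (EuclideanSpace.proj (𝕜 := ℝ) j).contDiff.contDiffAt.comp x
      (hu.contDiffAt (isOpen_ne.mem_nhds hx))
  have hP : SmoothOff p := fun x hx => hp.contDiffAt (isOpen_ne.mem_nhds hx)
  have hnorm : ∀ x, ∑ j, u x j * u x j = ‖u x‖ ^ 2 := fun x => by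
    rw [EuclideanSpace.real_norm_sq_eq]
    exact Finset.sum_congr rfl fun j _ => by ring
  have hhead : ∀ x, head (fun j y => u y j) p x = ‖u x‖ ^ 2 / 2 + p x := fun x => by
    rw [head, hnorm]
    ring
  have hrad : ∀ x, x ≠ 0 → |∑ j, u x j * x j| ≤ C := by
    intro x hx
    have hcs := abs_real_inner_le_norm x (u x)
    have hinner : inner ℝ x (u x) = ∑ j, u x j * x j := by
      simp [PiLp.inner_apply]
    rw [hinner] at hcs
    refine hcs.trans ?_
    rw [mul_comm]
    exact (le_div_iff₀ (norm_pos_iff.2 hx)).1 (hbound x hx)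
  have hK : ∀ x, x ≠ 0 → |head (fun j y => u y j) p x| ≤ (C ^ 2 / 2 + C') / ‖x‖ ^ 2 := by
    intro x hx
    have hsq : ‖u x‖ ^ 2 ≤ C ^ 2 / ‖x‖ ^ 2 := by
      rw [← div_pow]
      exact pow_le_pow_left₀ (norm_nonneg _) (hbound x hx) 2
    rw [hhead]
    calc |‖u x‖ ^ 2 / 2 + p x| ≤ |‖u x‖ ^ 2 / 2| + |p x| := abs_add_le _ _
      _ ≤ C ^ 2 / ‖x‖ ^ 2 / 2 + C' / ‖x‖ ^ 2 := by
          rw [abs_of_nonneg (by positivity)]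
          gcongr
          exact hpbound x hx
      _ = (C ^ 2 / 2 + C') / ‖x‖ ^ 2 := by ring
  have hneg : ∀ x, x ≠ 0 → head (fun j y => u y j) p x ≤ 0 := fun x hx =>
    head_nonpos hn hU hP hNS hdiv hrad hK hx
  obtain ⟨I, hI⟩ := exists_bound_integral_cutoff_head hn hU hP hNS hdiv hrad hpbound hneg
  simp_rw [hhead] at hI
  have hcover : AECover volume atTop
      fun k : ℕ => {x : EuclideanSpace ℝ (Fin n) | |Real.log ‖x‖| ≤ (k : ℝ) + 1} := by
    refine ⟨ae_of_all _ fun x => ?_, fun k => measurableSet_le (by fun_prop) measurable_const⟩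
    obtain ⟨k₀, hk₀⟩ := exists_nat_ge |Real.log ‖x‖|
    filter_upwards [eventually_ge_atTop k₀] with k hk
    have : (k₀ : ℝ) ≤ k := by exact_mod_cast hk
    show |Real.log ‖x‖| ≤ (k : ℝ) + 1
    linarith
  refine hcover.integrable_of_integral_norm_bounded I (fun k => (hI (k + 1) (by simp)).1)
    (Eventually.of_forall fun k => ?_)
  simp only [norm_div, norm_pow, Real.norm_eq_abs, abs_abs, abs_norm]
  exact (hI (k + 1) (by simp)).2
end

section
/- Let n ≥ 5 and let (u, p) be a smooth solution of the steady Navier-Stokes equations on ℝⁿ \ {0} with |u(x)| ≤ C/|x| for all x ≠ 0, where the pressure is normalized so that |p(x)| ≤ C′/|x|² for all x ≠ 0. Then ∫_{ℝⁿ} (|u(x)|² |x|^{2−n} + |∇u(x)|² |x|^{4−n}) dx < ∞. -/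
open MeasureTheory Set Filter Topology
open scoped ContDiff

/-- The `i`-th partial derivative of a real function on `ℝⁿ`. -/
noncomputable def pd {n : ℕ} (i : Fin n) (f : EuclideanSpace ℝ (Fin n) → ℝ)
    (x : EuclideanSpace ℝ (Fin n)) : ℝ :=
  fderiv ℝ f x (EuclideanSpace.single i 1)

/-- Smoothness away from the origin. -/
def Smooth₀ {n : ℕ} (f : EuclideanSpace ℝ (Fin n) → ℝ) : Prop :=
  ContDiffOn ℝ ∞ f {x | x ≠ 0}

/-- The closed annulus `exp (-R) ≤ |x| ≤ exp R`. -/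
def annulus (n : ℕ) (R : ℝ) : Set (EuclideanSpace ℝ (Fin n)) :=
  {x | Real.exp (-R) ≤ ‖x‖ ∧ ‖x‖ ≤ Real.exp R}

section Calculus

variable {n : ℕ} {f g : EuclideanSpace ℝ (Fin n) → ℝ} {x : EuclideanSpace ℝ (Fin n)}

lemma isOpen_punctured : IsOpen {x : EuclideanSpace ℝ (Fin n) | x ≠ 0} := isOpen_ne

lemma Smooth₀.contDiffAt (hf : Smooth₀ f) (hx : x ≠ 0) : ContDiffAt ℝ ∞ f x :=
  ContDiffOn.contDiffAt hf (isOpen_punctured.mem_nhds hx)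

lemma Smooth₀.differentiableAt (hf : Smooth₀ f) (hx : x ≠ 0) : DifferentiableAt ℝ f x :=
  (hf.contDiffAt hx).differentiableAt (by simp)

lemma Smooth₀.add (hf : Smooth₀ f) (hg : Smooth₀ g) : Smooth₀ (fun x => f x + g x) :=
  ContDiffOn.add hf hg

lemma Smooth₀.sub (hf : Smooth₀ f) (hg : Smooth₀ g) : Smooth₀ (fun x => f x - g x) :=
  ContDiffOn.sub hf hg

lemma Smooth₀.mul (hf : Smooth₀ f) (hg : Smooth₀ g) : Smooth₀ (fun x => f x * g x) :=
  ContDiffOn.mul hf hg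

lemma Smooth₀.const_mul (c : ℝ) (hf : Smooth₀ f) : Smooth₀ (fun x => c * f x) :=
  ContDiffOn.mul contDiffOn_const hf

lemma Smooth₀.sum {F : Fin n → EuclideanSpace ℝ (Fin n) → ℝ} (hF : ∀ i, Smooth₀ (F i)) :
    Smooth₀ (fun x => ∑ i, F i x) :=
  ContDiffOn.sum fun i _ => hF i

lemma Smooth₀.comp {φ : ℝ → ℝ} (hφ : ContDiff ℝ ∞ φ) (hf : Smooth₀ f) :
    Smooth₀ (fun x => φ (f x)) :=
  hφ.comp_contDiffOn hf

lemma Smooth₀.pd (hf : Smooth₀ f) (i : Fin n) : Smooth₀ (pd i f) :=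
  (ContDiffOn.fderiv_of_isOpen hf isOpen_punctured (m := ∞) (by simp)).clm_apply contDiffOn_const

lemma Smooth₀.congr (hf : Smooth₀ f) (h : ∀ x, x ≠ 0 → g x = f x) : Smooth₀ g :=
  ContDiffOn.congr hf h

lemma pd_congr (h : ∀ x, x ≠ 0 → f x = g x) (i : Fin n) (hx : x ≠ 0) : pd i f x = pd i g x := by
  have : f =ᶠ[𝓝 x] g := by
    filter_upwards [isOpen_punctured.mem_nhds hx] with y hy using h y hy
  rw [pd, pd, this.fderiv_eq]

lemma pd_add (hf : Smooth₀ f) (hg : Smooth₀ g) (i : Fin n) (hx : x ≠ 0) :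
    pd i (fun x => f x + g x) x = pd i f x + pd i g x := by
  simp [pd, fderiv_fun_add (hf.differentiableAt hx) (hg.differentiableAt hx)]

lemma pd_sub (hf : Smooth₀ f) (hg : Smooth₀ g) (i : Fin n) (hx : x ≠ 0) :
    pd i (fun x => f x - g x) x = pd i f x - pd i g x := by
  simp [pd, fderiv_fun_sub (hf.differentiableAt hx) (hg.differentiableAt hx)]

lemma pd_mul (hf : Smooth₀ f) (hg : Smooth₀ g) (i : Fin n) (hx : x ≠ 0) :
    pd i (fun x => f x * g x) x = pd i f x * g x + f x * pd i g x := by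
  simp [pd, fderiv_fun_mul (hf.differentiableAt hx) (hg.differentiableAt hx)]
  ring

lemma pd_const_mul (c : ℝ) (hf : Smooth₀ f) (i : Fin n) (hx : x ≠ 0) :
    pd i (fun x => c * f x) x = c * pd i f x := by
  simp [pd, fderiv_const_mul (hf.differentiableAt hx)]

lemma pd_sum {F : Fin n → EuclideanSpace ℝ (Fin n) → ℝ} (hF : ∀ i, Smooth₀ (F i)) (i : Fin n)
    (hx : x ≠ 0) : pd i (fun x => ∑ j, F j x) x = ∑ j, pd i (F j) x := by
  simp [pd, fderiv_fun_sum fun j _ => (hF j).differentiableAt hx]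

lemma pd_comp {φ : ℝ → ℝ} (hφ : ContDiff ℝ ∞ φ) (hf : Smooth₀ f) (i : Fin n) (hx : x ≠ 0) :
    pd i (fun x => φ (f x)) x = deriv φ (f x) * pd i f x := by
  have h1 : HasDerivAt φ (deriv φ (f x)) (f x) :=
    (hφ.differentiable (by simp)).differentiableAt.hasDerivAt
  have h2 := h1.comp_hasFDerivAt x (hf.differentiableAt hx).hasFDerivAt
  rw [pd, show (fun x => φ (f x)) = φ ∘ f from rfl, h2.fderiv]
  simp [pd]

lemma pd_comm (hf : Smooth₀ f) (i j : Fin n) (hx : x ≠ 0) :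
    pd i (pd j f) x = pd j (pd i f) x := by
  have hd : DifferentiableAt ℝ (fderiv ℝ f) x :=
    ((hf.contDiffAt hx).fderiv_right (m := ∞) (by simp)).differentiableAt (by simp)
  have key : ∀ k l : Fin n, pd k (pd l f) x =
      fderiv ℝ (fderiv ℝ f) x (EuclideanSpace.single k 1) (EuclideanSpace.single l 1) := by
    intro k l
    have : pd l f = fun y => fderiv ℝ f y (EuclideanSpace.single l 1) := rfl
    rw [pd, this, fderiv_clm_apply hd (differentiableAt_const _)]
    simp
  rw [key, key]
  exact ((hf.contDiffAt hx).isSymmSndFDerivAt (by simp; norm_cast)).eq _ _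

lemma isClosed_annulus (R : ℝ) : IsClosed (annulus n R) :=
  (isClosed_le continuous_const continuous_norm).inter
    (isClosed_le continuous_norm continuous_const)

lemma pd_zero_of_zero_off {R : ℝ} (h : ∀ x, x ≠ 0 → x ∉ annulus n R → f x = 0) (i : Fin n)
    (hx₀ : x ≠ 0) (hx : x ∉ annulus n R) : pd i f x = 0 := by
  have : f =ᶠ[𝓝 x] fun _ => 0 := by
    filter_upwards [(isClosed_annulus R).isOpen_compl.mem_nhds hx,
      isOpen_punctured.mem_nhds hx₀] with y hy hy₀ using h y hy₀ hy
  rw [pd, this.fderiv_eq]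
  simp

lemma ne_zero_of_mem_annulus {R : ℝ} (hx : x ∈ annulus n R) : x ≠ 0 :=
  norm_pos_iff.1 ((Real.exp_pos _).trans_le hx.1)

lemma isCompact_annulus (R : ℝ) : IsCompact (annulus n R) :=
  (isCompact_closedBall (0 : EuclideanSpace ℝ (Fin n)) (Real.exp R)).of_isClosed_subset
    (isClosed_annulus R) fun _ hx => by simpa using hx.2

lemma ae_ne_zero [NeZero n] : ∀ᵐ x : EuclideanSpace ℝ (Fin n), x ≠ 0 := by
  simp [ae_iff]

/-- The function `f` with its value at the origin replaced by zero. -/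
noncomputable def extendByZero (f : EuclideanSpace ℝ (Fin n) → ℝ) :
    EuclideanSpace ℝ (Fin n) → ℝ := {x | x ≠ 0}.indicator f

lemma extendByZero_of_ne (hx : x ≠ 0) : extendByZero f x = f x := indicator_of_mem hx f

lemma extendByZero_of_notMem {R : ℝ} (h : ∀ x, x ≠ 0 → x ∉ annulus n R → f x = 0)
    (hx : x ∉ annulus n R) : extendByZero f x = 0 := by
  by_cases hx₀ : x = 0
  · exact indicator_of_notMem (by simp [hx₀]) f
  · rw [extendByZero_of_ne hx₀, h x hx₀ hx]

lemma hasCompactSupport_extendByZero {R : ℝ} (h : ∀ x, x ≠ 0 → x ∉ annulus n R → f x = 0) :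
    HasCompactSupport (extendByZero f) :=
  HasCompactSupport.intro (isCompact_annulus R) fun _ => extendByZero_of_notMem h

lemma Smooth₀.contDiff_extendByZero {R : ℝ} (hf : Smooth₀ f)
    (h : ∀ x, x ≠ 0 → x ∉ annulus n R → f x = 0) : ContDiff ℝ ∞ (extendByZero f) := by
  rw [contDiff_iff_contDiffAt]
  intro x
  by_cases hx : x ∈ annulus n R
  · exact (hf.congr fun _ => extendByZero_of_ne).contDiffAt (ne_zero_of_mem_annulus hx)
  · have : extendByZero f =ᶠ[𝓝 x] fun _ => 0 := by
      filter_upwards [(isClosed_annulus R).isOpen_compl.mem_nhds hx] with y hy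
        using extendByZero_of_notMem h hy
    exact contDiffAt_const.congr_of_eventuallyEq this

lemma Smooth₀.eq_zero_of_integral_nonpos [NeZero n] {R : ℝ} (hf : Smooth₀ f)
    (h : ∀ x, x ≠ 0 → x ∉ annulus n R → f x = 0) (h₀ : ∀ x, x ≠ 0 → 0 ≤ f x)
    (hint : ∫ x, f x ≤ 0) (hx : x ≠ 0) : f x = 0 := by
  by_contra hne
  have hpos : 0 < ∫ x, extendByZero f x :=
    (hf.contDiff_extendByZero h).continuous.integral_pos_of_hasCompactSupport_nonneg_nonzero
      (hasCompactSupport_extendByZero h) (fun y => indicator_nonneg h₀ y)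
      (x := x) (by rwa [extendByZero_of_ne hx])
  rw [integral_congr_ae (ae_ne_zero.mono fun y hy => extendByZero_of_ne hy)] at hpos
  exact hpos.not_ge hint

lemma integrable_pd_and_integral_pd_eq_zero [NeZero n] {R : ℝ} (hf : Smooth₀ f)
    (h : ∀ x, x ≠ 0 → x ∉ annulus n R → f x = 0) (i : Fin n) :
    Integrable (pd i f) ∧ ∫ x, pd i f x = 0 := by
  have hc := hf.contDiff_extendByZero h
  have hs := hasCompactSupport_extendByZero h
  have hae : pd i (extendByZero f) =ᵐ[volume] pd i f :=
    ae_ne_zero.mono fun y hy => pd_congr (fun _ => extendByZero_of_ne) i hy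
  have hi : Integrable (pd i (extendByZero f)) :=
    ((hc.continuous_fderiv (by simp)).clm_apply continuous_const).integrable_of_hasCompactSupport
      (hs.fderiv_apply ℝ _)
  have := integral_mul_fderiv_eq_neg_fderiv_mul_of_integrable (μ := volume)
    (f := fun _ : EuclideanSpace ℝ (Fin n) => (1 : ℝ)) (g := extendByZero f)
    (v := EuclideanSpace.single i 1)
    (by simp) (by simpa using! hi)
    (by simpa using hc.continuous.integrable_of_hasCompactSupport hs)
    (fun _ _ => differentiableAt_const _) (fun _ _ => hc.differentiable (by simp) _)
  exact ⟨hi.congr hae, by rw [← integral_congr_ae hae]; simpa [pd] using this⟩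

lemma integrable_div_and_integral_div_eq_zero [NeZero n] {R : ℝ}
    {F : Fin n → EuclideanSpace ℝ (Fin n) → ℝ}
    (hF : ∀ i, Smooth₀ (F i)) (h : ∀ i x, x ≠ 0 → x ∉ annulus n R → F i x = 0) :
    Integrable (fun x => ∑ i, pd i (F i) x) ∧ ∫ x, ∑ i, pd i (F i) x = 0 := by
  have key := fun i => integrable_pd_and_integral_pd_eq_zero (hF i) (h i) i
  refine ⟨integrable_finsetSum _ fun i _ => (key i).1, ?_⟩
  rw [integral_finsetSum _ fun i _ => (key i).1]
  exact Finset.sum_eq_zero fun i _ => (key i).2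

end Calculus

section Radial

variable {n : ℕ} {x : EuclideanSpace ℝ (Fin n)}

lemma smooth₀_coord (i : Fin n) : Smooth₀ (fun x : EuclideanSpace ℝ (Fin n) => x i) :=
  (EuclideanSpace.proj (𝕜 := ℝ) i).contDiff.contDiffOn

lemma pd_coord (i j : Fin n) : pd i (fun x : EuclideanSpace ℝ (Fin n) => x j) x =
    if i = j then 1 else 0 := by
  have : (fun x : EuclideanSpace ℝ (Fin n) => x j) = EuclideanSpace.proj (𝕜 := ℝ) j := rfl
  rw [pd, this, ContinuousLinearMap.fderiv]
  simp [eq_comm]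

lemma smooth₀_log_norm : Smooth₀ (fun x : EuclideanSpace ℝ (Fin n) => Real.log ‖x‖) :=
  fun _ hx => ((contDiffAt_norm ℝ hx).log (norm_ne_zero_iff.2 hx)).contDiffWithinAt

lemma smooth₀_inv_norm_sq : Smooth₀ (fun x : EuclideanSpace ℝ (Fin n) => (‖x‖ ^ 2)⁻¹) :=
  fun _ hx => (((contDiffAt_norm ℝ hx).pow 2).inv
    (pow_ne_zero 2 (norm_ne_zero_iff.2 hx))).contDiffWithinAt

lemma pd_log_norm (i : Fin n) (hx : x ≠ 0) :
    pd i (fun x : EuclideanSpace ℝ (Fin n) => Real.log ‖x‖) x = x i * (‖x‖ ^ 2)⁻¹ := by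
  have h0 : ‖x‖ ^ 2 ≠ 0 := pow_ne_zero 2 (norm_ne_zero_iff.2 hx)
  have h : HasFDerivAt (fun x : EuclideanSpace ℝ (Fin n) => 2⁻¹ * Real.log (‖x‖ ^ 2)) _ x :=
    ((hasStrictFDerivAt_norm_sq x).hasFDerivAt.log h0).const_mul 2⁻¹
  have e : (fun x : EuclideanSpace ℝ (Fin n) => Real.log ‖x‖) =
      fun x => 2⁻¹ * Real.log (‖x‖ ^ 2) := by
    ext y; rw [Real.log_pow]; push_cast; ring
  rw [e, pd, h.fderiv]
  simp [EuclideanSpace.inner_single_right]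
  ring

lemma pd_inv_norm_sq (i : Fin n) (hx : x ≠ 0) :
    pd i (fun x : EuclideanSpace ℝ (Fin n) => (‖x‖ ^ 2)⁻¹) x = -2 * x i * (‖x‖ ^ 2)⁻¹ ^ 2 := by
  have h0 : ‖x‖ ^ 2 ≠ 0 := pow_ne_zero 2 (norm_ne_zero_iff.2 hx)
  have h : HasFDerivAt (fun x : EuclideanSpace ℝ (Fin n) => (‖x‖ ^ 2)⁻¹) _ x :=
    (hasDerivAt_inv h0).comp_hasFDerivAt x (hasStrictFDerivAt_norm_sq x).hasFDerivAt
  rw [pd, h.fderiv]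
  simp [EuclideanSpace.inner_single_right]
  ring

lemma Smooth₀.radial {G : ℝ → ℝ} (hG : ContDiff ℝ ∞ G) :
    Smooth₀ (fun x : EuclideanSpace ℝ (Fin n) => G (Real.log ‖x‖)) :=
  smooth₀_log_norm.comp hG

lemma contDiff_deriv {G : ℝ → ℝ} (hG : ContDiff ℝ ∞ G) : ContDiff ℝ ∞ (deriv G) :=
  (contDiff_infty_iff_deriv.1 hG).2

lemma pd_radial {G : ℝ → ℝ} (hG : ContDiff ℝ ∞ G) (i : Fin n) (hx : x ≠ 0) :
    pd i (fun x : EuclideanSpace ℝ (Fin n) => G (Real.log ‖x‖)) x =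
      deriv G (Real.log ‖x‖) * (x i * (‖x‖ ^ 2)⁻¹) := by
  rw [pd_comp hG smooth₀_log_norm i hx, pd_log_norm i hx]

lemma pd_pd_radial {G : ℝ → ℝ} (hG : ContDiff ℝ ∞ G) (i j : Fin n) (hx : x ≠ 0) :
    pd i (pd j (fun x : EuclideanSpace ℝ (Fin n) => G (Real.log ‖x‖))) x =
      deriv G (Real.log ‖x‖) * (if i = j then 1 else 0) * (‖x‖ ^ 2)⁻¹ +
      (deriv (deriv G) (Real.log ‖x‖) - 2 * deriv G (Real.log ‖x‖)) *
        (x i * x j) * (‖x‖ ^ 2)⁻¹ ^ 2 := by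
  have hG' := contDiff_deriv hG
  have hs := (smooth₀_coord (n := n) j).mul smooth₀_inv_norm_sq
  rw [pd_congr (fun y hy => pd_radial hG j hy) i hx, pd_mul (Smooth₀.radial hG') hs i hx,
    pd_radial hG' i hx, pd_mul (smooth₀_coord j) smooth₀_inv_norm_sq i hx, pd_coord,
    pd_inv_norm_sq i hx]
  ring

lemma sum_coord_sq_mul_inv (hx : x ≠ 0) : (∑ i, x i * x i) * (‖x‖ ^ 2)⁻¹ = 1 := by
  have : ∑ i, x i * x i = ‖x‖ ^ 2 := by
    rw [EuclideanSpace.norm_sq_eq]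
    exact Finset.sum_congr rfl fun i _ => by rw [Real.norm_eq_abs, sq_abs, sq]
  rw [this]
  exact mul_inv_cancel₀ (pow_ne_zero 2 (norm_ne_zero_iff.2 hx))

lemma laplacian_radial {G : ℝ → ℝ} (hG : ContDiff ℝ ∞ G) (hx : x ≠ 0) :
    ∑ i, pd i (pd i (fun x : EuclideanSpace ℝ (Fin n) => G (Real.log ‖x‖))) x =
      (((n : ℝ) - 2) * deriv G (Real.log ‖x‖) + deriv (deriv G) (Real.log ‖x‖)) *
        (‖x‖ ^ 2)⁻¹ := by
  simp_rw [pd_pd_radial hG _ _ hx, if_true]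
  simp only [Finset.sum_add_distrib, ← Finset.sum_mul, ← Finset.mul_sum, Finset.sum_const,
    Finset.card_univ, Fintype.card_fin, nsmul_eq_mul]
  have := sum_coord_sq_mul_inv hx
  linear_combination (deriv (deriv G) (Real.log ‖x‖) - 2 * deriv G (Real.log ‖x‖)) *
    (‖x‖ ^ 2)⁻¹ * this

lemma hessian_radial {G : ℝ → ℝ} (hG : ContDiff ℝ ∞ G) (hx : x ≠ 0)
    (v : EuclideanSpace ℝ (Fin n)) :
    ∑ i, ∑ j, v i * v j * pd i (pd j (fun x : EuclideanSpace ℝ (Fin n) => G (Real.log ‖x‖))) x =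
      deriv G (Real.log ‖x‖) * ‖v‖ ^ 2 * (‖x‖ ^ 2)⁻¹ +
      (deriv (deriv G) (Real.log ‖x‖) - 2 * deriv G (Real.log ‖x‖)) *
        (∑ i, v i * x i) ^ 2 * (‖x‖ ^ 2)⁻¹ ^ 2 := by
  have hv : ‖v‖ ^ 2 = ∑ i, v i * v i := by
    rw [EuclideanSpace.norm_sq_eq]
    exact Finset.sum_congr rfl fun i _ => by rw [Real.norm_eq_abs, sq_abs, sq]
  simp_rw [pd_pd_radial hG _ _ hx, mul_add, Finset.sum_add_distrib]
  congr 1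
  · rw [hv, Finset.mul_sum, Finset.sum_mul]
    refine Finset.sum_congr rfl fun i _ => ?_
    rw [Finset.sum_eq_single i] <;> simp +contextual [eq_comm]
    ring
  · rw [sq (∑ i, v i * x i), Finset.sum_mul_sum, Finset.mul_sum, Finset.sum_mul]
    refine Finset.sum_congr rfl fun i _ => ?_
    rw [Finset.mul_sum, Finset.sum_mul]
    exact Finset.sum_congr rfl fun j _ => by ring

end Radial

/-- The steady Navier-Stokes equations away from the origin, in coordinates. -/
structure SteadyNS {n : ℕ} (U : Fin n → EuclideanSpace ℝ (Fin n) → ℝ)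
    (P : EuclideanSpace ℝ (Fin n) → ℝ) : Prop where
  smooth_velocity : ∀ j, Smooth₀ (U j)
  smooth_pressure : Smooth₀ P
  momentum : ∀ x, x ≠ 0 → ∀ j,
    -(∑ i, pd i (pd i (U j)) x) + (∑ i, U i x * pd i (U j) x) + pd j P x = 0
  incompressible : ∀ x, x ≠ 0 → ∑ i, pd i (U i) x = 0

/-- The kinetic energy density. -/
noncomputable def kinetic {n : ℕ} (U : Fin n → EuclideanSpace ℝ (Fin n) → ℝ)
    (x : EuclideanSpace ℝ (Fin n)) : ℝ := 2⁻¹ * ∑ j, U j x * U j x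

/-- The total head pressure `|u|² / 2 + p`. -/
noncomputable def head {n : ℕ} (U : Fin n → EuclideanSpace ℝ (Fin n) → ℝ)
    (P : EuclideanSpace ℝ (Fin n) → ℝ) (x : EuclideanSpace ℝ (Fin n)) : ℝ := kinetic U x + P x

namespace SteadyNS

variable {n : ℕ} {U : Fin n → EuclideanSpace ℝ (Fin n) → ℝ} {P : EuclideanSpace ℝ (Fin n) → ℝ}
  {x : EuclideanSpace ℝ (Fin n)}

lemma sum_pd_pd_velocity (h : SteadyNS U P) (i : Fin n) (hx : x ≠ 0) :
    ∑ j, pd i (pd j (U j)) x = 0 := by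
  rw [← pd_sum (fun j => (h.smooth_velocity j).pd j) i hx, pd_congr h.incompressible i hx]
  simp [pd]

lemma sum_pd_pd_pd_velocity (h : SteadyNS U P) (i : Fin n) (hx : x ≠ 0) :
    ∑ j, pd j (pd i (pd i (U j))) x = 0 := by
  have e : ∀ j, pd j (pd i (pd i (U j))) x = pd i (pd i (pd j (U j))) x := fun j => by
    rw [pd_comm ((h.smooth_velocity j).pd i) j i hx,
      pd_congr (fun y hy => pd_comm (h.smooth_velocity j) j i hy) i hx]
  simp_rw [e]
  rw [← pd_sum (fun j => ((h.smooth_velocity j).pd j).pd i) i hx,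
    pd_congr (fun y hy => h.sum_pd_pd_velocity i hy) i hx]
  simp [pd]

lemma laplacian_pressure (h : SteadyNS U P) (hx : x ≠ 0) :
    ∑ j, pd j (pd j P) x = -∑ i, ∑ j, pd i (U j) x * pd j (U i) x := by
  have hU := h.smooth_velocity
  have e1 : ∀ j, pd j (pd j P) x = ∑ i, pd j (pd i (pd i (U j))) x -
      ∑ i, (pd j (U i) x * pd i (U j) x + U i x * pd i (pd j (U j)) x) := by
    intro j
    rw [pd_congr (g := fun y => (∑ i, pd i (pd i (U j)) y) - ∑ i, U i y * pd i (U j) y)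
      (fun y hy => by linear_combination h.momentum y hy j) j hx,
      pd_sub (Smooth₀.sum fun i => ((hU j).pd i).pd i)
        (Smooth₀.sum fun i => (hU i).mul ((hU j).pd i)) j hx,
      pd_sum (fun i => ((hU j).pd i).pd i) j hx,
      pd_sum (fun i => (hU i).mul ((hU j).pd i)) j hx]
    congr 1
    refine Finset.sum_congr rfl fun i _ => ?_
    rw [pd_mul (hU i) ((hU j).pd i) j hx, pd_comm (hU j) j i hx]
  simp_rw [e1, Finset.sum_sub_distrib, Finset.sum_add_distrib]
  rw [Finset.sum_comm, Finset.sum_eq_zero fun i _ => h.sum_pd_pd_pd_velocity i hx,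
    Finset.sum_comm (f := fun j i => U i x * pd i (pd j (U j)) x)]
  simp_rw [← Finset.mul_sum, h.sum_pd_pd_velocity _ hx]
  simp only [mul_zero, Finset.sum_const_zero, add_zero, zero_sub]

lemma smooth_kinetic (h : SteadyNS U P) : Smooth₀ (kinetic U) :=
  (Smooth₀.sum fun j => (h.smooth_velocity j).mul (h.smooth_velocity j)).const_mul _

lemma smooth_head (h : SteadyNS U P) : Smooth₀ (head U P) :=
  h.smooth_kinetic.add h.smooth_pressure

lemma pd_kinetic (h : SteadyNS U P) (i : Fin n) (hx : x ≠ 0) :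
    pd i (kinetic U) x = ∑ j, U j x * pd i (U j) x := by
  have hU := h.smooth_velocity
  rw [show kinetic U = fun x => 2⁻¹ * ∑ j, U j x * U j x from rfl,
    pd_const_mul _ (Smooth₀.sum fun j => (hU j).mul (hU j)) i hx,
    pd_sum (fun j => (hU j).mul (hU j)) i hx, Finset.mul_sum]
  refine Finset.sum_congr rfl fun j _ => ?_
  rw [pd_mul (hU j) (hU j) i hx]
  ring

lemma pd_pd_kinetic (h : SteadyNS U P) (i : Fin n) (hx : x ≠ 0) :
    pd i (pd i (kinetic U)) x = ∑ j, (pd i (U j) x ^ 2 + U j x * pd i (pd i (U j)) x) := by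
  have hU := h.smooth_velocity
  rw [pd_congr (fun y hy => h.pd_kinetic i hy) i hx, pd_sum (fun j => (hU j).mul ((hU j).pd i)) i hx]
  refine Finset.sum_congr rfl fun j _ => ?_
  rw [pd_mul (hU j) ((hU j).pd i) i hx]
  ring

lemma pd_head (h : SteadyNS U P) (i : Fin n) (hx : x ≠ 0) :
    pd i (head U P) x = ∑ j, U j x * pd i (U j) x + pd i P x := by
  rw [show head U P = fun x => kinetic U x + P x from rfl,
    pd_add h.smooth_kinetic h.smooth_pressure i hx, h.pd_kinetic i hx]

lemma laplacian_kinetic_sub (h : SteadyNS U P) (hx : x ≠ 0) :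
    ∑ i, pd i (pd i (kinetic U)) x - ∑ i, U i x * pd i (head U P) x =
      ∑ i, ∑ j, pd i (U j) x ^ 2 := by
  simp_rw [h.pd_pd_kinetic _ hx, h.pd_head _ hx, mul_add, Finset.sum_add_distrib]
  have e : ∑ j, U j x *
      (-(∑ i, pd i (pd i (U j)) x) + (∑ i, U i x * pd i (U j) x) + pd j P x) = 0 :=
    Finset.sum_eq_zero fun j _ => by rw [h.momentum x hx j, mul_zero]
  simp_rw [mul_add, mul_neg, Finset.sum_add_distrib, Finset.mul_sum] at e
  rw [Finset.sum_neg_distrib, Finset.sum_comm,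
    Finset.sum_comm (f := fun j i => U j x * (U i x * pd i (U j) x))] at e
  have e2 : ∑ i, U i x * ∑ j, U j x * pd i (U j) x =
      ∑ i, ∑ j, U j x * (U i x * pd i (U j) x) := by
    refine Finset.sum_congr rfl fun i _ => ?_
    rw [Finset.mul_sum]
    exact Finset.sum_congr rfl fun j _ => by ring
  rw [e2]
  linear_combination -e

lemma laplacian_head_sub (h : SteadyNS U P) (hx : x ≠ 0) :
    ∑ i, pd i (pd i (head U P)) x - ∑ i, U i x * pd i (head U P) x =
      2⁻¹ * ∑ i, ∑ j, (pd i (U j) x - pd j (U i) x) ^ 2 := by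
  have e1 : ∀ i, pd i (pd i (head U P)) x = pd i (pd i (kinetic U)) x + pd i (pd i P) x := by
    intro i
    rw [pd_congr (f := pd i (head U P)) (g := fun y => pd i (kinetic U) y + pd i P y)
      (fun y hy => pd_add h.smooth_kinetic h.smooth_pressure i hy) i hx,
      pd_add (h.smooth_kinetic.pd i) (h.smooth_pressure.pd i) i hx]
  have e2 : ∑ i, ∑ j, (pd i (U j) x - pd j (U i) x) ^ 2 =
      2 * ∑ i, ∑ j, pd i (U j) x ^ 2 - 2 * ∑ i, ∑ j, pd i (U j) x * pd j (U i) x := by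
    have : ∑ i, ∑ j, pd j (U i) x ^ 2 = ∑ i, ∑ j, pd i (U j) x ^ 2 := Finset.sum_comm
    simp_rw [sub_sq, Finset.sum_add_distrib, Finset.sum_sub_distrib, this, mul_assoc,
      ← Finset.mul_sum]
    ring
  simp_rw [e1, Finset.sum_add_distrib]
  rw [e2]
  linear_combination h.laplacian_kinetic_sub hx + h.laplacian_pressure hx

variable {g : EuclideanSpace ℝ (Fin n) → ℝ} {R : ℝ}

/-- Integration by parts for the drift Laplacian. -/
lemma green [NeZero n] (h : SteadyNS U P) (hg : Smooth₀ g)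
    (hR : ∀ x, x ≠ 0 → x ∉ annulus n R → g x = 0)
    {V Q : EuclideanSpace ℝ (Fin n) → ℝ} (hV : Smooth₀ V) (hQ : Smooth₀ Q)
    {F : EuclideanSpace ℝ (Fin n) → ℝ}
    (hF : ∀ x, x ≠ 0 → F x = (∑ i, pd i (pd i V) x - ∑ i, U i x * pd i Q x) * g x -
      V x * (∑ i, pd i (pd i g) x) - Q x * ∑ i, U i x * pd i g x) :
    Integrable F ∧ ∫ x, F x = 0 := by
  have hU := h.smooth_velocity
  have sA := fun i => (hV.pd i).mul hg
  have sB := fun i => hV.mul (hg.pd i)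
  have sC := fun i => ((hU i).mul hQ).mul hg
  have key := integrable_div_and_integral_div_eq_zero (R := R)
    (fun i => ((sA i).sub (sB i)).sub (sC i))
    (fun i x hx₀ hx => by simp [hR x hx₀ hx, pd_zero_of_zero_off hR i hx₀ hx])
  have hae : F =ᵐ[volume] fun x => ∑ i, pd i (fun x => pd i V x * g x - V x * pd i g x -
      U i x * Q x * g x) x := by
    filter_upwards [ae_ne_zero] with x hx
    rw [hF x hx]
    have e : ∀ i, pd i (fun x => pd i V x * g x - V x * pd i g x - U i x * Q x * g x) x =
      pd i (pd i V) x * g x - U i x * pd i Q x * g x - V x * pd i (pd i g) x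
        - Q x * (U i x * pd i g x) - pd i (U i) x * (Q x * g x) := by
      intro i
      rw [pd_sub ((sA i).sub (sB i)) (sC i) i hx, pd_sub (sA i) (sB i) i hx,
        pd_mul (hV.pd i) hg i hx, pd_mul hV (hg.pd i) i hx, pd_mul ((hU i).mul hQ) hg i hx,
        pd_mul (hU i) hQ i hx]
      ring
    simp_rw [e, Finset.sum_sub_distrib, ← Finset.sum_mul, ← Finset.mul_sum]
    rw [h.incompressible x hx]
    ring
  exact ⟨key.1.congr hae.symm, by rw [integral_congr_ae hae]; exact key.2⟩

/-- The weak form of the pressure Poisson equation. -/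
lemma weak_pressure [NeZero n] (h : SteadyNS U P) (hg : Smooth₀ g)
    (hR : ∀ x, x ≠ 0 → x ∉ annulus n R → g x = 0)
    {F : EuclideanSpace ℝ (Fin n) → ℝ}
    (hF : ∀ x, x ≠ 0 → F x = ∑ i, ∑ j, U i x * U j x * pd i (pd j g) x +
      P x * ∑ i, pd i (pd i g) x) :
    Integrable F ∧ ∫ x, F x = 0 := by
  have hU := h.smooth_velocity
  have hP := h.smooth_pressure
  have sA := fun i => hP.mul (hg.pd i)
  have sB := fun i => (hP.pd i).mul hg
  have sC := fun i j => ((hU i).mul (hU j)).mul (hg.pd j)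
  have sD := fun i j => ((hU j).mul ((hU i).pd j)).mul hg
  have sS := fun i => Smooth₀.sum fun j => (sC i j).sub (sD i j)
  have key := integrable_div_and_integral_div_eq_zero (R := R)
    (fun i => ((sA i).sub (sB i)).add (sS i))
    (fun i x hx₀ hx => by simp [hR x hx₀ hx, pd_zero_of_zero_off hR _ hx₀ hx])
  have hae : F =ᵐ[volume] fun x => ∑ i, pd i (fun x => P x * pd i g x - pd i P x * g x +
      ∑ j, (U i x * U j x * pd j g x - U j x * pd j (U i) x * g x)) x := by
    filter_upwards [ae_ne_zero] with x hx
    rw [hF x hx]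
    have e : ∀ i, pd i (fun x => P x * pd i g x - pd i P x * g x +
      ∑ j, (U i x * U j x * pd j g x - U j x * pd j (U i) x * g x)) x =
      P x * pd i (pd i g) x - pd i (pd i P) x * g x +
      ∑ j, (pd i (U i) x * (U j x * pd j g x) + U i x * U j x * pd i (pd j g) x
        + U i x * pd i (U j) x * pd j g x - U j x * pd j (U i) x * pd i g x
        - pd i (U j) x * pd j (U i) x * g x - U j x * pd j (pd i (U i)) x * g x) := by
      intro i
      rw [pd_add ((sA i).sub (sB i)) (sS i) i hx, pd_sub (sA i) (sB i) i hx,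
        pd_mul hP (hg.pd i) i hx, pd_mul (hP.pd i) hg i hx,
        pd_sum (fun j => (sC i j).sub (sD i j)) i hx]
      congr 1
      · ring
      refine Finset.sum_congr rfl fun j _ => ?_
      rw [pd_sub (sC i j) (sD i j) i hx, pd_mul ((hU i).mul (hU j)) (hg.pd j) i hx,
        pd_mul (hU i) (hU j) i hx, pd_mul ((hU j).mul ((hU i).pd j)) hg i hx,
        pd_mul (hU j) ((hU i).pd j) i hx, pd_comm (hU i) i j hx]
      ring
    simp_rw [e, Finset.sum_add_distrib, Finset.sum_sub_distrib, Finset.sum_add_distrib]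
    have z1 : ∑ i, ∑ j, pd i (U i) x * (U j x * pd j g x) = 0 := by
      rw [← Finset.sum_mul_sum, h.incompressible x hx, zero_mul]
    have z2 : ∑ i, ∑ j, U j x * pd j (pd i (U i)) x * g x = 0 := by
      rw [Finset.sum_comm]
      simp_rw [← Finset.sum_mul, ← Finset.mul_sum, h.sum_pd_pd_velocity _ hx]
      simp
    have z3 : ∑ i, ∑ j, U j x * pd j (U i) x * pd i g x =
      ∑ i, ∑ j, U i x * pd i (U j) x * pd j g x := Finset.sum_comm
    rw [z1, z2, z3]
    simp_rw [← Finset.sum_mul, ← Finset.mul_sum]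
    rw [h.laplacian_pressure hx]
    ring
  exact ⟨key.1.congr hae.symm, by rw [integral_congr_ae hae]; exact key.2⟩

end SteadyNS

section Cutoff

lemma exists_bound_deriv_smoothTransition :
    ∃ K : ℝ, ∀ t, |deriv Real.smoothTransition t| ≤ K ∧
      |deriv (deriv Real.smoothTransition) t| ≤ K := by
  have hS : ContDiff ℝ ∞ Real.smoothTransition := Real.smoothTransition.contDiff
  have h1 : HasCompactSupport (deriv Real.smoothTransition) := by
    refine HasCompactSupport.intro (isCompact_Icc (a := (0 : ℝ)) (b := 1)) fun t ht => ?_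
    rw [mem_Icc, not_and_or, not_le, not_le] at ht
    rcases ht with ht | ht
    · have : Real.smoothTransition =ᶠ[𝓝 t] fun _ => 0 := by
        filter_upwards [Iio_mem_nhds ht] with s hs
        exact Real.smoothTransition.zero_of_nonpos (le_of_lt hs)
      rw [this.deriv_eq, deriv_const]
    · have : Real.smoothTransition =ᶠ[𝓝 t] fun _ => 1 := by
        filter_upwards [Ioi_mem_nhds ht] with s hs
        exact Real.smoothTransition.one_of_one_le (le_of_lt hs)
      rw [this.deriv_eq, deriv_const]
  obtain ⟨K₁, hK₁⟩ := h1.exists_bound_of_continuous (contDiff_deriv hS).continuous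
  obtain ⟨K₂, hK₂⟩ := h1.deriv.exists_bound_of_continuous
    (contDiff_deriv (contDiff_deriv hS)).continuous
  exact ⟨max K₁ K₂, fun t => ⟨(hK₁ t).trans (le_max_left _ _), (hK₂ t).trans (le_max_right _ _)⟩⟩

/-- Smooth plateau functions of arbitrary width with uniformly bounded derivatives. -/
structure IsPlateau (K T : ℝ) (η : ℝ → ℝ) : Prop where
  contDiff : ContDiff ℝ ∞ η
  nonneg : ∀ t, 0 ≤ η t
  le_one : ∀ t, η t ≤ 1
  eq_one : ∀ t, |t| ≤ T → η t = 1
  eq_zero : ∀ t, T + 1 ≤ |t| → η t = 0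
  abs_deriv_le : ∀ t, |deriv η t| ≤ K
  abs_deriv_deriv_le : ∀ t, |deriv (deriv η) t| ≤ K

lemma exists_isPlateau : ∃ K : ℝ, ∀ T, 0 ≤ T → ∃ η, IsPlateau K T η := by
  obtain ⟨K, hK⟩ := exists_bound_deriv_smoothTransition
  set S := Real.smoothTransition with hS_def
  have hS : ContDiff ℝ ∞ S := Real.smoothTransition.contDiff
  have hS' := contDiff_deriv hS
  have hK0 : 0 ≤ K := (abs_nonneg _).trans (hK 0).1
  have d : ∀ {f : ℝ → ℝ}, ContDiff ℝ ∞ f → ∀ t, HasDerivAt f (deriv f t) t := fun hf t =>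
    (hf.differentiable (by simp) t).hasDerivAt
  refine ⟨2 * K + 2 * K ^ 2, fun T hT => ?_⟩
  have hl : ∀ t, HasDerivAt (fun t => T + 1 - t) (-1) t := fun t =>
    (hasDerivAt_id t).const_sub (T + 1)
  have hr : ∀ t, HasDerivAt (fun t => T + 1 + t) 1 t := fun t =>
    (hasDerivAt_id t).const_add (T + 1)
  have e1 : deriv (fun t => S (T + 1 - t) * S (T + 1 + t)) = fun t =>
      -(deriv S (T + 1 - t) * S (T + 1 + t)) + S (T + 1 - t) * deriv S (T + 1 + t) := by
    ext t
    refine (((d hS _).comp t (hl t)).mul ((d hS _).comp t (hr t))).deriv.trans ?_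
    simp
  have e2 : ∀ t, deriv (deriv (fun t => S (T + 1 - t) * S (T + 1 + t))) t =
      deriv (deriv S) (T + 1 - t) * S (T + 1 + t) - 2 * (deriv S (T + 1 - t) * deriv S (T + 1 + t))
        + S (T + 1 - t) * deriv (deriv S) (T + 1 + t) := by
    intro t
    rw [e1]
    have h1 := ((d hS' _).comp t (hl t)).mul ((d hS _).comp t (hr t))
    have h2 := ((d hS _).comp t (hl t)).mul ((d hS' _).comp t (hr t))
    refine (h1.neg.add h2).deriv.trans ?_
    simp
    ring
  have s1 : ∀ t, |S t| ≤ 1 := fun t => abs_le.2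
    ⟨by linarith [Real.smoothTransition.nonneg t], Real.smoothTransition.le_one t⟩
  have m : ∀ {a b c e : ℝ}, |a| ≤ c → |b| ≤ e → |a * b| ≤ c * e := fun {a b c e} h1 h2 => by
    rw [abs_mul]; exact mul_le_mul h1 h2 (abs_nonneg _) ((abs_nonneg _).trans h1)
  refine ⟨fun t => S (T + 1 - t) * S (T + 1 + t), ?_, fun t => ?_, fun t => ?_, fun t ht => ?_,
    fun t ht => ?_, fun t => ?_, fun t => ?_⟩
  · exact (hS.comp (contDiff_const.sub contDiff_id)).mul (hS.comp (contDiff_const.add contDiff_id))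
  · exact mul_nonneg (Real.smoothTransition.nonneg _) (Real.smoothTransition.nonneg _)
  · exact mul_le_one₀ (Real.smoothTransition.le_one _) (Real.smoothTransition.nonneg _)
      (Real.smoothTransition.le_one _)
  · rw [abs_le] at ht
    rw [hS_def, Real.smoothTransition.one_of_one_le (by linarith),
      Real.smoothTransition.one_of_one_le (by linarith), one_mul]
  · rcases le_abs'.1 ht with h | h
    · rw [hS_def, Real.smoothTransition.zero_of_nonpos (x := T + 1 + t) (by linarith), mul_zero]
    · rw [hS_def, Real.smoothTransition.zero_of_nonpos (x := T + 1 - t) (by linarith), zero_mul]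
  · rw [e1]
    have h1 := m (hK (T + 1 - t)).1 (s1 (T + 1 + t))
    have h2 := m (s1 (T + 1 - t)) (hK (T + 1 + t)).1
    rw [abs_le] at *
    constructor <;> nlinarith
  · rw [e2]
    have h1 := m (hK (T + 1 - t)).2 (s1 (T + 1 + t))
    have h2 := m (s1 (T + 1 - t)) (hK (T + 1 + t)).2
    have h3 := m (hK (T + 1 - t)).1 (hK (T + 1 + t)).1
    rw [abs_le] at *
    constructor <;> nlinarith

namespace IsPlateau

variable {K T : ℝ} {η : ℝ → ℝ} {t : ℝ}

lemma deriv_eq_zero (h : IsPlateau K T η) (ht : |t| < T ∨ T + 1 < |t|) :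
    deriv η t = 0 ∧ deriv (deriv η) t = 0 := by
  have : ∃ c, η =ᶠ[𝓝 t] fun _ => c := by
    rcases ht with ht | ht
    · refine ⟨1, ?_⟩
      filter_upwards [(isOpen_lt continuous_abs continuous_const).mem_nhds ht] with s hs
        using h.eq_one s (le_of_lt hs)
    · refine ⟨0, ?_⟩
      filter_upwards [(isOpen_lt continuous_const continuous_abs).mem_nhds ht] with s hs
        using h.eq_zero s (le_of_lt hs)
  obtain ⟨c, hc⟩ := this
  have h1 := hc.deriv
  refine ⟨by simpa using h1.eq_of_nhds, by simpa using h1.deriv_eq⟩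

lemma deriv_exp_mul (h : IsPlateau K T η) (a : ℝ) :
    deriv (fun t => Real.exp (a * t) * η t) =
      fun t => Real.exp (a * t) * (a * η t + deriv η t) := by
  ext t
  have h1 : HasDerivAt (fun t => Real.exp (a * t)) (Real.exp (a * t) * a) t :=
    (((hasDerivAt_id t).const_mul a).exp).congr_deriv (by simp)
  refine (h1.mul (h.contDiff.differentiable (by simp) t).hasDerivAt).deriv.trans ?_
  ring

lemma deriv_deriv_exp_mul (h : IsPlateau K T η) (a : ℝ) :
    deriv (deriv (fun t => Real.exp (a * t) * η t)) =
      fun t => Real.exp (a * t) * (a ^ 2 * η t + 2 * a * deriv η t + deriv (deriv η) t) := by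
  rw [h.deriv_exp_mul]
  ext t
  have h1 : HasDerivAt (fun t => Real.exp (a * t)) (Real.exp (a * t) * a) t :=
    (((hasDerivAt_id t).const_mul a).exp).congr_deriv (by simp)
  have h2 := (h.contDiff.differentiable (by simp) t).hasDerivAt
  have h3 := ((contDiff_deriv h.contDiff).differentiable (by simp) t).hasDerivAt
  refine (h1.mul ((h2.const_mul a).add h3)).deriv.trans ?_
  simp
  ring

end IsPlateau

/-- A smooth convex truncation that vanishes below `δ`. -/
lemma exists_convex_truncation (δ : ℝ) (hδ : 0 < δ) : ∃ Φ : ℝ → ℝ, ContDiff ℝ ∞ Φ ∧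
    (deriv Φ = fun s => Real.smoothTransition (s - δ)) ∧ (∀ s, s ≤ δ → Φ s = 0) ∧
    ∀ s, |Φ s| ≤ |s| := by
  set S : ℝ → ℝ := fun s => Real.smoothTransition (s - δ) with hS
  have hSc : ContDiff ℝ ∞ S :=
    (Real.smoothTransition.contDiff (n := ⊤)).comp (contDiff_id.sub contDiff_const)
  have hd : ∀ s, HasDerivAt (fun s => ∫ t in (0 : ℝ)..s, S t) (S s) s := fun s =>
    hSc.continuous.integral_hasStrictDerivAt 0 s |>.hasDerivAt
  have hder : deriv (fun s => ∫ t in (0 : ℝ)..s, S t) = S := funext fun s => (hd s).deriv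
  refine ⟨fun s => ∫ t in (0 : ℝ)..s, S t, ?_, hder, fun s hs => ?_, fun s => ?_⟩
  · rw [contDiff_infty_iff_deriv, hder]
    exact ⟨fun s => (hd s).differentiableAt, hSc⟩
  · refine (intervalIntegral.integral_congr (g := fun _ => 0) fun t ht => ?_).trans (by simp)
    have : t ≤ δ := ht.2.trans (max_le hδ.le hs)
    exact Real.smoothTransition.zero_of_nonpos (by linarith)
  · have := intervalIntegral.norm_integral_le_of_norm_le_const (a := 0) (b := s) (C := 1) (f := S)
      fun t _ => by
        rw [Real.norm_eq_abs, abs_of_nonneg (Real.smoothTransition.nonneg _)]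
        exact Real.smoothTransition.le_one _
    simpa using this

end Cutoff

section Shell

/-- The closed spherical shell `s ≤ |x| ≤ e s`. -/
def shell (n : ℕ) (s : ℝ) : Set (EuclideanSpace ℝ (Fin n)) :=
  {x | s ≤ ‖x‖ ∧ ‖x‖ ≤ Real.exp 1 * s}

variable {n : ℕ}

lemma measurableSet_shell (s : ℝ) : MeasurableSet (shell n s) :=
  ((isClosed_le continuous_const continuous_norm).inter
    (isClosed_le continuous_norm continuous_const)).measurableSet

lemma integrable_and_integral_shell_le {m : ℕ} (hm : m ≤ n) {s : ℝ} (hs : 0 < s) :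
    Integrable ((shell n s).indicator fun x => (‖x‖ ^ m)⁻¹) ∧
    ∫ x, (shell n s).indicator (fun x => (‖x‖ ^ m)⁻¹) x ≤
      s ^ (n - m) *
        (Real.exp 1 ^ n * volume.real (Metric.ball (0 : EuclideanSpace ℝ (Fin n)) 1)) := by
  have hsub : shell n s ⊆ Metric.closedBall 0 (Real.exp 1 * s) := fun x hx => by
    simpa using hx.2
  have hfin : volume (shell n s) < ⊤ :=
    (measure_mono hsub).trans_lt measure_closedBall_lt_top
  have hb : ∀ x ∈ shell n s, ‖(‖x‖ ^ m)⁻¹‖ ≤ (s ^ m)⁻¹ := fun x hx => by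
    rw [norm_inv, norm_pow, norm_norm]
    exact inv_anti₀ (by positivity) (pow_le_pow_left₀ hs.le hx.1 m)
  constructor
  · rw [integrable_indicator_iff (measurableSet_shell s)]
    exact Measure.integrableOn_of_bounded hfin.ne
      (measurable_norm.pow_const m).inv.aestronglyMeasurable
      ((ae_restrict_iff' (measurableSet_shell s)).2 (ae_of_all _ hb))
  · rw [integral_indicator (measurableSet_shell s)]
    have h1 := norm_setIntegral_le_of_norm_le_const hfin hb
    have h2 : volume.real (shell n s) ≤
        (Real.exp 1 * s) ^ n * volume.real (Metric.ball (0 : EuclideanSpace ℝ (Fin n)) 1) := by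
      refine (measureReal_mono hsub measure_closedBall_lt_top.ne).trans_eq ?_
      rw [Measure.addHaar_real_closedBall _ _ (by positivity), finrank_euclideanSpace_fin]
    refine (le_abs_self _).trans (h1.trans ((mul_le_mul_of_nonneg_left h2 (by positivity)).trans_eq ?_))
    rw [pow_sub₀ s hs.ne' hm, mul_pow]
    ring

end Shell

section ShellBounds

variable {n : ℕ} {K T : ℝ} {η : ℝ → ℝ} {x : EuclideanSpace ℝ (Fin n)}

lemma lt_abs_log_norm_of_notMem_annulus {R : ℝ} (hx₀ : x ≠ 0) (hx : x ∉ annulus n R) :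
    R < |Real.log ‖x‖| := by
  have h0 := norm_pos_iff.2 hx₀
  by_contra hle
  rw [not_lt, abs_le] at hle
  exact hx ⟨(Real.le_log_iff_exp_le h0).1 hle.1, (Real.log_le_iff_le_exp h0).1 hle.2⟩

/-- The inner shell where a plateau function of `log |x|` is not locally constant, weighted by
`|x| ^ (-m)`. -/
noncomputable def innerShell (n m : ℕ) (T : ℝ) : EuclideanSpace ℝ (Fin n) → ℝ :=
  (shell n (Real.exp (-(T + 1)))).indicator fun x => (‖x‖ ^ m)⁻¹

/-- The outer shell where a plateau function of `log |x|` is not locally constant, weighted by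
`|x| ^ (-m)`. -/
noncomputable def outerShell (n m : ℕ) (T : ℝ) : EuclideanSpace ℝ (Fin n) → ℝ :=
  (shell n (Real.exp T)).indicator fun x => (‖x‖ ^ m)⁻¹

lemma innerShell_nonneg (m : ℕ) : 0 ≤ innerShell n m T x :=
  indicator_nonneg (fun _ _ => by positivity) x

lemma outerShell_nonneg (m : ℕ) : 0 ≤ outerShell n m T x :=
  indicator_nonneg (fun _ _ => by positivity) x

namespace IsPlateau

lemma radial_eq_zero (h : IsPlateau K T η) (hx₀ : x ≠ 0) (hx : x ∉ annulus n (T + 1)) :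
    η (Real.log ‖x‖) = 0 :=
  h.eq_zero _ (lt_abs_log_norm_of_notMem_annulus hx₀ hx).le

lemma trichotomy (h : IsPlateau K T η) (hx : x ≠ 0) (m : ℕ) :
    (deriv η (Real.log ‖x‖) = 0 ∧ deriv (deriv η) (Real.log ‖x‖) = 0) ∨
    (‖x‖ ^ m)⁻¹ = innerShell n m T x ∨
    (Real.exp T ≤ ‖x‖ ∧ (‖x‖ ^ m)⁻¹ = outerShell n m T x) := by
  have h0 := norm_pos_iff.2 hx
  by_cases ht : |Real.log ‖x‖| < T ∨ T + 1 < |Real.log ‖x‖|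
  · exact Or.inl (h.deriv_eq_zero ht)
  · rw [not_or, not_lt, not_lt] at ht
    obtain ⟨h1, h2⟩ := ht
    rw [abs_le] at h2
    right
    rcases le_abs'.1 h1 with h3 | h3
    · left
      refine (indicator_of_mem (s := shell n (Real.exp (-(T + 1)))) ?_ fun x => (‖x‖ ^ m)⁻¹).symm
      refine ⟨(Real.le_log_iff_exp_le h0).1 h2.1, ?_⟩
      rw [← Real.exp_add]
      exact (Real.log_le_iff_le_exp h0).1 (by linarith)
    · right
      have h4 := (Real.le_log_iff_exp_le h0).1 h3
      refine ⟨h4, (indicator_of_mem (s := shell n (Real.exp T)) ?_ fun x => (‖x‖ ^ m)⁻¹).symm⟩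
      refine ⟨h4, ?_⟩
      rw [← Real.exp_add]
      exact (Real.log_le_iff_le_exp h0).1 (by linarith)

lemma abs_deriv_mul_le (h : IsPlateau K T η) (hx : x ≠ 0) (m : ℕ) :
    |deriv η (Real.log ‖x‖)| * (‖x‖ ^ m)⁻¹ ≤ K * (innerShell n m T x + outerShell n m T x) ∧
    |deriv (deriv η) (Real.log ‖x‖)| * (‖x‖ ^ m)⁻¹ ≤
      K * (innerShell n m T x + outerShell n m T x) := by
  have hK : 0 ≤ K := (abs_nonneg _).trans (h.abs_deriv_le 0)
  have hi := innerShell_nonneg (T := T) (x := x) m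
  have ho := outerShell_nonneg (T := T) (x := x) m
  have hw : 0 ≤ (‖x‖ ^ m)⁻¹ := by positivity
  rcases h.trichotomy hx m with ⟨h1, h2⟩ | h1 | ⟨-, h1⟩
  · rw [h1, h2, abs_zero, zero_mul]
    exact ⟨by positivity, by positivity⟩
  all_goals
    have h2 : (‖x‖ ^ m)⁻¹ ≤ innerShell n m T x + outerShell n m T x := by linarith
    exact ⟨mul_le_mul (h.abs_deriv_le _) h2 hw hK, mul_le_mul (h.abs_deriv_deriv_le _) h2 hw hK⟩

end IsPlateau

end ShellBounds

namespace SteadyNS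

variable {n : ℕ} {U : Fin n → EuclideanSpace ℝ (Fin n) → ℝ} {P : EuclideanSpace ℝ (Fin n) → ℝ}
  {x : EuclideanSpace ℝ (Fin n)}

lemma drift_laplacian_comp_head (h : SteadyNS U P) {Φ : ℝ → ℝ} (hΦ : ContDiff ℝ ∞ Φ)
    (hx : x ≠ 0) :
    ∑ i, pd i (pd i fun x => Φ (head U P x)) x - ∑ i, U i x * pd i (fun x => Φ (head U P x)) x =
      deriv (deriv Φ) (head U P x) * ∑ i, pd i (head U P) x * pd i (head U P) x +
      deriv Φ (head U P x) * (2⁻¹ * ∑ i, ∑ j, (pd i (U j) x - pd j (U i) x) ^ 2) := by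
  have hH := h.smooth_head
  have hΦ' := contDiff_deriv hΦ
  have e : ∀ i, pd i (pd i fun x => Φ (head U P x)) x =
      deriv (deriv Φ) (head U P x) * (pd i (head U P) x * pd i (head U P) x) +
      deriv Φ (head U P x) * pd i (pd i (head U P)) x := fun i => by
    rw [pd_congr (fun y hy => pd_comp hΦ hH i hy) i hx, pd_mul (hH.comp hΦ') (hH.pd i) i hx,
      pd_comp hΦ' hH i hx]
    ring
  simp_rw [e, pd_comp hΦ hH _ hx, ← h.laplacian_head_sub hx, Finset.sum_add_distrib,
    mul_left_comm (U _ x), ← Finset.mul_sum]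
  ring

lemma integral_truncation_le [NeZero n] (h : SteadyNS U P) (hn : 4 ≤ n) {C D δ K T₀ T : ℝ}
    (hC : ∀ x, x ≠ 0 → |∑ i, U i x * x i| ≤ C)
    (hD : ∀ x, x ≠ 0 → |head U P x| ≤ D * (‖x‖ ^ 2)⁻¹)
    {Φ : ℝ → ℝ} (hΦ : ContDiff ℝ ∞ Φ) (hΦ' : ∀ s, 0 ≤ deriv Φ s)
    (hΦ'' : ∀ s, 0 ≤ deriv (deriv Φ) s) (hΦ0 : ∀ s, s ≤ δ → Φ s = 0) (hΦ1 : ∀ s, |Φ s| ≤ |s|)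
    {η₀ η : ℝ → ℝ} (hη₀ : IsPlateau K T₀ η₀) (hη : IsPlateau K T η) (hT : T₀ + 1 ≤ T)
    (hTδ : D * (Real.exp T ^ 2)⁻¹ ≤ δ) :
    ∫ x, deriv (deriv Φ) (head U P x) * (∑ i, pd i (head U P) x * pd i (head U P) x) *
      η₀ (Real.log ‖x‖) ≤ D * ((n + C) * K) * (Real.exp (-(T + 1)) ^ (n - 4) *
        (Real.exp 1 ^ n * volume.real (Metric.ball (0 : EuclideanSpace ℝ (Fin n)) 1))) := by
  have hn' : (4 : ℝ) ≤ n := by exact_mod_cast hn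
  obtain ⟨y, hy⟩ := exists_ne (0 : EuclideanSpace ℝ (Fin n))
  have hC0 : 0 ≤ C := (abs_nonneg _).trans (hC y hy)
  have hD0 : 0 ≤ D := by
    have := (abs_nonneg _).trans (hD y hy)
    exact nonneg_of_mul_nonneg_left this (by positivity)
  have hK0 : 0 ≤ K := (abs_nonneg _).trans (hη.abs_deriv_le 0)
  set g : EuclideanSpace ℝ (Fin n) → ℝ := fun x => η (Real.log ‖x‖) with hg
  set V : EuclideanSpace ℝ (Fin n) → ℝ := fun x => Φ (head U P x) with hV
  have hVs : Smooth₀ V := h.smooth_head.comp hΦ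
  obtain ⟨hFi, hF0⟩ := h.green (g := g) (Smooth₀.radial hη.contDiff)
    (fun x hx₀ hx => hη.radial_eq_zero hx₀ hx) hVs hVs (fun _ _ => rfl)
  obtain ⟨hSi, hSb⟩ := integrable_and_integral_shell_le (n := n) hn (Real.exp_pos (-(T + 1)))
  have hdom := hFi.add (hSi.const_mul (D * ((n + C) * K)))
  refine (integral_mono_of_nonneg ?_ hdom ?_).trans ?_
  · filter_upwards with x
    exact mul_nonneg (mul_nonneg (hΦ'' _) (Finset.sum_nonneg fun i _ => mul_self_nonneg _))
      (hη₀.nonneg _)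
  · filter_upwards [ae_ne_zero] with x hx
    have hr := norm_pos_iff.2 hx
    have hM : 0 ≤ deriv (deriv Φ) (head U P x) * ∑ i, pd i (head U P) x * pd i (head U P) x :=
      mul_nonneg (hΦ'' _) (Finset.sum_nonneg fun i _ => mul_self_nonneg _)
    have hle : η₀ (Real.log ‖x‖) ≤ η (Real.log ‖x‖) := by
      by_cases ht : |Real.log ‖x‖| ≤ T
      · rw [hη.eq_one _ ht]
        exact hη₀.le_one _
      · rw [hη₀.eq_zero _ (by linarith)]
        exact hη.nonneg _
    have hLap := h.drift_laplacian_comp_head hΦ hx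
    have hvort : 0 ≤ deriv Φ (head U P x) *
        (2⁻¹ * ∑ i, ∑ j, (pd i (U j) x - pd j (U i) x) ^ 2) :=
      mul_nonneg (hΦ' _) (mul_nonneg (by norm_num)
        (Finset.sum_nonneg fun i _ => Finset.sum_nonneg fun j _ => sq_nonneg _))
    have hdrift : ∑ i, U i x * pd i g x =
        deriv η (Real.log ‖x‖) * (∑ i, U i x * x i) * (‖x‖ ^ 2)⁻¹ := by
      simp_rw [hg, pd_radial hη.contDiff _ hx]
      rw [Finset.mul_sum, Finset.sum_mul]
      exact Finset.sum_congr rfl fun i _ => by ring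
    have hlapg := laplacian_radial hη.contDiff hx
    have hbd : -(V x * ((n - 2) * deriv η (Real.log ‖x‖) + deriv (deriv η) (Real.log ‖x‖)
        + deriv η (Real.log ‖x‖) * ∑ i, U i x * x i) * (‖x‖ ^ 2)⁻¹) ≥ -
        (D * ((n + C) * K) * innerShell n 4 T x) := by
      rw [ge_iff_le, neg_le_neg_iff]
      rcases hη.trichotomy hx 4 with ⟨h1, h2⟩ | h1 | ⟨h1, -⟩
      · rw [h1, h2]
        have := innerShell_nonneg (T := T) (x := x) 4
        simp only [mul_zero, zero_mul, add_zero]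
        positivity
      · rw [← h1]
        have hV1 : |V x| ≤ D * (‖x‖ ^ 2)⁻¹ := (hΦ1 _).trans (hD x hx)
        have h2 : |(n - 2) * deriv η (Real.log ‖x‖) + deriv (deriv η) (Real.log ‖x‖)
            + deriv η (Real.log ‖x‖) * ∑ i, U i x * x i| ≤ (n + C) * K := by
          have a1 : |(n - 2) * deriv η (Real.log ‖x‖)| ≤ (n - 2) * K := by
            rw [abs_mul, abs_of_nonneg (by linarith : (0 : ℝ) ≤ n - 2)]
            exact mul_le_mul_of_nonneg_left (hη.abs_deriv_le _) (by linarith)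
          have a2 : |deriv η (Real.log ‖x‖) * ∑ i, U i x * x i| ≤ K * C := by
            rw [abs_mul]
            exact mul_le_mul (hη.abs_deriv_le _) (hC x hx) (abs_nonneg _) hK0
          refine (abs_add_three _ _ _).trans ?_
          linarith [hη.abs_deriv_deriv_le (Real.log ‖x‖)]
        have h3 : |V x * ((n - 2) * deriv η (Real.log ‖x‖) + deriv (deriv η) (Real.log ‖x‖)
            + deriv η (Real.log ‖x‖) * ∑ i, U i x * x i)| ≤
            D * (‖x‖ ^ 2)⁻¹ * ((n + C) * K) := by
          rw [abs_mul]
          exact mul_le_mul hV1 h2 (abs_nonneg _) (by positivity)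
        refine (mul_le_mul_of_nonneg_right ((le_abs_self _).trans h3) (by positivity)).trans_eq ?_
        rw [show ‖x‖ ^ 4 = ‖x‖ ^ 2 * ‖x‖ ^ 2 by ring, mul_inv]
        ring
      · have : V x = 0 := by
          refine hΦ0 _ ((le_abs_self _).trans ((hD x hx).trans (le_trans ?_ hTδ)))
          gcongr
        have := innerShell_nonneg (T := T) (x := x) 4
        rw [‹V x = 0›, zero_mul, zero_mul]
        positivity
    have hM' := mul_le_mul_of_nonneg_left hle hM
    have hη0 := hη.nonneg (Real.log ‖x‖)
    have hv' := mul_nonneg hvort hη0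
    simp only [Pi.add_apply]
    rw [hdrift]
    have hlapg' : ∑ i, pd i (pd i g) x = _ := hlapg
    rw [hlapg', hLap]
    have hgx : g x = η (Real.log ‖x‖) := rfl
    have hin : (shell n (Real.exp (-(T + 1)))).indicator (fun x => (‖x‖ ^ 4)⁻¹) x =
      innerShell n 4 T x := rfl
    rw [hgx, hin]
    linarith
  · refine (integral_add hFi (hSi.const_mul _)).trans_le ?_
    rw [hF0, zero_add, integral_const_mul]
    exact mul_le_mul_of_nonneg_left hSb (by positivity)

/-- The total head pressure of a solution with scale-invariant bounds is nonpositive. -/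
lemma head_nonpos [NeZero n] (h : SteadyNS U P) (hn : 5 ≤ n) {C D : ℝ}
    (hC : ∀ x, x ≠ 0 → |∑ i, U i x * x i| ≤ C)
    (hD : ∀ x, x ≠ 0 → |head U P x| ≤ D * (‖x‖ ^ 2)⁻¹) (hx : x ≠ 0) : head U P x ≤ 0 := by
  refine le_of_forall_pos_le_add fun δ hδ => ?_
  rw [zero_add]
  obtain ⟨Φ, hΦ, hΦd, hΦ0, hΦ1⟩ := exists_convex_truncation δ hδ
  obtain ⟨K, hK⟩ := exists_isPlateau
  have hΦ' : ∀ s, 0 ≤ deriv Φ s := fun s => by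
    rw [hΦd]; exact Real.smoothTransition.nonneg _
  have hmono : Monotone (deriv Φ) := fun s t hst => by
    rw [hΦd]; exact Real.smoothTransition.monotone (by linarith)
  have hΦ'' : ∀ s, 0 ≤ deriv (deriv Φ) s := fun s => hmono.deriv_nonneg
  have hH := h.smooth_head
  have hsq : Tendsto (fun T : ℝ => D * (Real.exp T ^ 2)⁻¹) atTop (𝓝 0) := by
    simpa using ((tendsto_inv_atTop_zero.comp
      ((tendsto_pow_atTop two_ne_zero).comp Real.tendsto_exp_atTop)).const_mul D)
  have hzero : ∀ y, y ≠ 0 → deriv (deriv Φ) (head U P y) *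
      (∑ i, pd i (head U P) y * pd i (head U P) y) = 0 := by
    intro y hy
    obtain ⟨η₀, hη₀⟩ := hK |Real.log ‖y‖| (abs_nonneg _)
    have hs : Smooth₀ fun x => deriv (deriv Φ) (head U P x) *
        (∑ i, pd i (head U P) x * pd i (head U P) x) * η₀ (Real.log ‖x‖) :=
      ((hH.comp (contDiff_deriv (contDiff_deriv hΦ))).mul
        (Smooth₀.sum fun i => (hH.pd i).mul (hH.pd i))).mul (Smooth₀.radial hη₀.contDiff)
    have hlim : Tendsto (fun T : ℝ => D * ((n + C) * K) * (Real.exp (-(T + 1)) ^ (n - 4) *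
        (Real.exp 1 ^ n * volume.real (Metric.ball (0 : EuclideanSpace ℝ (Fin n)) 1))))
        atTop (𝓝 0) := by
      have h1 : Tendsto (fun T : ℝ => Real.exp (-(T + 1)) ^ (n - 4)) atTop (𝓝 0) := by
        have := (Real.tendsto_exp_neg_atTop_nhds_zero.comp
          (tendsto_atTop_add_const_right atTop (1 : ℝ) tendsto_id)).pow (n - 4)
        rw [zero_pow (by omega)] at this
        exact this
      simpa using (h1.mul_const _).const_mul (D * ((n + C) * K))
    have hint := ge_of_tendsto hlim (b := ∫ x, deriv (deriv Φ) (head U P x) *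
        (∑ i, pd i (head U P) x * pd i (head U P) x) * η₀ (Real.log ‖x‖)) (by
      filter_upwards [eventually_ge_atTop (|Real.log ‖y‖| + 1),
        hsq.eventually (eventually_le_nhds hδ)] with T hT hTδ
      obtain ⟨η, hη⟩ := hK T (by linarith [abs_nonneg (Real.log ‖y‖)])
      exact h.integral_truncation_le (by omega) hC hD hΦ hΦ' hΦ'' hΦ0 hΦ1 hη₀ hη hT hTδ)
    have := hs.eq_zero_of_integral_nonpos
      (fun x hx₀ hx => by rw [hη₀.radial_eq_zero hx₀ hx, mul_zero])
      (fun x _ => mul_nonneg (mul_nonneg (hΦ'' _)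
        (Finset.sum_nonneg fun i _ => mul_self_nonneg _)) (hη₀.nonneg _)) hint hy
    rwa [hη₀.eq_one _ le_rfl, mul_one] at this
  set W : EuclideanSpace ℝ (Fin n) → ℝ := fun y => deriv Φ (head U P y) with hW
  have hWs : Smooth₀ W := hH.comp (contDiff_deriv hΦ)
  have hpd : ∀ y, y ≠ 0 → ∀ i, pd i W y = 0 := fun y hy i => by
    rw [hW, pd_comp (contDiff_deriv hΦ) hH i hy]
    rcases mul_eq_zero.1 (hzero y hy) with h1 | h1
    · rw [h1, zero_mul]
    · have := (Finset.sum_eq_zero_iff_of_nonneg fun i _ => mul_self_nonneg _).1 h1 i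
        (Finset.mem_univ i)
      rw [mul_self_eq_zero.1 this, mul_zero]
  have hconn : IsPreconnected {y : EuclideanSpace ℝ (Fin n) | y ≠ 0} := by
    refine (isConnected_compl_singleton_of_one_lt_rank ?_ 0).isPreconnected
    rw [← Module.finrank_eq_rank, finrank_euclideanSpace_fin]
    exact_mod_cast (by omega : 1 < n)
  have hfd : EqOn (fderiv ℝ W) 0 {y : EuclideanSpace ℝ (Fin n) | y ≠ 0} := fun y hy => by
    refine ContinuousLinearMap.coe_injective ((EuclideanSpace.basisFun (Fin n) ℝ).toBasis.ext ?_)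
    intro i
    simpa [pd] using hpd y hy i
  obtain ⟨y, hy⟩ := exists_ne (0 : EuclideanSpace ℝ (Fin n))
  obtain ⟨c, hc⟩ := isOpen_punctured.exists_is_const_of_fderiv_eq_zero hconn
    (fun z hz => (hWs.differentiableAt hz).differentiableWithinAt) hfd
  obtain ⟨T, hTδ⟩ := (hsq.eventually (eventually_le_nhds hδ)).exists
  set z : EuclideanSpace ℝ (Fin n) := (Real.exp T / ‖y‖) • y with hz_def
  have hz : ‖z‖ = Real.exp T := by
    have := norm_pos_iff.2 hy
    rw [hz_def, norm_smul, Real.norm_of_nonneg (by positivity)]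
    field_simp
  have hz₀ : z ≠ 0 := norm_pos_iff.1 (hz ▸ Real.exp_pos T)
  have hWz : W z = 0 := by
    have : head U P z ≤ δ := (le_abs_self _).trans ((hD z hz₀).trans (by rwa [hz]))
    rw [hW]
    simp only [hΦd]
    exact Real.smoothTransition.zero_of_nonpos (by linarith)
  have hWx : Real.smoothTransition (head U P x - δ) = 0 := by
    have := (hc x hx).trans (hc z hz₀).symm
    rw [hWz, hW] at this
    simpa only [hΦd] using this
  by_contra! hlt
  exact (Real.smoothTransition.pos_of_pos (sub_pos.2 hlt)).ne' hWx

end SteadyNS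

lemma abs_mul_mul_le_of_abs_le {e ρ d A A₀ B : ℝ} (he : 0 ≤ e) (hρ : 0 ≤ ρ) (hA₀ : 0 ≤ A₀)
    (hA : |A| ≤ A₀ * ρ) (hd : |d| * (e * ρ ^ 2) ≤ B) : |e * ρ * (d * A)| ≤ A₀ * B := by
  rw [abs_mul, abs_mul, abs_mul, abs_of_nonneg he, abs_of_nonneg hρ]
  calc e * ρ * (|d| * |A|) ≤ e * ρ * (|d| * (A₀ * ρ)) := by gcongr
    _ = A₀ * (|d| * (e * ρ ^ 2)) := by ring
    _ ≤ A₀ * B := by gcongr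

/-- The algebraic inequality combining the weighted energy and pressure identities.  Here `k`, `z`
and `P` stand for `|u|²`, `u · x` and the pressure, and `y`, `d₁`, `d₂` for a cutoff function and
its derivatives. -/
lemma weighted_energy_le {N e ρ B C C' y d₁ d₂ k z P G FE FP : ℝ} (hN : 5 ≤ N) (he : 0 ≤ e)
    (hρ : 0 ≤ ρ) (hy : 0 ≤ y) (hC : 0 ≤ C) (hC' : 0 ≤ C') (hk₀ : 0 ≤ k) (hk : k ≤ C ^ 2 * ρ)
    (hz : |z| ≤ C) (hP : |P| ≤ C' * ρ) (hd₁ : |d₁| * (e * ρ ^ 2) ≤ B)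
    (hd₂ : |d₂| * (e * ρ ^ 2) ≤ B) (hH : 2⁻¹ * k + P ≤ 0)
    (hFP : FP = e * ((4 - N) * y + d₁) * k * ρ +
      (e * ((4 - N) ^ 2 * y + 2 * (4 - N) * d₁ + d₂) - 2 * (e * ((4 - N) * y + d₁))) * z ^ 2 *
        ρ ^ 2 +
      P * (((N - 2) * (e * ((4 - N) * y + d₁)) +
        e * ((4 - N) ^ 2 * y + 2 * (4 - N) * d₁ + d₂)) * ρ))
    (hFE : FE = G * (e * y) - 2⁻¹ * k * (((N - 2) * (e * ((4 - N) * y + d₁)) +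
        e * ((4 - N) ^ 2 * y + 2 * (4 - N) * d₁ + d₂)) * ρ) -
      (2⁻¹ * k + P) * (e * ((4 - N) * y + d₁) * z * ρ)) :
    (k * (ρ * e) + G * e) * y ≤ FE + C / 2 * FP +
      ((C / 2) * ((C ^ 2 + 2 * N * C ^ 2 + N * C') + (C ^ 2 + C')) +
        (2⁻¹ * C ^ 2 * N + 2⁻¹ * C ^ 2 + (2⁻¹ * C ^ 2 + C') * C)) * B := by
  have hq : |z ^ 2 * ρ| ≤ C ^ 2 * ρ := by
    rw [abs_mul, abs_of_nonneg hρ, abs_of_nonneg (sq_nonneg z), ← sq_abs z]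
    gcongr
  have hk' : |k| ≤ C ^ 2 * ρ := by rwa [abs_of_nonneg hk₀]
  have hA1 : |k + (2 * (4 - N) - 2) * (z ^ 2 * ρ) + (N - 2 + 2 * (4 - N)) * P| ≤
      (C ^ 2 + 2 * N * C ^ 2 + N * C') * ρ := by
    refine (abs_add_three _ _ _).trans ?_
    have h1 : |(2 * (4 - N) - 2) * (z ^ 2 * ρ)| ≤ 2 * N * (C ^ 2 * ρ) := by
      rw [abs_mul]
      exact mul_le_mul (abs_le.2 ⟨by linarith, by linarith⟩) hq (abs_nonneg _) (by linarith)
    have h2 : |(N - 2 + 2 * (4 - N)) * P| ≤ N * (C' * ρ) := by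
      rw [abs_mul]
      exact mul_le_mul (abs_le.2 ⟨by linarith, by linarith⟩) hP (abs_nonneg _) (by linarith)
    linarith
  have hA2 : |z ^ 2 * ρ + P| ≤ (C ^ 2 + C') * ρ := by
    refine (abs_add_le _ _).trans ?_
    linarith
  have hA3 : |2⁻¹ * k * (N - 2 + 2 * (4 - N))| ≤ (2⁻¹ * C ^ 2 * N) * ρ := by
    rw [abs_mul, abs_of_nonneg (by positivity : 0 ≤ 2⁻¹ * k)]
    have : |N - 2 + 2 * (4 - N)| ≤ N := abs_le.2 ⟨by linarith, by linarith⟩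
    calc 2⁻¹ * k * |N - 2 + 2 * (4 - N)| ≤ 2⁻¹ * (C ^ 2 * ρ) * N := by gcongr
      _ = _ := by ring
  have hA4 : |2⁻¹ * k| ≤ (2⁻¹ * C ^ 2) * ρ := by
    rw [abs_of_nonneg (by positivity)]
    linarith
  have hA5 : |(2⁻¹ * k + P) * z| ≤ ((2⁻¹ * C ^ 2 + C') * C) * ρ := by
    have : |2⁻¹ * k + P| ≤ (2⁻¹ * C ^ 2 + C') * ρ := (abs_add_le _ _).trans (by linarith)
    rw [abs_mul]
    calc |2⁻¹ * k + P| * |z| ≤ (2⁻¹ * C ^ 2 + C') * ρ * C := by gcongr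
      _ = _ := by ring
  have hN0 : 0 ≤ N := by linarith
  have b1 := (abs_le.1 (abs_mul_mul_le_of_abs_le he hρ (by positivity) hA1 hd₁)).1
  have b2 := (abs_le.1 (abs_mul_mul_le_of_abs_le he hρ (by positivity) hA2 hd₂)).1
  have b3 := (abs_le.1 (abs_mul_mul_le_of_abs_le he hρ (by positivity) hA3 hd₁)).2
  have b4 := (abs_le.1 (abs_mul_mul_le_of_abs_le he hρ (by positivity) hA4 hd₂)).2
  have b5 := (abs_le.1 (abs_mul_mul_le_of_abs_le he hρ (by positivity) hA5 hd₁)).2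
  have hpress : (N - 4) * (e * ρ * y * (-(2⁻¹ * k + P))) ≤ 2⁻¹ * FP + 2⁻¹ *
      (((C ^ 2 + 2 * N * C ^ 2 + N * C') + (C ^ 2 + C')) * B) := by
    have hpos : 0 ≤ (N - 4) * (N - 2) * (e * ρ * y * (z ^ 2 * ρ)) :=
      mul_nonneg (mul_nonneg (by linarith) (by linarith)) (by positivity)
    rw [hFP]
    linarith
  have hdrift : (N - 4) * (e * ρ * y * (-(2⁻¹ * k + P))) * z ≤
      (N - 4) * (e * ρ * y * (-(2⁻¹ * k + P))) * C :=
    mul_le_mul_of_nonneg_left ((le_abs_self z).trans hz)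
      (mul_nonneg (by linarith) (mul_nonneg (by positivity) (by linarith)))
  have hpress' := mul_le_mul_of_nonneg_left hpress hC
  have hsurplus : 0 ≤ (N - 5) * (k * (ρ * e) * y) :=
    mul_nonneg (by linarith) (by positivity)
  rw [hFE]
  linarith

namespace SteadyNS

variable {n : ℕ} {U : Fin n → EuclideanSpace ℝ (Fin n) → ℝ} {P : EuclideanSpace ℝ (Fin n) → ℝ}
  {x : EuclideanSpace ℝ (Fin n)}

/-- The weighted energy density `|u|² |x|^(2-n) + |∇u|² |x|^(4-n)`. -/
noncomputable def weightedEnergy (U : Fin n → EuclideanSpace ℝ (Fin n) → ℝ)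
    (x : EuclideanSpace ℝ (Fin n)) : ℝ :=
  (∑ j, U j x * U j x) / ‖x‖ ^ (n - 2) + (∑ i, ∑ j, pd i (U j) x ^ 2) / ‖x‖ ^ (n - 4)

lemma weightedEnergy_nonneg : 0 ≤ weightedEnergy U x :=
  add_nonneg (div_nonneg (Finset.sum_nonneg fun _ _ => mul_self_nonneg _) (by positivity))
    (div_nonneg (Finset.sum_nonneg fun _ _ => Finset.sum_nonneg fun _ _ => sq_nonneg _)
      (by positivity))

lemma setIntegral_annulus_weightedEnergy_le [NeZero n] (h : SteadyNS U P) (hn : 5 ≤ n)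
    {C C' K T : ℝ} (hC' : 0 ≤ C') (hU : ∀ x, x ≠ 0 → ∑ j, U j x * U j x ≤ C ^ 2 * (‖x‖ ^ 2)⁻¹)
    (hC : ∀ x, x ≠ 0 → |∑ i, U i x * x i| ≤ C) (hP : ∀ x, x ≠ 0 → |P x| ≤ C' * (‖x‖ ^ 2)⁻¹)
    {η : ℝ → ℝ} (hη : IsPlateau K T η) :
    ∫ x in annulus n T, weightedEnergy U x ≤
      ((C / 2) * ((C ^ 2 + 2 * n * C ^ 2 + n * C') + (C ^ 2 + C')) +
        (2⁻¹ * C ^ 2 * n + 2⁻¹ * C ^ 2 + (2⁻¹ * C ^ 2 + C') * C)) * (K *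
      (2 * (Real.exp 1 ^ n * volume.real (Metric.ball (0 : EuclideanSpace ℝ (Fin n)) 1)))) := by
  have hn' : (5 : ℝ) ≤ n := by exact_mod_cast hn
  obtain ⟨x₀, hx₀⟩ := exists_ne (0 : EuclideanSpace ℝ (Fin n))
  have hC0 : 0 ≤ C := (abs_nonneg _).trans (hC x₀ hx₀)
  have hK0 : 0 ≤ K := (abs_nonneg _).trans (hη.abs_deriv_le 0)
  have hH : ∀ x, x ≠ 0 → head U P x ≤ 0 := fun x hx => by
    refine h.head_nonpos hn (D := 2⁻¹ * C ^ 2 + C') hC (fun y hy => ?_) hx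
    refine (abs_add_le _ _).trans ?_
    rw [kinetic, abs_of_nonneg (mul_nonneg (by norm_num)
      (Finset.sum_nonneg fun _ _ => mul_self_nonneg _))]
    linarith [hU y hy, hP y hy]
  set a : ℝ := 4 - n with ha
  set G : ℝ → ℝ := fun t => Real.exp (a * t) * η t with hG_def
  have hG : ContDiff ℝ ∞ G :=
    (Real.contDiff_exp.comp (contDiff_const.mul contDiff_id)).mul hη.contDiff
  set g : EuclideanSpace ℝ (Fin n) → ℝ := fun x => G (Real.log ‖x‖) with hg_def
  have hg : Smooth₀ g := Smooth₀.radial hG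
  have hg0 : ∀ x, x ≠ 0 → x ∉ annulus n (T + 1) → g x = 0 := fun x hx₀ hx => by
    simp only [hg_def, hG_def, hη.radial_eq_zero hx₀ hx, mul_zero]
  set FE : EuclideanSpace ℝ (Fin n) → ℝ := fun x =>
    (∑ i, pd i (pd i (kinetic U)) x - ∑ i, U i x * pd i (head U P) x) * g x -
      kinetic U x * (∑ i, pd i (pd i g) x) - head U P x * ∑ i, U i x * pd i g x with hFE
  set FP : EuclideanSpace ℝ (Fin n) → ℝ := fun x => ∑ i, ∑ j, U i x * U j x * pd i (pd j g) x +
      P x * ∑ i, pd i (pd i g) x with hFP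
  obtain ⟨hFEi, hFE0⟩ := h.green hg hg0 h.smooth_kinetic h.smooth_head (F := FE) fun _ _ => rfl
  obtain ⟨hFPi, hFP0⟩ := h.weak_pressure hg hg0 (F := FP) fun _ _ => rfl
  obtain ⟨hIi, hIb⟩ := integrable_and_integral_shell_le (n := n) le_rfl (Real.exp_pos (-(T + 1)))
  obtain ⟨hOi, hOb⟩ := integrable_and_integral_shell_le (n := n) le_rfl (Real.exp_pos T)
  rw [Nat.sub_self, pow_zero, one_mul] at hIb hOb
  set c : ℝ := (C / 2) * ((C ^ 2 + 2 * n * C ^ 2 + n * C') + (C ^ 2 + C')) +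
        (2⁻¹ * C ^ 2 * n + 2⁻¹ * C ^ 2 + (2⁻¹ * C ^ 2 + C') * C) with hc_def
  have hc : 0 ≤ c := by positivity
  have hSi : Integrable fun x => innerShell n n T x + outerShell n n T x := hIi.add hOi
  have hSb : ∫ x, (innerShell n n T x + outerShell n n T x) ≤
      2 * (Real.exp 1 ^ n * volume.real (Metric.ball (0 : EuclideanSpace ℝ (Fin n)) 1)) := by
    refine (integral_add hIi hOi).trans_le ?_
    linarith
  have hsum : Integrable fun x => FE x + C / 2 * FP x := hFEi.add (hFPi.const_mul _)
  have hdom : Integrable fun x => FE x + C / 2 * FP x +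
      c * (K * (innerShell n n T x + outerShell n n T x)) :=
    hsum.add ((hSi.const_mul K).const_mul c)
  rw [← integral_indicator (isClosed_annulus T).measurableSet]
  refine (integral_mono_of_nonneg (ae_of_all _ fun x =>
    indicator_nonneg (fun _ _ => weightedEnergy_nonneg) x) hdom ?_).trans ?_
  · filter_upwards [ae_ne_zero] with x hx
    have hr := norm_pos_iff.2 hx
    have he : Real.exp (a * Real.log ‖x‖) = (‖x‖ ^ (n - 4))⁻¹ := by
      rw [show a * Real.log ‖x‖ = -(((n - 4 : ℕ) : ℝ) * Real.log ‖x‖) by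
        rw [Nat.cast_sub (by omega), ha]; push_cast; ring, Real.exp_neg, Real.exp_nat_mul,
        Real.exp_log hr]
    have hw : Real.exp (a * Real.log ‖x‖) * (‖x‖ ^ 2)⁻¹ ^ 2 = (‖x‖ ^ n)⁻¹ := by
      rw [he, inv_pow, ← mul_inv, ← pow_mul, ← pow_add]
      congr 2
      omega
    have hf : weightedEnergy U x = (∑ j, U j x * U j x) *
        ((‖x‖ ^ 2)⁻¹ * Real.exp (a * Real.log ‖x‖)) +
        (∑ i, ∑ j, pd i (U j) x ^ 2) * Real.exp (a * Real.log ‖x‖) := by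
      rw [weightedEnergy, he, ← mul_inv, ← pow_add, show 2 + (n - 4) = n - 2 by omega]
      rfl
    have hη0 := hη.nonneg (Real.log ‖x‖)
    have hind : (annulus n T).indicator (weightedEnergy U) x ≤
        weightedEnergy U x * η (Real.log ‖x‖) := by
      by_cases hxA : x ∈ annulus n T
      · rw [indicator_of_mem hxA, hη.eq_one, mul_one]
        exact abs_le.2 ⟨(Real.le_log_iff_exp_le hr).2 hxA.1, (Real.log_le_iff_le_exp hr).2 hxA.2⟩
      · rw [indicator_of_notMem hxA]
        exact mul_nonneg weightedEnergy_nonneg hη0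
    refine hind.trans ?_
    rw [hf]
    have hd := hη.abs_deriv_mul_le hx n
    rw [← hw] at hd
    have hG1 : deriv G (Real.log ‖x‖) = _ := congrFun (hη.deriv_exp_mul a) _
    have hG2 : deriv (deriv G) (Real.log ‖x‖) = _ := congrFun (hη.deriv_deriv_exp_mul a) _
    have hlap : ∑ i, pd i (pd i g) x = _ := laplacian_radial hG hx
    have hhess : ∑ i, ∑ j, U i x * U j x * pd i (pd j g) x = _ :=
      hessian_radial hG hx (WithLp.toLp 2 fun i => U i x)
    have hnorm : ‖(WithLp.toLp 2 fun i => U i x : EuclideanSpace ℝ (Fin n))‖ ^ 2 =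
        ∑ j, U j x * U j x := by
      rw [EuclideanSpace.norm_sq_eq]
      exact Finset.sum_congr rfl fun i _ => by rw [Real.norm_eq_abs, sq_abs, sq]
    have hdrift : ∑ i, U i x * pd i g x =
        deriv G (Real.log ‖x‖) * (∑ i, U i x * x i) * (‖x‖ ^ 2)⁻¹ := by
      simp_rw [hg_def, pd_radial hG _ hx]
      rw [Finset.mul_sum, Finset.sum_mul]
      exact Finset.sum_congr rfl fun i _ => by ring
    rw [hG1, hG2] at hlap
    rw [hG1, hG2, hnorm] at hhess
    rw [hG1] at hdrift
    refine weighted_energy_le hn' (Real.exp_pos _).le (by positivity) hη0 hC0 hC'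
      (Finset.sum_nonneg fun _ _ => mul_self_nonneg _) (hU x hx) (hC x hx) (hP x hx)
      hd.1 hd.2 (hH x hx) ?_ ?_
    · simp only [hFP]
      rw [hhess, hlap]
    · simp only [hFE]
      rw [h.laplacian_kinetic_sub hx, hlap, hdrift]
      rfl
  · rw [integral_add hsum ((hSi.const_mul K).const_mul c),
      integral_add hFEi (hFPi.const_mul _), integral_const_mul, integral_const_mul,
      integral_const_mul, hFE0, hFP0, mul_zero, zero_add, zero_add]
    gcongr

lemma integrable_weightedEnergy [NeZero n] (h : SteadyNS U P) (hn : 5 ≤ n)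
    {C C' : ℝ} (hC' : 0 ≤ C') (hU : ∀ x, x ≠ 0 → ∑ j, U j x * U j x ≤ C ^ 2 * (‖x‖ ^ 2)⁻¹)
    (hC : ∀ x, x ≠ 0 → |∑ i, U i x * x i| ≤ C) (hP : ∀ x, x ≠ 0 → |P x| ≤ C' * (‖x‖ ^ 2)⁻¹) :
    Integrable (weightedEnergy U) := by
  obtain ⟨K, hK⟩ := exists_isPlateau
  choose η hη using hK
  have hcover : AECover volume atTop (fun k : ℕ => annulus n k) := by
    refine ⟨?_, fun k => (isClosed_annulus _).measurableSet⟩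
    filter_upwards [ae_ne_zero] with x hx
    filter_upwards [eventually_ge_atTop ⌈|Real.log ‖x‖|⌉₊] with k hk
    by_contra hxk
    exact absurd (lt_abs_log_norm_of_notMem_annulus hx hxk) (not_lt.2 (Nat.ceil_le.1 hk))
  have hcont : ContinuousOn (weightedEnergy U) {x | x ≠ 0} := by
    have hpow : ∀ m : ℕ, ∀ x ∈ {x : EuclideanSpace ℝ (Fin n) | x ≠ 0}, ‖x‖ ^ m ≠ 0 :=
      fun m x hx => pow_ne_zero m (norm_ne_zero_iff.2 hx)
    have h1 : Smooth₀ fun x => ∑ j, U j x * U j x :=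
      Smooth₀.sum fun j => (h.smooth_velocity j).mul (h.smooth_velocity j)
    have h2 : Smooth₀ fun x => ∑ i, ∑ j, pd i (U j) x ^ 2 :=
      Smooth₀.sum fun i => Smooth₀.sum fun j => ContDiffOn.pow ((h.smooth_velocity j).pd i) 2
    exact (ContDiffOn.continuousOn h1 |>.div (by fun_prop) (hpow _)).add
      (ContDiffOn.continuousOn h2 |>.div (by fun_prop) (hpow _))
  have hbound := fun k : ℕ =>
    h.setIntegral_annulus_weightedEnergy_le hn hC' hU hC hP (hη k k.cast_nonneg)
  refine hcover.integrable_of_integral_bounded_of_nonneg_ae _ (fun k => ?_)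
    (ae_of_all _ fun x => weightedEnergy_nonneg) (Eventually.of_forall hbound)
  exact (hcont.mono fun x hx => ne_zero_of_mem_annulus hx).integrableOn_compact
      (isCompact_annulus _)

end SteadyNS

/-- **Weighted energy integrability, n ≥ 5.**  If `(u, p)` is a smooth solution of the
steady Navier-Stokes equations on `ℝⁿ \ {0}`, `n ≥ 5`, with `|u(x)| ≤ C/|x|` and the
pressure normalized so that `|p(x)| ≤ C'/|x|²`, then
`∫_{ℝⁿ} (|u(x)|² |x|^{2-n} + |∇u(x)|² |x|^{4-n}) dx < ∞`,
where `|∇u|² = ∑_{i,j} (∂ᵢuⱼ)²`. -/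
theorem steady_NS_weighted_energy_integrable {n : ℕ} (hn : 5 ≤ n)
    (u : EuclideanSpace ℝ (Fin n) → EuclideanSpace ℝ (Fin n))
    (p : EuclideanSpace ℝ (Fin n) → ℝ)
    (hu : ContDiffOn ℝ (⊤ : ℕ∞) u {x : EuclideanSpace ℝ (Fin n) | x ≠ 0})
    (hp : ContDiffOn ℝ (⊤ : ℕ∞) p {x : EuclideanSpace ℝ (Fin n) | x ≠ 0})
    (hNS : ∀ x : EuclideanSpace ℝ (Fin n), x ≠ 0 → ∀ j : Fin n,
      -(∑ i : Fin n, fderiv ℝ (fun y => fderiv ℝ (fun z => u z j) y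
            (EuclideanSpace.single i 1)) x (EuclideanSpace.single i 1)) +
        (∑ i : Fin n, u x i * fderiv ℝ (fun z => u z j) x (EuclideanSpace.single i 1)) +
        fderiv ℝ p x (EuclideanSpace.single j 1) = 0)
    (hdiv : ∀ x : EuclideanSpace ℝ (Fin n), x ≠ 0 →
      ∑ i : Fin n, fderiv ℝ (fun z => u z i) x (EuclideanSpace.single i 1) = 0)
    (C : ℝ) (hC : 0 < C)
    (hbound : ∀ x : EuclideanSpace ℝ (Fin n), x ≠ 0 → ‖u x‖ ≤ C / ‖x‖)
    (C' : ℝ) (hC' : 0 < C')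
    (hpbound : ∀ x : EuclideanSpace ℝ (Fin n), x ≠ 0 → |p x| ≤ C' / ‖x‖ ^ 2) :
    MeasureTheory.Integrable
      (fun x : EuclideanSpace ℝ (Fin n) =>
        ‖u x‖ ^ 2 / ‖x‖ ^ (n - 2) +
        (∑ i : Fin n, ∑ j : Fin n,
          (fderiv ℝ (fun z => u z j) x (EuclideanSpace.single i 1)) ^ 2) / ‖x‖ ^ (n - 4))
      MeasureTheory.volume := by
  have : NeZero n := ⟨by omega⟩
  have h : SteadyNS (fun j z => u z j) p :=
    ⟨fun j => (EuclideanSpace.proj (𝕜 := ℝ) j).contDiff.comp_contDiffOn hu, hp, hNS, hdiv⟩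
  have hnorm : ∀ x, ‖u x‖ ^ 2 = ∑ j, u x j * u x j := fun x => by
    rw [EuclideanSpace.norm_sq_eq]
    exact Finset.sum_congr rfl fun i _ => by rw [Real.norm_eq_abs, sq_abs, sq]
  have key := h.integrable_weightedEnergy hn hC'.le (C := C)
    (fun x hx => by
      rw [← hnorm, ← div_eq_mul_inv, ← div_pow]
      exact pow_le_pow_left₀ (norm_nonneg _) (hbound x hx) 2)
    (fun x hx => by
      have h1 : ∑ i, u x i * x i = inner ℝ x (u x) := by
        rw [PiLp.inner_apply]
        exact Finset.sum_congr rfl fun i _ => by simp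
      rw [h1]
      refine (abs_real_inner_le_norm _ _).trans ?_
      rw [mul_comm]
      exact (le_div_iff₀ (norm_pos_iff.2 hx)).1 (hbound x hx))
    (fun x hx => by
      rw [← div_eq_mul_inv]
      exact hpbound x hx)
  refine key.congr (ae_of_all _ fun x => ?_)
  simp only [SteadyNS.weightedEnergy, hnorm]
  rfl
end
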